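/- arXiv:1603.06764 — 4 statements merged into one kernel-verified Lean document; each statement's English description precedes it below -/
import Mathlib

section
/- Let n ≥ 1 and let c_1, …, c_{2n−1} be a finite sequence each of whose entries is colored red or blue, containing exactly n−1 red entries and n blue entries. Suppose the first entry c_1 is red. Then there exists a least index j such that 1 + #{k ≤ j : c_k is red} = #{k ≤ j : c_k is blue} (i.e., counting one additional red point preceding the sequence, the first j entries are balanced in color); this least index satisfies 3 ≤ j ≤ 2n−1, and both c_{j−1} and c_j are blue. (If instead c_1 is blue, the least such index is j = 1.) -/
/-- Counting one additional red entry preceding the sequence, the entries `c 1, …, c j`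
are balanced in color: `1 + #{k ≤ j : c k red} = #{k ≤ j : c k blue}`.
Here `c k = true` means the `k`-th entry is red and `c k = false` means it is blue. -/
def balancedUpTo (c : ℕ → Bool) (j : ℕ) : Prop :=
  1 + ((Finset.Icc 1 j).filter fun k => c k = true).card
    = ((Finset.Icc 1 j).filter fun k => c k = false).card

theorem card_filter_Icc_one_succ (p : ℕ → Prop) [DecidablePred p] (j : ℕ) :
    ((Finset.Icc 1 (j + 1)).filter p).card
      = ((Finset.Icc 1 j).filter p).card + if p (j + 1) then 1 else 0 := by
  rw [← Finset.insert_Icc_right_eq_Icc_add_one (by omega), Finset.filter_insert]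
  split_ifs <;> simp

theorem balancedUpTo_one {c : ℕ → Bool} : balancedUpTo c 1 ↔ c 1 = false := by
  cases h : c 1 <;> simp [balancedUpTo, Finset.filter_singleton, h]

theorem not_balancedUpTo_zero (c : ℕ → Bool) : ¬ balancedUpTo c 0 := by
  simp [balancedUpTo]

/-- As long as no balanced index has occurred, the red entries (with the additional one)
strictly outnumber the blue ones. -/
theorem card_blue_lt_of_forall_not_balancedUpTo {c : ℕ → Bool} {i : ℕ}
    (h : ∀ k ≤ i, ¬ balancedUpTo c k) :
    ((Finset.Icc 1 i).filter fun k => c k = false).card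
      < 1 + ((Finset.Icc 1 i).filter fun k => c k = true).card := by
  induction i with
  | zero => simp
  | succ i ih =>
    have hi := ih fun k hk => h k (by omega)
    have hb := h (i + 1) le_rfl
    unfold balancedUpTo at hb
    rw [card_filter_Icc_one_succ, card_filter_Icc_one_succ] at hb ⊢
    cases hc : c (i + 1) <;> simp [hc] at hb ⊢ <;> omega

/-- The first balanced index is reached by a blue entry, and, unless it is the very first
index, the entry before it is blue as well. -/
theorem eq_false_of_first_balancedUpTo {c : ℕ → Bool} {j : ℕ} (hj : balancedUpTo c (j + 2))
    (hmin : ∀ k < j + 2, ¬ balancedUpTo c k) : c (j + 1) = false ∧ c (j + 2) = false := by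
  have h0 := card_blue_lt_of_forall_not_balancedUpTo fun k (hk : k ≤ j) => hmin k (by omega)
  have h1 := card_blue_lt_of_forall_not_balancedUpTo fun k (hk : k ≤ j + 1) => hmin k (by omega)
  unfold balancedUpTo at hj
  simp only [card_filter_Icc_one_succ _ (j + 1), card_filter_Icc_one_succ _ j] at h1 hj
  cases hc : c (j + 1) <;> cases hd : c (j + 2) <;> simp [hc, hd] at h1 hj ⊢ <;> omega

/-- Lemma 2.1(i), combinatorial content: a sequence `c 1, …, c (2n−1)` with `n−1` red and
`n` blue entries, starting with a red entry, has a least balanced index `j`; it satisfies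
`3 ≤ j ≤ 2n−1` and both `c (j−1)` and `c j` are blue.  If instead the first entry is blue,
the least balanced index is `j = 1`. -/
theorem stmt0 (n : ℕ) (hn : 1 ≤ n) (c : ℕ → Bool)
    (hred : ((Finset.Icc 1 (2 * n - 1)).filter fun k => c k = true).card = n - 1)
    (hblue : ((Finset.Icc 1 (2 * n - 1)).filter fun k => c k = false).card = n) :
    (c 1 = true →
      ∃ j, 1 ≤ j ∧ j ≤ 2 * n - 1 ∧ balancedUpTo c j ∧
        (∀ j', 1 ≤ j' → j' < j → ¬ balancedUpTo c j') ∧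
        3 ≤ j ∧ c (j - 1) = false ∧ c j = false) ∧
    (c 1 = false →
      balancedUpTo c 1 ∧ ∀ j', 1 ≤ j' → j' < 1 → ¬ balancedUpTo c j') := by
  classical
  refine ⟨fun hc => ?_, fun hc => ⟨balancedUpTo_one.2 hc, by omega⟩⟩
  have hlast : balancedUpTo c (2 * n - 1) := by
    unfold balancedUpTo
    omega
  have hex : ∃ j, balancedUpTo c j := ⟨_, hlast⟩
  obtain ⟨j, hj, hmin, hle⟩ : ∃ j, balancedUpTo c j ∧ (∀ k < j, ¬ balancedUpTo c k) ∧
      j ≤ 2 * n - 1 :=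
    ⟨Nat.find hex, Nat.find_spec hex, fun _ => Nat.find_min hex, Nat.find_le hlast⟩
  match j with
  | 0 => exact absurd hj (not_balancedUpTo_zero c)
  | 1 => simp [balancedUpTo_one, hc] at hj
  | j + 2 =>
    obtain ⟨hb, hb'⟩ := eq_false_of_first_balancedUpTo hj hmin
    have hj0 : j ≠ 0 := by
      rintro rfl
      simp [hc] at hb
    exact ⟨j + 2, by omega, hle, hj, fun k _ => hmin k, by omega, hb, hb'⟩
end

section
/- Let n ≥ 1 and let c_1, …, c_{2n} be a finite sequence each of whose entries is colored red or blue, containing exactly n red entries and n blue entries, and suppose the last entry c_{2n} is red and the first entry c_1 is red. Then there exists a least index j such that 1 + #{k ≤ j : c_k is red} = #{k ≤ j : c_k is blue} (i.e., counting one additional red point preceding the sequence, the first j entries are balanced in color); this least index satisfies 3 ≤ j ≤ 2n−1, and both c_{j−1} and c_j are blue. (If instead c_1 is blue, the least such index is j = 1.) -/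
/-- Appending the entry `c (j + 1)` raises the count of its own color by one. -/
theorem card_filter_Icc_succ (c : ℕ → Bool) (b : Bool) (j : ℕ) :
    ((Finset.Icc 1 (j + 1)).filter fun k => c k = b).card
      = ((Finset.Icc 1 j).filter fun k => c k = b).card + if c (j + 1) = b then 1 else 0 := by
  rw [← Finset.insert_Icc_right_eq_Icc_add_one (by omega), Finset.filter_insert]
  split_ifs <;> simp

/-- Before the first balanced index, blue entries never outnumber red ones. -/
theorem card_blue_le_card_red_of_not_balancedUpTo (c : ℕ → Bool) (m : ℕ)
    (h : ∀ j, 1 ≤ j → j ≤ m → ¬ balancedUpTo c j) :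
    ((Finset.Icc 1 m).filter fun k => c k = false).card
      ≤ ((Finset.Icc 1 m).filter fun k => c k = true).card := by
  induction m with
  | zero => simp
  | succ m ih =>
    have hm := h (m + 1) (by omega) le_rfl
    have hle := ih fun j h1 h2 => h j h1 (by omega)
    simp only [balancedUpTo, card_filter_Icc_succ] at hm ⊢
    cases hc : c (m + 1) <;> simp [hc] at hm ⊢ <;> omega

/-- Lemma 2.1(ii), combinatorial content: a sequence `c 1, …, c (2n)` with `n` red and
`n` blue entries, whose last entry is red and whose first entry is red, has a least
balanced index `j`; it satisfies `3 ≤ j ≤ 2n−1` and both `c (j−1)` and `c j` are blue.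
If instead the first entry is blue, the least balanced index is `j = 1`. -/
theorem stmt1 (n : ℕ) (hn : 1 ≤ n) (c : ℕ → Bool)
    (hred : ((Finset.Icc 1 (2 * n)).filter fun k => c k = true).card = n)
    (hblue : ((Finset.Icc 1 (2 * n)).filter fun k => c k = false).card = n)
    (hlast : c (2 * n) = true) :
    (c 1 = true →
      ∃ j, 1 ≤ j ∧ j ≤ 2 * n - 1 ∧ balancedUpTo c j ∧
        (∀ j', 1 ≤ j' → j' < j → ¬ balancedUpTo c j') ∧
        3 ≤ j ∧ c (j - 1) = false ∧ c j = false) ∧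
    (c 1 = false →
      balancedUpTo c 1 ∧ ∀ j', 1 ≤ j' → j' < 1 → ¬ balancedUpTo c j') := by
  classical
  constructor
  · intro hfirst
    have hpen : balancedUpTo c (2 * n - 1) := by
      obtain ⟨m, hm⟩ : ∃ m, 2 * n = m + 1 := ⟨2 * n - 1, by omega⟩
      rw [hm] at hred hblue hlast
      rw [card_filter_Icc_succ] at hred hblue
      simp only [hlast, if_true, Bool.true_eq_false, if_false] at hred hblue
      rw [hm, Nat.add_sub_cancel]
      unfold balancedUpTo
      omega
    have hex : ∃ j, 1 ≤ j ∧ balancedUpTo c j := ⟨2 * n - 1, by omega, hpen⟩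
    obtain ⟨j, ⟨hj, hbal⟩, hmin⟩ :
        ∃ j, (1 ≤ j ∧ balancedUpTo c j) ∧ ∀ i, 1 ≤ i → i < j → ¬ balancedUpTo c i :=
      ⟨Nat.find hex, Nat.find_spec hex, fun i h1 h2 h3 => Nat.find_min hex h2 ⟨h1, h3⟩⟩
    have hjle : j ≤ 2 * n - 1 :=
      not_lt.mp fun h => hmin _ (by omega) h hpen
    have hj1 : j ≠ 1 := by
      rintro rfl
      simp [balancedUpTo, Finset.filter_singleton, hfirst] at hbal
    obtain ⟨i, rfl⟩ : ∃ i, j = i + 2 := ⟨j - 2, by omega⟩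
    have hle₀ := card_blue_le_card_red_of_not_balancedUpTo c i
      fun k h1 h2 => hmin k h1 (by omega)
    have hle₁ := card_blue_le_card_red_of_not_balancedUpTo c (i + 1)
      fun k h1 h2 => hmin k h1 (by omega)
    have hcount := hbal
    simp only [balancedUpTo, card_filter_Icc_succ c _ (i + 1)] at hcount
    have hblue₂ : c (i + 2) = false := by
      by_contra hc
      simp only [Bool.not_eq_false] at hc
      simp only [hc, Bool.true_eq_false, if_true, if_false] at hcount
      omega
    have hblue₁ : c (i + 1) = false := by
      by_contra hc
      simp only [Bool.not_eq_false] at hc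
      simp only [card_filter_Icc_succ, hblue₂, hc, Bool.false_eq_true, Bool.true_eq_false,
        if_true, if_false] at hcount
      omega
    have hi : i ≠ 0 := by
      rintro rfl
      simp [hfirst] at hblue₁
    exact ⟨i + 2, hj, hjle, hbal, hmin, by omega, hblue₁, hblue₂⟩
  · intro hfirst
    refine ⟨?_, fun j h1 h2 => by omega⟩
    simp [balancedUpTo, Finset.filter_singleton, hfirst]
end

section
/- Let n ≥ 1 and let c be an assignment of colors red/blue to the residues ZMod(2n), regarded as 2n points in clockwise circular order, with exactly n red and exactly n blue indices. For each red index i, define J(i) to be the first index j encountered strictly after i in clockwise circular order such that the clockwise cyclic interval from i to j (inclusive of both endpoints) contains equally many red and blue indices. Then J(i) exists for every red index i, the index J(i) is blue, and the map i ↦ J(i) is injective on the set of red indices; consequently it is a bijection from the set of red indices onto the set of blue indices. -/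
open scoped Classical

noncomputable section

/-- The clockwise cyclic interval `{i, i+1, …, j}` in `ZMod (2n)`, inclusive of both
endpoints. -/
def cycInt (n : ℕ) (i j : ZMod (2 * n)) : Finset (ZMod (2 * n)) :=
  (Finset.range ((j - i).val + 1)).image fun t => i + (t : ZMod (2 * n))

/-- The clockwise cyclic interval from `i` to `j` contains equally many red and blue
indices. -/
def BalInt (n : ℕ) (red blue : Finset (ZMod (2 * n))) (i j : ZMod (2 * n)) : Prop :=
  (cycInt n i j ∩ red).card = (cycInt n i j ∩ blue).card

/-- `j = J(i)`: the first index strictly after `i` in clockwise circular order such that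
the clockwise cyclic interval from `i` to `j` contains equally many red and blue
indices. -/
def IsJ (n : ℕ) (red blue : Finset (ZMod (2 * n))) (i j : ZMod (2 * n)) : Prop :=
  j ≠ i ∧ BalInt n red blue i j ∧
    ∀ j', j' ≠ i → (j' - i).val < (j - i).val → ¬ BalInt n red blue i j'

/-- The signed number of red minus non-red indices among the `k` indices
`i, i+1, …, i+k-1`. -/
def redExcess {m : ℕ} (red : Finset (ZMod m)) (i : ZMod m) (k : ℕ) : ℤ :=
  ∑ t ∈ Finset.range k, if i + (t : ZMod m) ∈ red then 1 else -1

theorem redExcess_succ {m : ℕ} (red : Finset (ZMod m)) (i : ZMod m) (k : ℕ) :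
    redExcess red i (k + 1) =
      redExcess red i k + if i + (k : ZMod m) ∈ red then 1 else -1 :=
  Finset.sum_range_succ _ _

theorem redExcess_one {m : ℕ} {red : Finset (ZMod m)} {i : ZMod m} (hi : i ∈ red) :
    redExcess red i 1 = 1 := by
  simp [redExcess, hi]

theorem redExcess_add {m : ℕ} (red : Finset (ZMod m)) (i : ZMod m) (d k : ℕ) :
    redExcess red i (d + k) = redExcess red i d + redExcess red (i + (d : ZMod m)) k := by
  simp only [redExcess, Finset.sum_range_add, Nat.cast_add, add_assoc]

theorem redExcess_pos {m : ℕ} {red : Finset (ZMod m)} {i : ZMod m} (hi : i ∈ red) {k : ℕ}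
    (h : ∀ l, 1 ≤ l → l < k → redExcess red i (l + 1) ≠ 0) {l : ℕ} (hl : 1 ≤ l) (hlk : l ≤ k) :
    0 < redExcess red i l := by
  induction l, hl using Nat.le_induction with
  | base => simp [redExcess_one hi]
  | succ l hl ih =>
    have h₀ := ih (by omega)
    have h₁ := h l hl (by omega)
    have h₂ := redExcess_succ red i l
    split_ifs at h₂ <;> omega

theorem natCast_injOn_range {m k : ℕ} (hk : k ≤ m) (i : ZMod m) :
    Set.InjOn (fun t : ℕ => i + (t : ZMod m)) (Finset.range k) := by
  intro a ha b hb hab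
  simp only [Finset.coe_range, Set.mem_Iio] at ha hb
  have h := add_left_cancel hab
  rw [ZMod.natCast_eq_natCast_iff'] at h
  rwa [Nat.mod_eq_of_lt (by omega), Nat.mod_eq_of_lt (by omega)] at h

theorem mem_blue_iff {α : Type*} {red blue : Finset α} (hdisj : Disjoint red blue)
    (hcover : ∀ i, i ∈ red ∨ i ∈ blue) (x : α) : x ∈ blue ↔ x ∉ red :=
  ⟨fun hb hr => Finset.disjoint_left.1 hdisj hr hb, fun h => (hcover x).resolve_left h⟩

theorem cycInt_eq_image (n : ℕ) (i j : ZMod (2 * n)) :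
    cycInt n i j =
      (Finset.range ((j - i).val + 1)).image fun t : ℕ => i + (t : ZMod (2 * n)) := by
  ext x
  simp [cycInt, eq_neg_add_iff_add_eq]

theorem balInt_iff {n : ℕ} (hn : 1 ≤ n) {red blue : Finset (ZMod (2 * n))}
    (hblue : ∀ x, x ∈ blue ↔ x ∉ red) (i j : ZMod (2 * n)) :
    BalInt n red blue i j ↔ redExcess red i ((j - i).val + 1) = 0 := by
  have : NeZero (2 * n) := ⟨by omega⟩
  have hlt := ZMod.val_lt (j - i)
  have hsum : redExcess red i ((j - i).val + 1) =
      ∑ x ∈ cycInt n i j, if x ∈ red then (1 : ℤ) else -1 := by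
    rw [cycInt_eq_image, Finset.sum_image (natCast_injOn_range (by omega) i), redExcess]
  have hr : cycInt n i j ∩ red = (cycInt n i j).filter (· ∈ red) := by
    ext x; simp
  have hb : cycInt n i j ∩ blue = (cycInt n i j).filter (· ∉ red) := by
    ext x; simp [hblue]
  rw [BalInt, hr, hb, hsum, Finset.sum_ite]
  simp only [Finset.sum_const, nsmul_eq_mul, mul_one, mul_neg]
  omega

theorem redExcess_two_mul {n : ℕ} (hn : 1 ≤ n) {red blue : Finset (ZMod (2 * n))}
    (hblue : ∀ x, x ∈ blue ↔ x ∉ red) (hcard : red.card = blue.card) (i : ZMod (2 * n)) :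
    redExcess red i (2 * n) = 0 := by
  have : NeZero (2 * n) := ⟨by omega⟩
  have hval : (((2 * n - 1 : ℕ) : ZMod (2 * n))).val = 2 * n - 1 :=
    ZMod.val_cast_of_lt (by omega)
  have h := balInt_iff hn hblue i (i + ((2 * n - 1 : ℕ) : ZMod (2 * n)))
  have huniv : cycInt n i (i + ((2 * n - 1 : ℕ) : ZMod (2 * n))) = Finset.univ := by
    rw [← Finset.card_eq_iff_eq_univ, cycInt_eq_image, add_sub_cancel_left, hval,
      Finset.card_image_of_injOn (natCast_injOn_range (by omega) i), Finset.card_range,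
      ZMod.card]
    omega
  rw [BalInt, huniv, Finset.univ_inter, Finset.univ_inter, add_sub_cancel_left, hval,
    Nat.sub_add_cancel (by omega)] at h
  exact h.1 hcard

theorem isJ_iff {n : ℕ} (hn : 1 ≤ n) {red blue : Finset (ZMod (2 * n))}
    (hblue : ∀ x, x ∈ blue ↔ x ∉ red) (i j : ZMod (2 * n)) :
    IsJ n red blue i j ↔ 1 ≤ (j - i).val ∧ redExcess red i ((j - i).val + 1) = 0 ∧
      ∀ l, 1 ≤ l → l < (j - i).val → redExcess red i (l + 1) ≠ 0 := by
  have : NeZero (2 * n) := ⟨by omega⟩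
  have hne : ∀ x : ZMod (2 * n), x ≠ i ↔ 1 ≤ (x - i).val := fun x => by
    rw [Nat.one_le_iff_ne_zero, Ne, Ne, ZMod.val_eq_zero, sub_eq_zero]
  simp only [IsJ, balInt_iff hn hblue, hne]
  refine and_congr_right fun _ => and_congr_right fun _ => ⟨fun h l hl hlt => ?_,
    fun h x hx hlt => h _ hx hlt⟩
  have hval : (i + (l : ZMod (2 * n)) - i).val = l := by
    rw [add_sub_cancel_left, ZMod.val_cast_of_lt (hlt.trans (ZMod.val_lt _))]
  simpa only [hval] using h (i + (l : ZMod (2 * n))) (by omega) (by omega)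

theorem exists_isJ {n : ℕ} (hn : 1 ≤ n) {red blue : Finset (ZMod (2 * n))}
    (hblue : ∀ x, x ∈ blue ↔ x ∉ red) (hcard : red.card = blue.card)
    {i : ZMod (2 * n)} (hi : i ∈ red) : ∃ j, IsJ n red blue i j ∧ j ∈ blue := by
  have hlast : 1 ≤ 2 * n - 1 ∧ redExcess red i (2 * n - 1 + 1) = 0 := by
    rw [Nat.sub_add_cancel (by omega)]
    exact ⟨by omega, redExcess_two_mul hn hblue hcard i⟩
  have hex : ∃ k, 1 ≤ k ∧ redExcess red i (k + 1) = 0 := ⟨_, hlast⟩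
  obtain ⟨hk, hzero⟩ := Nat.find_spec hex
  have hle : Nat.find hex ≤ 2 * n - 1 := Nat.find_min' hex hlast
  have hmin : ∀ l, 1 ≤ l → l < Nat.find hex → redExcess red i (l + 1) ≠ 0 :=
    fun l hl hlt h => Nat.find_min hex hlt ⟨hl, h⟩
  generalize Nat.find hex = k at *
  have hval : (i + (k : ZMod (2 * n)) - i).val = k := by
    rw [add_sub_cancel_left, ZMod.val_cast_of_lt (by omega)]
  refine ⟨i + (k : ZMod (2 * n)), (isJ_iff hn hblue _ _).2 ?_, (hblue _).2 fun hred => ?_⟩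
  · rw [hval]
    exact ⟨hk, hzero, hmin⟩
  · have hpos := redExcess_pos hi hmin hk le_rfl
    rw [redExcess_succ, if_pos hred] at hzero
    omega

theorem IsJ.val_le {n : ℕ} (hn : 1 ≤ n) {red blue : Finset (ZMod (2 * n))}
    (hblue : ∀ x, x ∈ blue ↔ x ∉ red) {i i' j : ZMod (2 * n)} (hi : i ∈ red)
    (h : IsJ n red blue i j) (h' : IsJ n red blue i' j) : (j - i).val ≤ (j - i').val := by
  have : NeZero (2 * n) := ⟨by omega⟩
  rw [isJ_iff hn hblue] at h h'
  by_contra! hlt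
  obtain ⟨d, hd⟩ := Nat.exists_eq_add_of_lt hlt
  have hstart : i + ((d + 1 : ℕ) : ZMod (2 * n)) = i' := by
    have hcast := congrArg (Nat.cast : ℕ → ZMod (2 * n)) hd
    push_cast [ZMod.natCast_zmod_val] at hcast ⊢
    linear_combination -hcast
  have hsplit := redExcess_add red i (d + 1) ((j - i').val + 1)
  rw [hstart, h'.2.1, show d + 1 + ((j - i').val + 1) = (j - i).val + 1 by omega, h.2.1] at hsplit
  have hpos := redExcess_pos hi h.2.2 (l := d + 1) (by omega) (by omega)
  omega

theorem IsJ.injective {n : ℕ} (hn : 1 ≤ n) {red blue : Finset (ZMod (2 * n))}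
    (hblue : ∀ x, x ∈ blue ↔ x ∉ red) {i i' j : ZMod (2 * n)} (hi : i ∈ red) (hi' : i' ∈ red)
    (h : IsJ n red blue i j) (h' : IsJ n red blue i' j) : i = i' := by
  have : NeZero (2 * n) := ⟨by omega⟩
  exact sub_right_injective <| ZMod.val_injective _ <|
    le_antisymm (h.val_le hn hblue hi h') (h'.val_le hn hblue hi' h)

/-- Procedure J-PAIRS (Lemma 3.4): for a 2-coloring of `ZMod (2n)` with `n` red and `n`
blue indices, the point `J(i)` exists for every red index `i`, is blue, and the map
`i ↦ J(i)` is injective on the red indices; consequently it is a bijection from the red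
indices onto the blue indices. -/
theorem stmt2 (n : ℕ) (hn : 1 ≤ n)
    (red blue : Finset (ZMod (2 * n)))
    (hdisj : Disjoint red blue)
    (hcover : ∀ i : ZMod (2 * n), i ∈ red ∨ i ∈ blue)
    (hr : red.card = n) (hb : blue.card = n) :
    (∀ i ∈ red, ∃ j, IsJ n red blue i j ∧ j ∈ blue) ∧
    (∀ i ∈ red, ∀ i' ∈ red, ∀ j, IsJ n red blue i j → IsJ n red blue i' j → i = i') ∧
    (∀ b ∈ blue, ∃ i ∈ red, IsJ n red blue i b) := by
  have hblue := mem_blue_iff hdisj hcover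
  have hex : ∀ i ∈ red, ∃ j, IsJ n red blue i j ∧ j ∈ blue :=
    fun i hi => exists_isJ hn hblue (hr.trans hb.symm) hi
  refine ⟨hex, fun i hi i' hi' j h h' => h.injective hn hblue hi hi' h', fun b hbb => ?_⟩
  choose! J hJ hJblue using hex
  obtain ⟨i, hi, rfl⟩ := Finset.surjOn_of_injOn_of_card_le J hJblue
    (fun i hi i' hi' h => (hJ i hi).injective hn hblue hi hi' (h ▸ hJ i' hi'))
    (hb.trans hr.symm).le hbb
  exact ⟨i, hi, hJ i hi⟩

end
end

section
/- Let S = R ∪ B be a bicolored point set in general position with |R| = |B| = n ≥ 1, let r be a red point on the boundary of CH(S), and suppose there is a blue point b on the boundary of CH(S) such that the configuration (S, r, b) is non-special. Then there exists a 1-plane Hamiltonian alternating path on S with endpoints r and b having at most n − r(S) crossings (and here r(S) = b(S), since the boundary of CH(S) contains points of both colors). -/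
open scoped Classical

noncomputable section

/-- Points of the plane. -/
abbrev Pt := ℝ × ℝ

/-- Orientation determinant of the ordered triple `(a, b, c)`. -/
def det2 (a b c : Pt) : ℝ :=
  (b.1 - a.1) * (c.2 - a.2) - (b.2 - a.2) * (c.1 - a.1)

/-- Two closed segments cross: some point lies in the relative interior of both. -/
def SegCross (e f : Pt × Pt) : Prop :=
  ∃ x : Pt, x ∈ openSegment ℝ e.1 e.2 ∧ x ∈ openSegment ℝ f.1 f.2

/-- Number of crossings (unordered pairs of crossing edges) among a list of edges. -/
def crossNum (es : List (Pt × Pt)) : ℕ :=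
  ((Finset.range es.length ×ˢ Finset.range es.length).filter
    (fun ij => ij.1 < ij.2 ∧
      SegCross (es.getD ij.1 ((0, 0), (0, 0))) (es.getD ij.2 ((0, 0), (0, 0))))).card

/-- Number of other edges crossing the `i`-th edge of the list. -/
def edgeCrossCount (es : List (Pt × Pt)) (i : ℕ) : ℕ :=
  ((Finset.range es.length).filter (fun j => j ≠ i ∧
      SegCross (es.getD i ((0, 0), (0, 0))) (es.getD j ((0, 0), (0, 0))))).card

/-- Every edge is crossed by at most one other edge. -/
def OnePlane (es : List (Pt × Pt)) : Prop :=
  ∀ i ∈ Finset.range es.length, edgeCrossCount es i ≤ 1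

/-- The edges of a path given by its list of vertices. -/
def pathEdges (l : List Pt) : List (Pt × Pt) := l.zip l.tail

/-- The edges of a cycle given by its list of vertices (including the wrap-around edge). -/
def cycleEdges (l : List Pt) : List (Pt × Pt) := l.zip (l.rotate 1)

/-- An edge joining a point of `R` to a point of `B`. -/
def Bichromatic (R B : Finset Pt) (e : Pt × Pt) : Prop :=
  (e.1 ∈ R ∧ e.2 ∈ B) ∨ (e.1 ∈ B ∧ e.2 ∈ R)

/-- A Hamiltonian alternating path on the bicolored point set `R ∪ B`
with endpoints `p` and `q`. -/
structure HamAltPath (R B : Finset Pt) (p q : Pt) where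
  verts : List Pt
  nodup : verts.Nodup
  cover : verts.toFinset = R ∪ B
  head_eq : verts.head? = some p
  last_eq : verts.getLast? = some q
  alt : ∀ e ∈ pathEdges verts, Bichromatic R B e

/-- A Hamiltonian alternating cycle on the bicolored point set `R ∪ B`. -/
structure HamAltCycle (R B : Finset Pt) where
  verts : List Pt
  nodup : verts.Nodup
  cover : verts.toFinset = R ∪ B
  alt : ∀ e ∈ cycleEdges verts, Bichromatic R B e

/-- A Hamiltonian alternating path with prescribed endpoints is optimum if it has the
minimum number of crossings among all such paths. -/
def OptimumPath (R B : Finset Pt) (p q : Pt) (P : HamAltPath R B p q) : Prop :=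
  ∀ Q : HamAltPath R B p q, crossNum (pathEdges P.verts) ≤ crossNum (pathEdges Q.verts)

/-- No three points of `S` are collinear. -/
def GeneralPosition (S : Finset Pt) : Prop :=
  ∀ p ∈ S, ∀ q ∈ S, ∀ r ∈ S, p ≠ q → p ≠ r → q ≠ r → ¬ Collinear ℝ ({p, q, r} : Set Pt)

/-- Every point of `S` is a vertex (extreme point) of its convex hull. -/
def ConvexPosition (S : Finset Pt) : Prop :=
  ∀ p ∈ S, p ∉ convexHull ℝ ((S.erase p : Finset Pt) : Set Pt)

/-- The points of `S` lying on the boundary of the convex hull of `S`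
(i.e. the extreme points of `S`). -/
def hullPts (S : Finset Pt) : Finset Pt :=
  S.filter fun p => p ∉ convexHull ℝ ((S.erase p : Finset Pt) : Set Pt)

/-- Cyclic successor on `Fin m`. -/
def cycSucc {m : ℕ} (hm : 0 < m) (i : Fin m) : Fin m :=
  ⟨(i.val + 1) % m, Nat.mod_lt _ hm⟩

/-- Cyclic predecessor on `Fin m`. -/
def cycPred {m : ℕ} (hm : 0 < m) (i : Fin m) : Fin m :=
  ⟨(i.val + (m - 1)) % m, Nat.mod_lt _ hm⟩

/-- `pt` lists points in convex position, in clockwise circular order: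
every index-increasing triple is clockwise oriented. -/
def CWList {m : ℕ} (pt : Fin m → Pt) : Prop :=
  Function.Injective pt ∧
    ∀ i j k : Fin m, i < j → j < k → det2 (pt i) (pt j) (pt k) < 0

/-- `pt` is a clockwise listing of the points of `S` on the boundary of `CH(S)`. -/
def IsHullList (S : Finset Pt) {m : ℕ} (pt : Fin m → Pt) : Prop :=
  CWList pt ∧ Finset.univ.image pt = hullPts S

/-- The number of runs of color `A` (with other color `C`) in the cyclic sequence `pt`:
a run starts at an `A`-point whose cyclic predecessor is a `C`-point; a completely
`A`-colored cycle forms a single run. -/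
def runCount {m : ℕ} (hm : 0 < m) (A C : Finset Pt) (pt : Fin m → Pt) : ℕ :=
  if ∀ i : Fin m, pt i ∈ A then 1
  else (Finset.univ.filter fun i : Fin m => pt i ∈ A ∧ pt (cycPred hm i) ∈ C).card

/-- `q` is the counterclockwise radial order of the points of `T` around `r`. -/
def CCWOrder (r : Pt) {k : ℕ} (q : Fin k → Pt) (T : Finset Pt) : Prop :=
  Function.Injective q ∧ Finset.univ.image q = T ∧
    ∀ i j : Fin k, i < j → 0 < det2 r (q i) (q j)

/-- `q` is the clockwise radial order of the points of `T` around `r`. -/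
def CWOrder (r : Pt) {k : ℕ} (q : Fin k → Pt) (T : Finset Pt) : Prop :=
  Function.Injective q ∧ Finset.univ.image q = T ∧
    ∀ i j : Fin k, i < j → det2 r (q i) (q j) < 0

/-- Counting one extra point of color `A` (the center), the initial segment
`q 0, …, q j` contains equally many points of color `A` and of color `C`. -/
def BalancedAt (A C : Finset Pt) {k : ℕ} (q : Fin k → Pt) (j : Fin k) : Prop :=
  1 + (Finset.univ.filter fun i : Fin k => i ≤ j ∧ q i ∈ A).card
    = (Finset.univ.filter fun i : Fin k => i ≤ j ∧ q i ∈ C).card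

/-- `j` is the first balanced index of the sequence `q`. -/
def FirstBalanced (A C : Finset Pt) {k : ℕ} (q : Fin k → Pt) (j : Fin k) : Prop :=
  BalancedAt A C q j ∧ ∀ j' : Fin k, j' < j → ¬ BalancedAt A C q j'

/-- The triple `(R ∪ B, r, b)` is a special configuration (Definition 2.2):
(i) both neighbors of `r` on the hull boundary are red and both neighbors of `b` are
blue; (ii) in the counterclockwise and clockwise radial orders around `r`, the first
balanced point is `b`; (iii) symmetrically around `b`, the first balanced point is `r`. -/
def SpecialConfig (R B : Finset Pt) (r b : Pt) : Prop :=
  r ∈ hullPts (R ∪ B) ∧ b ∈ hullPts (R ∪ B) ∧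
  (∀ (m : ℕ) (hm : 0 < m) (pt : Fin m → Pt), IsHullList (R ∪ B) pt →
    ∀ i : Fin m,
      (pt i = r → pt (cycPred hm i) ∈ R ∧ pt (cycSucc hm i) ∈ R) ∧
      (pt i = b → pt (cycPred hm i) ∈ B ∧ pt (cycSucc hm i) ∈ B)) ∧
  (∀ (k : ℕ) (q : Fin k → Pt),
      (CCWOrder r q ((R ∪ B).erase r) ∨ CWOrder r q ((R ∪ B).erase r)) →
      ∀ j : Fin k, FirstBalanced R B q j → q j = b) ∧
  (∀ (k : ℕ) (q : Fin k → Pt),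
      (CCWOrder b q ((R ∪ B).erase b) ∨ CWOrder b q ((R ∪ B).erase b)) →
      ∀ j : Fin k, FirstBalanced B R q j → q j = r)

/-- The unordered pair `{a, b}` occurs as an edge of the list `es`. -/
def IsEdgeOf (es : List (Pt × Pt)) (a b : Pt) : Prop := (a, b) ∈ es ∨ (b, a) ∈ es

/-- The clockwise cyclic interval of indices from `a` to `b`, inclusive. -/
def cycIdx {m : ℕ} (hm : 0 < m) (a b : Fin m) : Finset (Fin m) :=
  (Finset.range ((b.val + m - a.val) % m + 1)).image
    fun t => (⟨(a.val + t) % m, Nat.mod_lt _ hm⟩ : Fin m)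

/-! ### Affine functionals on the plane -/

/-- Affine real-valued functions on the plane. -/
def IsAff (f : Pt → ℝ) : Prop :=
  ∃ a b c : ℝ, ∀ w : Pt, f w = a * w.1 + b * w.2 + c

theorem isAff_det2 (u v : Pt) : IsAff (det2 u v) :=
  ⟨-(v.2 - u.2), v.1 - u.1, -(v.1 - u.1) * u.2 + (v.2 - u.2) * u.1,
    fun w => by simp only [det2]; ring⟩

theorem IsAff.lin {f g : Pt → ℝ} (hf : IsAff f) (hg : IsAff g) (α β γ : ℝ) :
    IsAff fun w => α * f w + β * g w + γ := by
  obtain ⟨a, b, c, h⟩ := hf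
  obtain ⟨a', b', c', h'⟩ := hg
  exact ⟨α * a + β * a', α * b + β * b', α * c + β * c' + γ, fun w => by
    simp only [h, h']; ring⟩

theorem IsAff.neg {f : Pt → ℝ} (hf : IsAff f) : IsAff fun w => -f w := by
  obtain ⟨a, b, c, h⟩ := hf
  exact ⟨-a, -b, -c, fun w => by simp only [h]; ring⟩

theorem IsAff.combo {f : Pt → ℝ} (hf : IsAff f) (x y : Pt) {α β : ℝ} (h : α + β = 1) :
    f (α • x + β • y) = α * f x + β * f y := by
  obtain ⟨a, b, c, hf⟩ := hf
  simp only [hf, Prod.fst_add, Prod.snd_add, Prod.smul_fst, Prod.smul_snd, smul_eq_mul]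
  linear_combination c * (-h)

theorem IsAff.eq_mul_det2 {f : Pt → ℝ} (hf : IsAff f) {s t : Pt} (hst : s ≠ t)
    (hs : f s = 0) (ht : f t = 0) : ∃ κ : ℝ, ∀ w, f w = κ * det2 s t w := by
  obtain ⟨a, b, c, hf⟩ := hf
  rw [hf] at hs ht
  by_cases h1 : t.1 - s.1 = 0
  · have h2 : t.2 - s.2 ≠ 0 := fun h2 => hst (Prod.ext (by linarith) (by linarith))
    refine ⟨-a / (t.2 - s.2), fun w => ?_⟩
    have hb : b = 0 := by
      have : b * (t.2 - s.2) = 0 := by linear_combination ht - hs - a * h1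
      exact (mul_eq_zero.1 this).resolve_right h2
    rw [hf, det2, h1]
    field_simp
    subst hb
    linear_combination (t.2 - s.2) * hs
  · refine ⟨b / (t.1 - s.1), fun w => ?_⟩
    rw [hf, det2]
    field_simp
    linear_combination (t.1 - s.1) * hs + (w.1 - s.1) * (ht - hs)

/-- The functional `w ↦ ⟪t - s, w - s⟫`. -/
def dotAt (s t : Pt) (w : Pt) : ℝ :=
  (t.1 - s.1) * (w.1 - s.1) + (t.2 - s.2) * (w.2 - s.2)

theorem isAff_dotAt (s t : Pt) : IsAff (dotAt s t) :=
  ⟨t.1 - s.1, t.2 - s.2, -(t.1 - s.1) * s.1 - (t.2 - s.2) * s.2,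
    fun w => by simp only [dotAt]; ring⟩

theorem dotAt_self (s t : Pt) : dotAt s t s = 0 := by simp [dotAt]

theorem dotAt_pos {s t : Pt} (h : s ≠ t) : 0 < dotAt s t t := by
  unfold dotAt
  by_contra hc
  have h1 : t.1 - s.1 = 0 := by nlinarith [mul_self_nonneg (t.1 - s.1), mul_self_nonneg (t.2 - s.2)]
  have h2 : t.2 - s.2 = 0 := by nlinarith [mul_self_nonneg (t.1 - s.1), mul_self_nonneg (t.2 - s.2)]
  exact h (Prod.ext (by linarith) (by linarith))

theorem det2_swap (a b c : Pt) : det2 b a c = -det2 a b c := by simp only [det2]; ring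

theorem det2_rot (a b c : Pt) : det2 b c a = det2 a b c := by simp only [det2]; ring

theorem det2_left (a b : Pt) : det2 a b a = 0 := by simp [det2]

theorem det2_right (a b : Pt) : det2 a b b = 0 := by simp only [det2]; ring

/-- A large multiple of `L` dominates `M` wherever `L` does not vanish. -/
theorem exists_tilt (S : Finset Pt) (L M : Pt → ℝ) :
    ∃ K : ℝ, ∀ w ∈ S, (0 < L w → 0 < K * L w + M w) ∧ (L w < 0 → K * L w + M w < 0) := by
  obtain ⟨K, hK⟩ := (S.image fun w => |M w| / |L w|).exists_le
  refine ⟨K + 1, fun w hw => ?_⟩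
  have h := hK _ (Finset.mem_image_of_mem _ hw)
  constructor
  · intro hL
    rw [div_le_iff₀ (abs_pos.2 hL.ne'), abs_of_pos hL] at h
    nlinarith [neg_abs_le (M w)]
  · intro hL
    rw [div_le_iff₀ (abs_pos.2 hL.ne), abs_of_neg hL] at h
    nlinarith [le_abs_self (M w)]

/-- Minimising the ratio `N / F` over a finite set. -/
theorem exists_min_ratio {T : Finset Pt} (hT : T.Nonempty) (N F : Pt → ℝ)
    (hF : ∀ w ∈ T, 0 < F w) : ∃ x ∈ T, ∀ w ∈ T, N x * F w ≤ N w * F x := by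
  obtain ⟨x, hx, h⟩ := T.exists_min_image (fun w => N w / F w) hT
  exact ⟨x, hx, fun w hw => (div_le_div_iff₀ (hF x hx) (hF w hw)).1 (h w hw)⟩

/-! ### General position, extreme points and hull edges -/

/-- No three points of `S` are collinear, in terms of orientation determinants. -/
def GenPos (S : Finset Pt) : Prop :=
  ∀ p ∈ S, ∀ q ∈ S, ∀ r ∈ S, p ≠ q → p ≠ r → q ≠ r → det2 p q r ≠ 0

theorem GenPos.mono {S T : Finset Pt} (h : GenPos S) (hTS : T ⊆ S) : GenPos T :=
  fun p hp q hq r hr => h p (hTS hp) q (hTS hq) r (hTS hr)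

theorem GenPos.aff_ne_zero {S : Finset Pt} (h : GenPos S) {f : Pt → ℝ} (hf : IsAff f)
    {s t w o : Pt} (hs : s ∈ S) (ht : t ∈ S) (hw : w ∈ S) (hst : s ≠ t) (hsw : w ≠ s)
    (htw : w ≠ t) (fs : f s = 0) (ft : f t = 0) (fo : f o ≠ 0) : f w ≠ 0 := by
  obtain ⟨κ, hκ⟩ := hf.eq_mul_det2 hst fs ft
  rw [hκ] at fo ⊢
  exact mul_ne_zero (left_ne_zero_of_mul fo) (h s hs t ht w hw hst hsw.symm htw.symm)

/-- `p` is a strict minimiser of some affine functional on `S ∪ {p}`. -/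
def Extr (S : Finset Pt) (p : Pt) : Prop :=
  ∃ f, IsAff f ∧ f p = 0 ∧ ∀ w ∈ S, w ≠ p → 0 < f w

theorem Extr.mono {S T : Finset Pt} {p : Pt} (h : Extr S p) (hTS : T ⊆ S) : Extr T p := by
  obtain ⟨f, hf, hp, hw⟩ := h
  exact ⟨f, hf, hp, fun w hwT => hw w (hTS hwT)⟩

/-- `(u, v)` is a counterclockwise edge of the convex hull of `S`. -/
def DirEdge (S : Finset Pt) (u v : Pt) : Prop :=
  u ∈ S ∧ v ∈ S ∧ u ≠ v ∧ ∀ w ∈ S, w ≠ u → w ≠ v → 0 < det2 u v w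

/-- `{u, v}` is an edge of the convex hull of `S`. -/
def HullEdge (S : Finset Pt) (u v : Pt) : Prop :=
  u ∈ S ∧ v ∈ S ∧ u ≠ v ∧
    ∃ f, IsAff f ∧ f u = 0 ∧ f v = 0 ∧ ∀ w ∈ S, w ≠ u → w ≠ v → 0 < f w

theorem HullEdge.symm {S : Finset Pt} {u v : Pt} (h : HullEdge S u v) : HullEdge S v u := by
  obtain ⟨hu, hv, huv, f, hf, fu, fv, hw⟩ := h
  exact ⟨hv, hu, huv.symm, f, hf, fv, fu, fun w hwS h1 h2 => hw w hwS h2 h1⟩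

theorem HullEdge.mono {S T : Finset Pt} {u v : Pt} (h : HullEdge S u v) (hTS : T ⊆ S)
    (hu : u ∈ T) (hv : v ∈ T) : HullEdge T u v := by
  obtain ⟨-, -, huv, f, hf, fu, fv, hw⟩ := h
  exact ⟨hu, hv, huv, f, hf, fu, fv, fun w hwT => hw w (hTS hwT)⟩

theorem DirEdge.mono {S T : Finset Pt} {u v : Pt} (h : DirEdge S u v) (hTS : T ⊆ S)
    (hu : u ∈ T) (hv : v ∈ T) : DirEdge T u v :=
  ⟨hu, hv, h.2.2.1, fun w hwT => h.2.2.2 w (hTS hwT)⟩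

theorem DirEdge.hullEdge {S : Finset Pt} {u v : Pt} (h : DirEdge S u v) : HullEdge S u v :=
  ⟨h.1, h.2.1, h.2.2.1, det2 u v, isAff_det2 u v, det2_left u v, det2_right u v, h.2.2.2⟩

theorem HullEdge.dirEdge {S : Finset Pt} {u v : Pt} (h : HullEdge S u v) :
    DirEdge S u v ∨ DirEdge S v u := by
  obtain ⟨hu, hv, huv, f, hf, fu, fv, hw⟩ := h
  obtain ⟨κ, hκ⟩ := hf.eq_mul_det2 huv fu fv
  rcases le_or_gt κ 0 with h0 | h0
  · refine Or.inr ⟨hv, hu, huv.symm, fun w hwS h1 h2 => ?_⟩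
    have := hw w hwS h2 h1
    rw [hκ] at this
    rw [det2_swap]
    nlinarith
  · refine Or.inl ⟨hu, hv, huv, fun w hwS h1 h2 => ?_⟩
    have := hw w hwS h1 h2
    rw [hκ] at this
    exact pos_of_mul_pos_right this h0.le

theorem HullEdge.ext_left {S : Finset Pt} {u v : Pt} (h : HullEdge S u v) : Extr S u := by
  obtain ⟨hu, hv, huv, f, hf, fu, fv, hw⟩ := h
  obtain ⟨K, hK⟩ := exists_tilt S f (dotAt u v)
  refine ⟨_, hf.lin (isAff_dotAt u v) K 1 0, by simp [fu, dotAt_self], fun w hwS hwu => ?_⟩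
  by_cases hwv : w = v
  · subst hwv
    simpa [fv] using dotAt_pos huv
  · simpa using (hK w hwS).1 (hw w hwS hwu hwv)

theorem HullEdge.ext_right {S : Finset Pt} {u v : Pt} (h : HullEdge S u v) : Extr S v :=
  h.symm.ext_left

theorem DirEdge.right_unique {S : Finset Pt} {u v v' : Pt} (h : DirEdge S u v)
    (h' : DirEdge S u v') : v = v' := by
  by_contra hne
  have h1 := h.2.2.2 v' h'.2.1 h'.2.2.1.symm (Ne.symm hne)
  have h2 := h'.2.2.2 v h.2.1 h.2.2.1.symm hne
  simp only [det2] at *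
  linarith

theorem DirEdge.left_unique {S : Finset Pt} {u u' v : Pt} (h : DirEdge S u v)
    (h' : DirEdge S u' v) : u = u' := by
  by_contra hne
  have h1 := h.2.2.2 u' h'.1 (Ne.symm hne) h'.2.2.1
  have h2 := h'.2.2.2 u h.1 hne h.2.2.1
  simp only [det2] at *
  linarith

/-- Strict pencil: the point of `S` minimising the ratio `M / F` of two functionals vanishing
at the extreme point `p` spans a hull edge with `p`. -/
theorem hullEdge_of_min_ratio {S : Finset Pt} (hS : GenPos S) {p x o : Pt} {F M : Pt → ℝ}
    (hF : IsAff F) (hM : IsAff M) (Fp : F p = 0) (Mp : M p = 0) (hp : p ∈ S) (hx : x ∈ S)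
    (hxp : x ≠ p) (hmin : ∀ w ∈ S, w ≠ p → M x * F w ≤ M w * F x)
    (ho : M x * F o ≠ M o * F x) : HullEdge S p x := by
  have haff : IsAff fun w => F x * M w + (-M x) * F w + 0 := hM.lin hF _ _ _
  refine ⟨hp, hx, hxp.symm, _, haff, by simp [Fp, Mp], by ring, fun w hw h1 h2 => ?_⟩
  have h3 := hS.aff_ne_zero haff (o := o) hp hx hw hxp.symm h1 h2 (by simp [Fp, Mp]) (by ring)
    (by intro h; exact ho (by linear_combination -h))
  exact lt_of_le_of_ne (by linarith [hmin w hw h1]) h3.symm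

theorem Extr.exists_dirEdge {S : Finset Pt} (hS : GenPos S) {p : Pt} (h : Extr S p) (hp : p ∈ S)
    (hne : (S.erase p).Nonempty) : (∃ x, DirEdge S p x) ∧ ∃ x, DirEdge S x p := by
  obtain ⟨F, ⟨a, b, c, hF⟩, Fp, hpos⟩ := h
  have hpos' : ∀ w ∈ S.erase p, 0 < F w := fun w hw =>
    hpos w (Finset.mem_of_mem_erase hw) (Finset.ne_of_mem_erase hw)
  have hc : c = -(a * p.1 + b * p.2) := by rw [hF] at Fp; linarith
  have hFw : ∀ w, F w = a * (w.1 - p.1) + b * (w.2 - p.2) := fun w => by rw [hF, hc]; ring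
  have hab : 0 < a ^ 2 + b ^ 2 := by
    obtain ⟨w, hw⟩ := hne
    have := hpos' w hw
    by_contra hcon
    have h1 : a = 0 := by nlinarith [sq_nonneg a, sq_nonneg b]
    have h2 : b = 0 := by nlinarith [sq_nonneg a, sq_nonneg b]
    rw [hFw, h1, h2] at this
    linarith
  let M : Pt → ℝ := fun w => a * (w.2 - p.2) - b * (w.1 - p.1)
  have key : ∀ x w, M w * F x - M x * F w = (a ^ 2 + b ^ 2) * det2 p x w := fun x w => by
    rw [hFw, hFw, det2]
    simp only [M]
    ring
  constructor
  · obtain ⟨x, hx, hmin⟩ := exists_min_ratio hne M F hpos'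
    have hxS := Finset.mem_of_mem_erase hx
    have hxp := Finset.ne_of_mem_erase hx
    refine ⟨x, hp, hxS, hxp.symm, fun w hw h1 h2 => ?_⟩
    have h3 := hmin w (Finset.mem_erase.2 ⟨h1, hw⟩)
    have h4 := hS p hp x hxS w hw hxp.symm h1.symm h2.symm
    exact lt_of_le_of_ne (le_of_mul_le_mul_left (by linarith [key x w]) hab) h4.symm
  · obtain ⟨x, hx, hmin⟩ := exists_min_ratio hne (fun w => -M w) F hpos'
    have hxS := Finset.mem_of_mem_erase hx
    have hxp := Finset.ne_of_mem_erase hx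
    refine ⟨x, hxS, hp, hxp, fun w hw h1 h2 => ?_⟩
    have h3 := hmin w (Finset.mem_erase.2 ⟨h2, hw⟩)
    have h4 := hS x hxS p hp w hw hxp h1.symm h2.symm
    refine lt_of_le_of_ne (le_of_mul_le_mul_left ?_ hab) h4.symm
    rw [det2_swap]
    linarith [key x w]

/-! ### Bichromatic hull edges -/

/-- The colour excess of `T`: number of points of colour `c` minus number of the others. -/
def colExc (χ : Pt → Bool) (c : Bool) (T : Finset Pt) : ℤ :=
  ∑ w ∈ T, if χ w = c then 1 else -1

/-- The bichromatic counterclockwise hull edges of `S`. -/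
def biEdges (χ : Pt → Bool) (S : Finset Pt) : Finset (Pt × Pt) :=
  (S ×ˢ S).filter fun e => DirEdge S e.1 e.2 ∧ χ e.1 ≠ χ e.2

theorem mem_biEdges {χ : Pt → Bool} {S : Finset Pt} {e : Pt × Pt} :
    e ∈ biEdges χ S ↔ DirEdge S e.1 e.2 ∧ χ e.1 ≠ χ e.2 := by
  simp only [biEdges, Finset.mem_filter, Finset.mem_product, and_iff_right_iff_imp]
  exact fun h => ⟨h.1.1, h.1.2.1⟩

/-- Going around the hull, colours change equally often in both directions. -/
theorem card_biEdges_eq {S : Finset Pt} (hS : GenPos S) (χ : Pt → Bool) :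
    ((biEdges χ S).filter fun e => χ e.1 = true).card =
      ((biEdges χ S).filter fun e => χ e.1 = false).card := by
  set H := (S ×ˢ S).filter fun e : Pt × Pt => DirEdge S e.1 e.2 with hH
  have memH : ∀ e, e ∈ H ↔ DirEdge S e.1 e.2 := fun e => by
    simp only [hH, Finset.mem_filter, Finset.mem_product, and_iff_right_iff_imp]
    exact fun h => ⟨h.1, h.2.1⟩
  have inj1 : Set.InjOn Prod.fst (H : Set (Pt × Pt)) := by
    intro e he e' he' h
    rw [Finset.mem_coe, memH] at he he'
    refine Prod.ext h ?_
    rw [← h] at he'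
    exact he.right_unique he'
  have inj2 : Set.InjOn Prod.snd (H : Set (Pt × Pt)) := by
    intro e he e' he' h
    rw [Finset.mem_coe, memH] at he he'
    refine Prod.ext ?_ h
    rw [← h] at he'
    exact he.left_unique he'
  have himg : H.image Prod.fst = H.image Prod.snd := by
    ext v
    simp only [Finset.mem_image, memH]
    constructor
    · rintro ⟨e, h, rfl⟩
      obtain ⟨x, hx⟩ := (h.hullEdge.ext_left.exists_dirEdge hS h.1
        ⟨e.2, Finset.mem_erase.2 ⟨h.2.2.1.symm, h.2.1⟩⟩).2
      exact ⟨(x, e.1), hx, rfl⟩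
    · rintro ⟨e, h, rfl⟩
      obtain ⟨x, hx⟩ := (h.hullEdge.ext_right.exists_dirEdge hS h.2.1
        ⟨e.1, Finset.mem_erase.2 ⟨h.2.2.1, h.1⟩⟩).1
      exact ⟨(e.2, x), hx, rfl⟩
  let s : Pt → ℕ := fun v => if χ v = true then 1 else 0
  have hsum : ∑ e ∈ H, s e.1 = ∑ e ∈ H, s e.2 := by
    rw [← Finset.sum_image (f := s) inj1, himg, Finset.sum_image (f := s) inj2]
  have key : ∀ c : Bool, ((biEdges χ S).filter fun e => χ e.1 = c).card =
      ∑ e ∈ H, if χ e.1 = c ∧ χ e.2 ≠ c then 1 else 0 := fun c => by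
    rw [← Finset.card_filter]
    congr 1
    ext e
    simp only [Finset.mem_filter, mem_biEdges, memH]
    constructor
    · rintro ⟨⟨h1, h2⟩, h3⟩
      exact ⟨h1, h3, fun h => h2 (h3.trans h.symm)⟩
    · rintro ⟨h1, h3, h2⟩
      exact ⟨⟨h1, fun h => h2 (h.symm.trans h3)⟩, h3⟩
  rw [key, key]
  have h2 : ∑ e ∈ H, (if χ e.1 = true ∧ χ e.2 ≠ true then 1 else 0) + ∑ e ∈ H, s e.2 =
      ∑ e ∈ H, (if χ e.1 = false ∧ χ e.2 ≠ false then 1 else 0) + ∑ e ∈ H, s e.1 := by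
    rw [← Finset.sum_add_distrib, ← Finset.sum_add_distrib]
    refine Finset.sum_congr rfl fun e _ => ?_
    simp only [s]
    cases χ e.1 <;> cases χ e.2 <;> simp
  omega

theorem card_biEdges_eq_two_mul {S : Finset Pt} (hS : GenPos S) (χ : Pt → Bool) (c : Bool) :
    (biEdges χ S).card = 2 * ((biEdges χ S).filter fun e => χ e.1 = c).card := by
  have h := card_biEdges_eq hS χ
  have h2 := Finset.card_filter_add_card_filter_not (s := biEdges χ S) (fun e => χ e.1 = true)
  simp only [Bool.not_eq_true] at h2
  cases c <;> omega

theorem even_card_biEdges {S : Finset Pt} (hS : GenPos S) (χ : Pt → Bool) :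
    Even (biEdges χ S).card :=
  ⟨_, (card_biEdges_eq_two_mul hS χ true).trans (two_mul _)⟩

/-- Between two differently coloured points `u`, `v` of `T`, each supported by a functional,
the chain of the hull of `T` visible from a point `o` contains a bichromatic edge. -/
theorem exists_visible_edge {T : Finset Pt} (hT : GenPos T) (χ : Pt → Bool) {u v o : Pt}
    (hu : u ∈ T) (hv : v ∈ T) (huv : χ u ≠ χ v) {L M : Pt → ℝ} (hL : IsAff L) (hM : IsAff M)
    (Lu : L u = 0) (hL0 : ∀ w ∈ T, w ≠ u → 0 < L w)
    (Mv : M v = 0) (hM0 : ∀ w ∈ T, w ≠ v → 0 < M w) (Lo : L o ≤ 0) (Mo : M o ≤ 0) :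
    ∃ s ∈ T, ∃ t ∈ T, χ s = χ u ∧ χ t = χ v ∧ ∃ D, IsAff D ∧ D s = 0 ∧ D t = 0 ∧
      (∀ w ∈ T, w ≠ s → w ≠ t → 0 < D w) ∧
      ∃ α β γ : ℝ, 0 < α ∧ 0 < β ∧ 0 < γ ∧ ∀ w, D w = α * L w + β * M w - γ := by
  have hne : u ≠ v := fun h => huv (h ▸ rfl)
  let f : ℝ → Pt → ℝ := fun a w => (1 - a) * L w + a * M w
  have hu' : u ∈ T.filter fun w => χ w = χ u := Finset.mem_filter.2 ⟨hu, rfl⟩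
  have hv' : v ∈ T.filter fun w => χ w = χ v := Finset.mem_filter.2 ⟨hv, rfl⟩
  have hTu : (T.filter fun w => χ w = χ u).Nonempty := ⟨u, hu'⟩
  have hTv : (T.filter fun w => χ w = χ v).Nonempty := ⟨v, hv'⟩
  let mu : ℝ → ℝ := fun a => (T.filter fun w => χ w = χ u).inf' hTu (f a)
  let mv : ℝ → ℝ := fun a => (T.filter fun w => χ w = χ v).inf' hTv (f a)
  have hmu : Continuous mu := Continuous.finset_inf'_apply hTu fun w _ => by fun_prop
  have hmv : Continuous mv := Continuous.finset_inf'_apply hTv fun w _ => by fun_prop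
  have h0 : mu 0 < mv 0 := by
    have h1 : mu 0 ≤ 0 := by
      have : mu 0 ≤ f 0 u := Finset.inf'_le (f 0) hu'
      simpa [f, Lu] using this
    have h2 : 0 < mv 0 := by
      refine (Finset.lt_inf'_iff _).2 fun w hw => ?_
      obtain ⟨hw, hc⟩ := Finset.mem_filter.1 hw
      simpa [f] using hL0 w hw fun h => huv (h ▸ hc)
    linarith
  have h1 : mv 1 < mu 1 := by
    have h1 : mv 1 ≤ 0 := by
      have : mv 1 ≤ f 1 v := Finset.inf'_le (f 1) hv'
      simpa [f, Mv] using this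
    have h2 : 0 < mu 1 := by
      refine (Finset.lt_inf'_iff _).2 fun w hw => ?_
      obtain ⟨hw, hc⟩ := Finset.mem_filter.1 hw
      simpa [f] using hM0 w hw fun h => huv (h ▸ hc).symm
    linarith
  obtain ⟨a, ⟨ha0, ha1⟩, ha⟩ := intermediate_value_Icc (zero_le_one (α := ℝ))
    (hmu.sub hmv).continuousOn ⟨(sub_neg.2 h0).le, (sub_pos.2 h1).le⟩
  replace ha : mu a = mv a := sub_eq_zero.1 ha
  have ha0' : 0 < a := lt_of_le_of_ne ha0 fun h => by subst h; exact h0.ne ha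
  have ha1' : a < 1 := lt_of_le_of_ne ha1 fun h => by subst h; exact h1.ne' ha
  have hle : ∀ w ∈ T, mu a ≤ f a w := fun w hw => by
    by_cases hc : χ w = χ u
    · exact Finset.inf'_le _ (Finset.mem_filter.2 ⟨hw, hc⟩)
    · rw [ha]
      refine Finset.inf'_le _ (Finset.mem_filter.2 ⟨hw, ?_⟩)
      revert hc huv
      cases χ w <;> cases χ u <;> cases χ v <;> simp
  obtain ⟨s, hs, hsa⟩ := Finset.exists_mem_eq_inf' hTu (f a)
  obtain ⟨t, ht, hta⟩ := Finset.exists_mem_eq_inf' hTv (f a)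
  obtain ⟨hs, hsc⟩ := Finset.mem_filter.1 hs
  obtain ⟨ht, htc⟩ := Finset.mem_filter.1 ht
  have hsa : mu a = f a s := hsa
  have hta : mv a = f a t := hta
  have hpos : 0 < mu a := by
    rw [hsa]
    simp only [f]
    by_cases hsu : s = u
    · subst hsu
      have := mul_pos ha0' (hM0 s hu hne)
      rw [Lu]; linarith
    · have h3 := mul_pos (sub_pos.2 ha1') (hL0 s hs hsu)
      have h4 : 0 ≤ M s := by
        by_cases hsv : s = v
        · rw [hsv, Mv]
        · exact (hM0 s hs hsv).le
      have := mul_nonneg ha0 h4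
      linarith
  have hD : IsAff fun w => (1 - a) * L w + a * M w + -mu a := hL.lin hM _ _ _
  have hst : s ≠ t := fun h => huv (hsc.symm.trans (h ▸ htc))
  have Ds : (1 - a) * L s + a * M s + -mu a = 0 := by rw [hsa]; simp only [f]; ring
  have Dt : (1 - a) * L t + a * M t + -mu a = 0 := by rw [ha, hta]; simp only [f]; ring
  refine ⟨s, hs, t, ht, hsc, htc, _, hD, Ds, Dt, fun w hw h1 h2 => ?_, 1 - a, a, mu a,
    sub_pos.2 ha1', ha0', hpos, fun w => by ring⟩
  have h3 := hle w hw
  have h4 := hT.aff_ne_zero hD (o := o) hs ht hw hst h1 h2 Ds Dt (by nlinarith)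
  exact lt_of_le_of_ne (by simp only [f] at h3; linarith) h4.symm

/-! ### Counting bichromatic hull edges of a set split at a point -/

/-- `L` strictly separates `U₁` from `U₂`, except for the common point `y`. -/
structure Separates (U₁ U₂ : Finset Pt) (y : Pt) (L : Pt → ℝ) : Prop where
  aff : IsAff L
  zero : L y = 0
  left : y ∈ U₁
  right : y ∈ U₂
  neg : ∀ w ∈ U₁, w ≠ y → L w < 0
  pos : ∀ w ∈ U₂, w ≠ y → 0 < L w

theorem Separates.symm {U₁ U₂ : Finset Pt} {y : Pt} {L : Pt → ℝ} (h : Separates U₁ U₂ y L) :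
    Separates U₂ U₁ y fun w => -L w :=
  ⟨h.aff.neg, by simp [h.zero], h.right, h.left, fun w hw hy => by simpa using h.pos w hw hy,
    fun w hw hy => by simpa using h.neg w hw hy⟩

theorem Separates.eq_of_mem {U₁ U₂ : Finset Pt} {y : Pt} {L : Pt → ℝ}
    (h : Separates U₁ U₂ y L) {w : Pt}
    (h1 : w ∈ U₁) (h2 : w ∈ U₂) : w = y := by
  by_contra hne
  exact lt_asymm (h.neg w h1 hne) (h.pos w h2 hne)

theorem Separates.card {U₁ U₂ : Finset Pt} {y : Pt} {L : Pt → ℝ} (h : Separates U₁ U₂ y L) :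
    U₁.card + U₂.card = (U₁ ∪ U₂).card + 1 := by
  rw [← Finset.card_union_add_card_inter]
  congr 1
  rw [Finset.card_eq_one]
  refine ⟨y, Finset.eq_singleton_iff_unique_mem.2 ⟨Finset.mem_inter.2 ⟨h.left, h.right⟩, ?_⟩⟩
  intro w hw
  exact h.eq_of_mem (Finset.mem_inter.1 hw).1 (Finset.mem_inter.1 hw).2

/-- A coordinate along the line `L = 0`, with origin `y`. -/
theorem exists_line_coord {L : Pt → ℝ} (hL : IsAff L) {y o : Pt} (hy : L y = 0) (ho : L o ≠ 0) :
    ∃ z : Pt → ℝ, ∀ f, IsAff f → ∃ k, ∀ w, L w = 0 → f w = f y + k * z w := by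
  obtain ⟨a, b, c, hL⟩ := hL
  have hab : a ^ 2 + b ^ 2 ≠ 0 := by
    intro h
    have h1 : a = 0 := by nlinarith [sq_nonneg a, sq_nonneg b]
    have h2 : b = 0 := by nlinarith [sq_nonneg a, sq_nonneg b]
    rw [hL, h1, h2] at hy ho
    exact ho (by linarith)
  refine ⟨fun w => -b * (w.1 - y.1) + a * (w.2 - y.2), fun f hf => ?_⟩
  obtain ⟨p, q, r, hf⟩ := hf
  refine ⟨(-b * p + a * q) / (a ^ 2 + b ^ 2), fun w hw => ?_⟩
  rw [hf, hf]
  field_simp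
  rw [hL] at hw hy
  linear_combination (p * a + q * b) * (hw - hy)

/-- The hull edges of `U₁ ∪ U₂` that avoid `y` and join the two parts. -/
def crossPairs (U₁ U₂ : Finset Pt) (y : Pt) : Finset (Pt × Pt) :=
  (U₁.erase y ×ˢ U₂.erase y).filter fun e => HullEdge (U₁ ∪ U₂) e.1 e.2

theorem mem_crossPairs {U₁ U₂ : Finset Pt} {y : Pt} {e : Pt × Pt} :
    e ∈ crossPairs U₁ U₂ y ↔ (e.1 ≠ y ∧ e.1 ∈ U₁) ∧ (e.2 ≠ y ∧ e.2 ∈ U₂) ∧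
      HullEdge (U₁ ∪ U₂) e.1 e.2 := by
  simp [crossPairs, and_assoc]

theorem Separates.exists_cross_coord {U₁ U₂ : Finset Pt} {y : Pt} {L : Pt → ℝ}
    (h : Separates U₁ U₂ y L) :
    ∃ z : Pt × Pt → ℝ, ∀ e ∈ crossPairs U₁ U₂ y, ∀ e' ∈ crossPairs U₁ U₂ y,
      (e ≠ e' → z e * z e' < 0) ∧ (Extr (U₁ ∪ U₂) y → 0 < z e * z e') := by
  by_cases hne : ∃ o, L o ≠ 0
  swap
  · refine ⟨fun _ => 0, fun e he => ?_⟩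
    push Not at hne
    have h1 := mem_crossPairs.1 he
    exact absurd (hne e.1) (h.neg e.1 h1.1.2 h1.1.1).ne
  obtain ⟨o, ho⟩ := hne
  obtain ⟨z, hz⟩ := exists_line_coord h.aff h.zero ho
  have hpt : ∀ e : Pt × Pt, ∃ Z : Pt, e ∈ crossPairs U₁ U₂ y → L Z = 0 ∧ ∃ α β : ℝ,
      0 < α ∧ 0 < β ∧ ∀ f, IsAff f → f Z = α * f e.1 + β * f e.2 := by
    intro e
    by_cases he : e ∈ crossPairs U₁ U₂ y
    swap
    · exact ⟨y, fun h' => absurd h' he⟩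
    have h1 := mem_crossPairs.1 he
    have hn := h.neg e.1 h1.1.2 h1.1.1
    have hp := h.pos e.2 h1.2.1.2 h1.2.1.1
    have hd : 0 < L e.2 - L e.1 := by linarith
    have hs : L e.2 / (L e.2 - L e.1) + -L e.1 / (L e.2 - L e.1) = 1 := by
      field_simp; ring
    refine ⟨(L e.2 / (L e.2 - L e.1)) • e.1 + (-L e.1 / (L e.2 - L e.1)) • e.2, fun _ =>
      ⟨?_, _, _, div_pos hp hd, div_pos (by linarith) hd, fun f hf => hf.combo _ _ hs⟩⟩
    rw [h.aff.combo _ _ hs]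
    field_simp
    ring
  choose Z hZ using hpt
  have main : ∀ e ∈ crossPairs U₁ U₂ y, ∃ k d : ℝ, 0 < d ∧ d + k * z (Z e) = 0 ∧
      ∀ e' ∈ crossPairs U₁ U₂ y, e ≠ e' → 0 < d + k * z (Z e') := by
    intro e he
    obtain ⟨hLZ, α, β, hα, hβ, hf⟩ := hZ e he
    obtain ⟨⟨h1y, h1⟩, ⟨h2y, h2⟩, -, -, -, D, hD, D1, D2, hDpos⟩ := mem_crossPairs.1 he
    obtain ⟨k, hk⟩ := hz D hD
    refine ⟨k, D y, hDpos y (Finset.mem_union_left _ h.left) h1y.symm h2y.symm, ?_, ?_⟩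
    · rw [← hk _ hLZ, hf D hD, D1, D2]; ring
    · intro e' he' hne
      obtain ⟨hLZ', α', β', hα', hβ', hf'⟩ := hZ e' he'
      obtain ⟨⟨h1y', h1'⟩, ⟨h2y', h2'⟩, -⟩ := mem_crossPairs.1 he'
      rw [← hk _ hLZ', hf' D hD]
      have h12 : e'.1 ≠ e.2 := fun hh => h2y (h.eq_of_mem (hh ▸ h1') h2)
      have h21 : e'.2 ≠ e.1 := fun hh => h1y (h.eq_of_mem h1 (hh ▸ h2'))
      by_cases h11 : e'.1 = e.1
      · have h22 : e'.2 ≠ e.2 := fun hh => hne (Prod.ext h11.symm hh.symm)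
        rw [h11, D1]
        have := mul_pos hβ' (hDpos e'.2 (Finset.mem_union_right _ h2') h21 h22)
        linarith
      · have h3 := mul_pos hα' (hDpos e'.1 (Finset.mem_union_left _ h1') h11 h12)
        have h4 : 0 ≤ D e'.2 := by
          by_cases h22 : e'.2 = e.2
          · rw [h22, D2]
          · exact (hDpos e'.2 (Finset.mem_union_right _ h2') h21 h22).le
        have := mul_nonneg hβ'.le h4
        linarith
  refine ⟨fun e => z (Z e), fun e he e' he' => ⟨fun hne => ?_, fun hext => ?_⟩⟩
  · obtain ⟨k, d, hd, h1, h2⟩ := main e he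
    obtain ⟨k', d', hd', h1', h2'⟩ := main e' he'
    have h2 := h2 e' he' hne
    have h2' := h2' e he hne.symm
    show z (Z e) * z (Z e') < 0
    generalize z (Z e) = u at *
    generalize z (Z e') = v at *
    have hu : u ≠ 0 := by rintro rfl; linarith
    have hv : v ≠ 0 := by rintro rfl; linarith
    rcases hu.lt_or_gt with hu | hu <;> rcases hv.lt_or_gt with hv | hv
    · exfalso
      have hk : 0 < k := by by_contra hk; nlinarith
      have hk' : 0 < k' := by by_contra hk; nlinarith
      have a1 : u < v := lt_of_mul_lt_mul_left (by linarith) hk.le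
      have a2 : v < u := lt_of_mul_lt_mul_left (by linarith) hk'.le
      linarith
    · exact mul_neg_of_neg_of_pos hu hv
    · exact mul_neg_of_pos_of_neg hu hv
    · exfalso
      have hk : 0 < -k := by by_contra hk; nlinarith
      have hk' : 0 < -k' := by by_contra hk; nlinarith
      have a1 : v < u := lt_of_mul_lt_mul_left (by linarith) hk.le
      have a2 : u < v := lt_of_mul_lt_mul_left (by linarith) hk'.le
      linarith
  · obtain ⟨F, hF, Fy, hFpos⟩ := hext
    obtain ⟨k, hk⟩ := hz F hF
    have hpos : ∀ e ∈ crossPairs U₁ U₂ y, 0 < k * z (Z e) := by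
      intro e he
      obtain ⟨hLZ, α, β, hα, hβ, hf⟩ := hZ e he
      obtain ⟨⟨h1y, h1⟩, ⟨h2y, h2⟩, -⟩ := mem_crossPairs.1 he
      have h3 := hk _ hLZ
      rw [hf F hF, Fy] at h3
      have := mul_pos hα (hFpos e.1 (Finset.mem_union_left _ h1) h1y)
      have := mul_pos hβ (hFpos e.2 (Finset.mem_union_right _ h2) h2y)
      linarith
    have h1 := mul_pos (hpos e he) (hpos e' he')
    have h2 : 0 < k ^ 2 * (z (Z e) * z (Z e')) := by linarith
    exact pos_of_mul_pos_right h2 (sq_nonneg k)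

theorem Separates.card_crossPairs_le_two {U₁ U₂ : Finset Pt} {y : Pt} {L : Pt → ℝ}
    (h : Separates U₁ U₂ y L) : (crossPairs U₁ U₂ y).card ≤ 2 := by
  obtain ⟨z, hz⟩ := h.exists_cross_coord
  by_contra hc
  obtain ⟨a, b, c, ha, hb, hc, hab, hac, hbc⟩ := Finset.two_lt_card_iff.1 (not_le.1 hc)
  have h1 := (hz a ha b hb).1 hab
  have h2 := (hz a ha c hc).1 hac
  have h3 := (hz b hb c hc).1 hbc
  nlinarith [mul_pos (neg_pos.2 h1) (mul_pos (neg_pos.2 h2) (neg_pos.2 h3)),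
    sq_nonneg (z a * z b * z c)]

theorem Separates.card_crossPairs_le_one {U₁ U₂ : Finset Pt} {y : Pt} {L : Pt → ℝ}
    (h : Separates U₁ U₂ y L) (hext : Extr (U₁ ∪ U₂) y) : (crossPairs U₁ U₂ y).card ≤ 1 := by
  obtain ⟨z, hz⟩ := h.exists_cross_coord
  refine Finset.card_le_one.2 fun a ha b hb => ?_
  by_contra hab
  exact lt_asymm ((hz a ha b hb).1 hab) ((hz a ha b hb).2 hext)

/-- The bichromatic members of `crossPairs`. -/
def biCrossPairs (χ : Pt → Bool) (U₁ U₂ : Finset Pt) (y : Pt) : Finset (Pt × Pt) :=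
  (crossPairs U₁ U₂ y).filter fun e => χ e.1 ≠ χ e.2

/-- The bichromatic hull edges of the two parts that are not hull edges of the union. -/
def newEdges (χ : Pt → Bool) (U₁ U₂ : Finset Pt) : Finset (Pt × Pt) :=
  (biEdges χ U₁ ∪ biEdges χ U₂) \ biEdges χ (U₁ ∪ U₂)

theorem mem_newEdges_left {χ : Pt → Bool} {U₁ U₂ : Finset Pt} {e : Pt × Pt}
    (h1 : e ∈ biEdges χ U₁) (h2 : e ∉ biEdges χ (U₁ ∪ U₂)) : e ∈ newEdges χ U₁ U₂ :=
  Finset.mem_sdiff.2 ⟨Finset.mem_union_left _ h1, h2⟩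

theorem mem_newEdges_right {χ : Pt → Bool} {U₁ U₂ : Finset Pt} {e : Pt × Pt}
    (h1 : e ∈ biEdges χ U₂) (h2 : e ∉ biEdges χ (U₁ ∪ U₂)) : e ∈ newEdges χ U₁ U₂ :=
  Finset.mem_sdiff.2 ⟨Finset.mem_union_right _ h1, h2⟩

theorem Separates.ne_of_mem_biEdges {U₁ U₂ : Finset Pt} {y : Pt} {L : Pt → ℝ}
    (h : Separates U₁ U₂ y L)
    {χ : Pt → Bool} {e e' : Pt × Pt} (h1 : e ∈ biEdges χ U₁) (h2 : e' ∈ biEdges χ U₂) :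
    e ≠ e' := by
  rintro rfl
  have h1 := (mem_biEdges.1 h1).1
  have h2 := (mem_biEdges.1 h2).1
  exact h1.2.2.1 ((h.eq_of_mem h1.1 h2.1).trans (h.eq_of_mem h1.2.1 h2.2.1).symm)

theorem Separates.card_biEdges_le {U₁ U₂ : Finset Pt} {y : Pt} {L : Pt → ℝ}
    (h : Separates U₁ U₂ y L)
    (χ : Pt → Bool) :
    (biEdges χ (U₁ ∪ U₂)).card + (newEdges χ U₁ U₂).card ≤
      (biEdges χ U₁).card + (biEdges χ U₂).card + (biCrossPairs χ U₁ U₂ y).card := by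
  have hdisj : Disjoint (biEdges χ U₁) (biEdges χ U₂) :=
    Finset.disjoint_left.2 fun e h1 h2 => h.ne_of_mem_biEdges h1 h2 rfl
  rw [← Finset.card_union_of_disjoint hdisj]
  set E := biEdges χ (U₁ ∪ U₂) with hE
  set E' := biEdges χ U₁ ∪ biEdges χ U₂ with hE'
  have h1 : (E' \ E).card + E.card = (E \ E').card + E'.card := by
    have i1 := Finset.card_sdiff_add_card_inter E' E
    have i2 := Finset.card_sdiff_add_card_inter E E'
    rw [Finset.inter_comm] at i2
    omega
  have h2 : (E \ E').card ≤ (biCrossPairs χ U₁ U₂ y).card := by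
    refine Finset.card_le_card_of_injOn (fun e => if e.1 ∈ U₁ then e else (e.2, e.1)) ?_ ?_
    · intro e he
      obtain ⟨he, he'⟩ := Finset.mem_sdiff.1 he
      obtain ⟨hd, hχ⟩ := mem_biEdges.1 he
      simp only [hE', Finset.mem_union, mem_biEdges, not_or, not_and_or] at he'
      have n1 : ¬ (e.1 ∈ U₁ ∧ e.2 ∈ U₁) := fun hh =>
        he'.1.elim (fun h' => h' (hd.mono Finset.subset_union_left hh.1 hh.2)) (fun h' => h' hχ)
      have n2 : ¬ (e.1 ∈ U₂ ∧ e.2 ∈ U₂) := fun hh =>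
        he'.2.elim (fun h' => h' (hd.mono Finset.subset_union_right hh.1 hh.2)) (fun h' => h' hχ)
      have m1 := Finset.mem_union.1 hd.1
      have m2 := Finset.mem_union.1 hd.2.1
      have hl := h.left
      have hr := h.right
      rw [Finset.mem_coe, biCrossPairs, Finset.mem_filter, mem_crossPairs]
      beta_reduce
      split_ifs with hc
      · have a2 : e.2 ∉ U₁ := fun hh => n1 ⟨hc, hh⟩
        have b2 : e.2 ∈ U₂ := m2.resolve_left a2
        have b1 : e.1 ∉ U₂ := fun hh => n2 ⟨hh, b2⟩
        exact ⟨⟨⟨fun hh => b1 (hh ▸ hr), hc⟩, ⟨fun hh => a2 (hh ▸ hl), b2⟩, hd.hullEdge⟩, hχ⟩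
      · have b1 : e.1 ∈ U₂ := m1.resolve_left hc
        have b2 : e.2 ∉ U₂ := fun hh => n2 ⟨b1, hh⟩
        have a2 : e.2 ∈ U₁ := m2.resolve_right b2
        have n2y : e.2 ≠ y := fun hh => b2 (hh ▸ hr)
        have n1y : e.1 ≠ y := fun hh => hc (hh ▸ hl)
        exact ⟨⟨⟨n2y, a2⟩, ⟨n1y, b1⟩, hd.hullEdge.symm⟩, hχ.symm⟩
    · intro e he e' he' hee
      have he := (mem_biEdges.1 (Finset.mem_sdiff.1 he).1).1
      obtain ⟨hm', hn'⟩ := Finset.mem_sdiff.1 he'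
      have hχ' := (mem_biEdges.1 hm').2
      have he' := (mem_biEdges.1 hm').1
      have key : ¬ (e.1 = e'.2 ∧ e.2 = e'.1) := by
        rintro ⟨e1, e2⟩
        have hy : y ∈ U₁ ∪ U₂ := Finset.mem_union_left _ h.left
        have hfalse : y = e'.1 ∨ y = e'.2 := by
          by_contra hcon
          push Not at hcon
          have p1 := he.2.2.2 y hy (by rw [e1]; exact hcon.2) (by rw [e2]; exact hcon.1)
          have p2 := he'.2.2.2 y hy hcon.1 hcon.2
          rw [e1, e2, det2_swap] at p1
          linarith
        apply hn'
        rw [hE', Finset.mem_union, mem_biEdges, mem_biEdges]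
        have m1 := Finset.mem_union.1 he'.1
        have m2 := Finset.mem_union.1 he'.2.1
        rcases hfalse with hf | hf
        · rcases m2 with m2 | m2
          · exact Or.inl ⟨he'.mono Finset.subset_union_left (hf ▸ h.left) m2, hχ'⟩
          · exact Or.inr ⟨he'.mono Finset.subset_union_right (hf ▸ h.right) m2, hχ'⟩
        · rcases m1 with m1 | m1
          · exact Or.inl ⟨he'.mono Finset.subset_union_left m1 (hf ▸ h.left), hχ'⟩
          · exact Or.inr ⟨he'.mono Finset.subset_union_right m1 (hf ▸ h.right), hχ'⟩
      simp only at hee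
      split_ifs at hee with c1 c2 c2
      · exact hee
      · exact absurd ⟨congrArg Prod.fst hee, congrArg Prod.snd hee⟩ key
      · exact absurd ⟨congrArg Prod.snd hee, congrArg Prod.fst hee⟩ key
      · exact Prod.ext (congrArg Prod.snd hee) (congrArg Prod.fst hee)
  have h3 : newEdges χ U₁ U₂ = E' \ E := rfl
  rw [h3]
  omega

/-- A bichromatic hull edge of `T` with a point of `U` on its outer side is not one of `U`. -/
theorem exists_biEdge_not_mem {T U : Finset Pt} {χ : Pt → Bool} {s t o : Pt} {D : Pt → ℝ}
    (hD : IsAff D) (hs : s ∈ T) (ht : t ∈ T) (hχ : χ s ≠ χ t) (Ds : D s = 0) (Dt : D t = 0)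
    (hpos : ∀ w ∈ T, w ≠ s → w ≠ t → 0 < D w) (ho : o ∈ U) (Do : D o < 0) :
    ∃ e ∈ biEdges χ T, e ∉ biEdges χ U := by
  have hst : s ≠ t := fun h => hχ (h ▸ rfl)
  have os : o ≠ s := by rintro rfl; linarith
  have ot : o ≠ t := by rintro rfl; linarith
  obtain ⟨κ, hκ⟩ := hD.eq_mul_det2 hst Ds Dt
  have hκ0 : κ ≠ 0 := by rintro rfl; rw [hκ] at Do; linarith
  rcases hκ0.lt_or_gt with h0 | h0
  · refine ⟨(t, s), mem_biEdges.2 ⟨⟨ht, hs, hst.symm, fun w hw h1 h2 => ?_⟩, hχ.symm⟩, fun h => ?_⟩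
    · have := hpos w hw h2 h1
      rw [hκ] at this
      rw [det2_swap]
      nlinarith
    · have := (mem_biEdges.1 h).1.2.2.2 o ho ot os
      simp only [det2_swap s t] at this
      rw [hκ] at Do
      nlinarith
  · refine ⟨(s, t), mem_biEdges.2 ⟨⟨hs, ht, hst, fun w hw h1 h2 => ?_⟩, hχ⟩, fun h => ?_⟩
    · have := hpos w hw h1 h2
      rw [hκ] at this
      exact pos_of_mul_pos_right this h0.le
    · have := (mem_biEdges.1 h).1.2.2.2 o ho os ot
      rw [hκ] at Do
      have := mul_pos h0 this
      linarith

theorem Separates.exists_new_left {U₁ U₂ : Finset Pt} {y : Pt} {L : Pt → ℝ}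
    (h : Separates U₁ U₂ y L)
    (hU : GenPos (U₁ ∪ U₂)) {χ : Pt → Bool} {e : Pt × Pt} (he : e ∈ crossPairs U₁ U₂ y)
    (hχ : χ e.1 ≠ χ y) : ∃ e ∈ biEdges χ U₁, e ∉ biEdges χ (U₁ ∪ U₂) := by
  obtain ⟨⟨h1y, h1⟩, ⟨h2y, h2⟩, -, -, -, D, hD, D1, D2, hpos⟩ := mem_crossPairs.1 he
  obtain ⟨s, hs, t, ht, hsc, htc, D', hD', Ds, Dt, hpos', α, β, γ, hα, hβ, hγ, hD''⟩ :=
    exists_visible_edge (hU.mono Finset.subset_union_left) χ (o := e.2) h1 h.left hχ hD h.aff.neg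
      D1 (fun w hw hne => hpos w (Finset.mem_union_left _ hw) hne
        fun hh => h2y (h.eq_of_mem (hh ▸ hw) h2))
      (by simp [h.zero]) (fun w hw hne => by simpa using h.neg w hw hne) D2.le
      (by simpa using (h.pos _ h2 h2y).le)
  refine exists_biEdge_not_mem hD' hs ht (by rw [hsc, htc]; exact hχ) Ds Dt hpos'
    (Finset.mem_union_right _ h2) ?_
  rw [hD'', D2]
  have := h.pos _ h2 h2y
  nlinarith

theorem mem_crossPairs_swap {U₁ U₂ : Finset Pt} {y : Pt} {e : Pt × Pt}
    (h : e ∈ crossPairs U₁ U₂ y) : (e.2, e.1) ∈ crossPairs U₂ U₁ y := by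
  rw [mem_crossPairs] at h ⊢
  rw [Finset.union_comm]
  exact ⟨h.2.1, h.1, h.2.2.symm⟩

theorem Separates.exists_new_right {U₁ U₂ : Finset Pt} {y : Pt} {L : Pt → ℝ}
    (h : Separates U₁ U₂ y L)
    (hU : GenPos (U₁ ∪ U₂)) {χ : Pt → Bool} {e : Pt × Pt} (he : e ∈ crossPairs U₁ U₂ y)
    (hχ : χ e.2 ≠ χ y) : ∃ e ∈ biEdges χ U₂, e ∉ biEdges χ (U₁ ∪ U₂) := by
  rw [Finset.union_comm] at hU ⊢
  exact h.symm.exists_new_left hU (mem_crossPairs_swap he) hχ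

/-- Splitting at a point does not decrease the number of bichromatic hull edges. -/
theorem Separates.card_le {U₁ U₂ : Finset Pt} {y : Pt} {L : Pt → ℝ} (h : Separates U₁ U₂ y L)
    (hU : GenPos (U₁ ∪ U₂)) (χ : Pt → Bool) :
    (biEdges χ (U₁ ∪ U₂)).card ≤ (biEdges χ U₁).card + (biEdges χ U₂).card := by
  have h0 := h.card_biEdges_le χ
  obtain ⟨k, hk⟩ := even_card_biEdges hU χ
  obtain ⟨k1, hk1⟩ := even_card_biEdges (hU.mono Finset.subset_union_left) χ
  obtain ⟨k2, hk2⟩ := even_card_biEdges (hU.mono Finset.subset_union_right) χ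
  have h2 : (biCrossPairs χ U₁ U₂ y).card ≤ 2 :=
    (Finset.card_filter_le _ _).trans h.card_crossPairs_le_two
  by_cases h1 : (biCrossPairs χ U₁ U₂ y).card ≤ 1
  · omega
  · obtain ⟨e, he⟩ := Finset.card_pos.1 (show 0 < (biCrossPairs χ U₁ U₂ y).card by omega)
    obtain ⟨he, hχ⟩ := Finset.mem_filter.1 he
    have : 0 < (newEdges χ U₁ U₂).card := by
      rw [Finset.card_pos]
      by_cases hc : χ e.1 = χ y
      · obtain ⟨e', h1, h2⟩ := h.exists_new_right hU he (fun hh => hχ (hc.trans hh.symm))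
        exact ⟨e', mem_newEdges_right h1 h2⟩
      · obtain ⟨e', h1, h2⟩ := h.exists_new_left hU he hc
        exact ⟨e', mem_newEdges_left h1 h2⟩
    omega

/-- If a monochromatic hull edge of the colour opposite to `y` crosses between the parts,
splitting at `y` creates two bichromatic hull edges. -/
theorem Separates.card_add_two_le_of_mono {U₁ U₂ : Finset Pt} {y : Pt} {L : Pt → ℝ}
    (h : Separates U₁ U₂ y L) (hU : GenPos (U₁ ∪ U₂)) {χ : Pt → Bool} {e : Pt × Pt}
    (he : e ∈ crossPairs U₁ U₂ y) (h1 : χ e.1 ≠ χ y) (h2 : χ e.2 ≠ χ y) :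
    (biEdges χ (U₁ ∪ U₂)).card + 2 ≤ (biEdges χ U₁).card + (biEdges χ U₂).card := by
  have h0 := h.card_biEdges_le χ
  obtain ⟨k, hk⟩ := even_card_biEdges hU χ
  obtain ⟨k1, hk1⟩ := even_card_biEdges (hU.mono Finset.subset_union_left) χ
  obtain ⟨k2, hk2⟩ := even_card_biEdges (hU.mono Finset.subset_union_right) χ
  have h3 : (biCrossPairs χ U₁ U₂ y).card < (crossPairs U₁ U₂ y).card := by
    refine Finset.card_lt_card (Finset.filter_ssubset.2 ⟨e, he, ?_⟩)
    revert h1 h2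
    cases χ e.1 <;> cases χ e.2 <;> cases χ y <;> simp
  have h4 := h.card_crossPairs_le_two
  obtain ⟨e1, a1, b1⟩ := h.exists_new_left hU he h1
  obtain ⟨e2, a2, b2⟩ := h.exists_new_right hU he h2
  have h5 : 1 < (newEdges χ U₁ U₂).card := Finset.one_lt_card.2
    ⟨e1, mem_newEdges_left a1 b1, e2, mem_newEdges_right a2 b2, h.ne_of_mem_biEdges a1 a2⟩
  omega

/-- If both hull neighbours of `y` in `U₂` have the other colour, one of the two hull edges
of `U₂` at `y` is not a hull edge of the union, and neither of them is when two hull edges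
cross between the parts. -/
theorem Separates.exists_new_junction {U₁ U₂ : Finset Pt} {y p q : Pt} {L : Pt → ℝ}
    (h : Separates U₁ U₂ y L) (hU : GenPos (U₁ ∪ U₂)) {χ : Pt → Bool} (hp : p ∈ U₁) (hpy : p ≠ y)
    (hq : q ∈ U₂) (hqy : q ≠ y) (hopp : ∀ x, HullEdge U₂ y x → χ x ≠ χ y) :
    ∃ N ⊆ biEdges χ U₂, N ⊆ newEdges χ U₁ U₂ ∧ 1 ≤ N.card ∧
      (2 ≤ (crossPairs U₁ U₂ y).card → 2 ≤ N.card) := by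
  have hext : Extr U₂ y := ⟨L, h.aff, h.zero, h.pos⟩
  obtain ⟨⟨c, hc⟩, ⟨a, ha⟩⟩ := hext.exists_dirEdge (hU.mono Finset.subset_union_right) h.right
    ⟨q, Finset.mem_erase.2 ⟨hqy, hq⟩⟩
  have ec : (y, c) ∈ biEdges χ U₂ := mem_biEdges.2 ⟨hc, (hopp c hc.hullEdge).symm⟩
  have ea : (a, y) ∈ biEdges χ U₂ := mem_biEdges.2 ⟨ha, hopp a ha.hullEdge.symm⟩
  have hne : (y, c) ≠ (a, y) := fun hh => hc.2.2.1 (congrArg Prod.snd hh).symm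
  by_cases hY : Extr (U₁ ∪ U₂) y
  · have h1 := h.card_crossPairs_le_one hY
    have : ¬ (DirEdge (U₁ ∪ U₂) y c ∧ DirEdge (U₁ ∪ U₂) a y) := by
      rintro ⟨d1, d2⟩
      have hpa : p ≠ a := fun hh => hpy (h.eq_of_mem hp (hh ▸ ha.1))
      have hpc : p ≠ c := fun hh => hpy (h.eq_of_mem hp (hh ▸ hc.2.1))
      have q1 := d1.2.2.2 p (Finset.mem_union_left _ hp) hpy hpc
      have q2 := d2.2.2.2 p (Finset.mem_union_left _ hp) hpa hpy
      by_cases hac : a = c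
      · subst hac
        rw [det2_swap] at q2
        linarith
      · have q3 := hc.2.2.2 a ha.1 ha.2.2.1 hac
        have La := h.pos a ha.1 ha.2.2.1
        have Lc := h.pos c hc.2.1 hc.2.2.1.symm
        have Lp := h.neg p hp hpy
        have Ly := h.zero
        obtain ⟨α, β, γ, hL⟩ := h.aff
        have key : det2 y c a * (L p - L y) =
            det2 a y p * (L c - L y) + det2 y c p * (L a - L y) := by
          simp only [hL, det2]
          ring
        rw [Ly] at key
        nlinarith [mul_pos q1 La, mul_pos q2 Lc, mul_pos q3 (neg_pos.2 Lp)]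
    rcases not_and_or.1 this with hh | hh
    · exact ⟨{(y, c)}, by simpa using ec, by
        simpa using mem_newEdges_right ec fun h' => hh (mem_biEdges.1 h').1, by simp, by omega⟩
    · exact ⟨{(a, y)}, by simpa using ea, by
        simpa using mem_newEdges_right ea fun h' => hh (mem_biEdges.1 h').1, by simp, by omega⟩
  · have n1 : (y, c) ∈ newEdges χ U₁ U₂ :=
      mem_newEdges_right ec fun h' => hY (mem_biEdges.1 h').1.hullEdge.ext_left
    have n2 : (a, y) ∈ newEdges χ U₁ U₂ :=
      mem_newEdges_right ea fun h' => hY (mem_biEdges.1 h').1.hullEdge.ext_right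
    refine ⟨{(y, c), (a, y)}, ?_, ?_, ?_, ?_⟩
    · simp [Finset.insert_subset_iff, ec, ea]
    · simp [Finset.insert_subset_iff, n1, n2]
    · rw [Finset.card_pair hne]; omega
    · rw [Finset.card_pair hne]; omega

theorem Separates.card_add_two_le_of_junction_mono {U₁ U₂ : Finset Pt} {y : Pt} {L : Pt → ℝ}
    (h : Separates U₁ U₂ y L) (hU : GenPos (U₁ ∪ U₂)) {χ : Pt → Bool}
    (hopp : ∀ x, HullEdge U₂ y x → χ x ≠ χ y) {e : Pt × Pt} (he : e ∈ crossPairs U₁ U₂ y)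
    (hχ : χ e.1 = χ e.2) :
    (biEdges χ (U₁ ∪ U₂)).card + 2 ≤ (biEdges χ U₁).card + (biEdges χ U₂).card := by
  have h0 := h.card_biEdges_le χ
  obtain ⟨k, hk⟩ := even_card_biEdges hU χ
  obtain ⟨k1, hk1⟩ := even_card_biEdges (hU.mono Finset.subset_union_left) χ
  obtain ⟨k2, hk2⟩ := even_card_biEdges (hU.mono Finset.subset_union_right) χ
  have h3 : (biCrossPairs χ U₁ U₂ y).card < (crossPairs U₁ U₂ y).card :=
    Finset.card_lt_card (Finset.filter_ssubset.2 ⟨e, he, by simpa using hχ⟩)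
  have h4 := h.card_crossPairs_le_two
  obtain ⟨⟨h1y, h1⟩, ⟨h2y, h2⟩, -⟩ := mem_crossPairs.1 he
  obtain ⟨N, -, hN, hN1, hN2⟩ := h.exists_new_junction hU h1 h1y h2 h2y hopp
  have := Finset.card_le_card hN
  by_cases hc : 2 ≤ (crossPairs U₁ U₂ y).card
  · have := hN2 hc
    omega
  · omega

theorem Separates.card_add_two_le_of_junction_edge {U₁ U₂ : Finset Pt} {y a o : Pt} {L D : Pt → ℝ}
    (h : Separates U₁ U₂ y L) (hU : GenPos (U₁ ∪ U₂)) {χ : Pt → Bool}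
    (hopp : ∀ x, HullEdge U₂ y x → χ x ≠ χ y) (ho : o ∈ U₂) (ha : a ∈ U₁)
    (hχ : χ a ≠ χ y) (hD : IsAff D) (Da : D a = 0) (Dy : D y = 0)
    (hpos : ∀ w ∈ U₁, w ≠ a → w ≠ y → 0 < D w) (Do : D o < 0) :
    (biEdges χ (U₁ ∪ U₂)).card + 2 ≤ (biEdges χ U₁).card + (biEdges χ U₂).card := by
  have h0 := h.card_biEdges_le χ
  obtain ⟨k, hk⟩ := even_card_biEdges hU χ
  obtain ⟨k1, hk1⟩ := even_card_biEdges (hU.mono Finset.subset_union_left) χ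
  obtain ⟨k2, hk2⟩ := even_card_biEdges (hU.mono Finset.subset_union_right) χ
  have h3 : (biCrossPairs χ U₁ U₂ y).card ≤ (crossPairs U₁ U₂ y).card :=
    Finset.card_filter_le _ _
  have h4 := h.card_crossPairs_le_two
  have oy : o ≠ y := by rintro rfl; linarith
  obtain ⟨N, hN', hN, hN1, hN2⟩ := h.exists_new_junction hU ha (fun hh => hχ (hh ▸ rfl)) ho oy hopp
  obtain ⟨e, e1, e2⟩ := exists_biEdge_not_mem (U := U₁ ∪ U₂) hD ha h.left hχ Da Dy hpos
    (Finset.mem_union_right _ ho) Do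
  have heN : e ∉ N := fun hh => h.ne_of_mem_biEdges e1 (hN' hh) rfl
  have := Finset.card_le_card (Finset.insert_subset (mem_newEdges_left e1 e2) hN)
  rw [Finset.card_insert_of_notMem heN] at this
  by_cases hc : 2 ≤ (crossPairs U₁ U₂ y).card
  · have := hN2 hc
    omega
  · omega

/-! ### Colour excess and balanced splitting lines -/

theorem colExc_insert {χ : Pt → Bool} {c : Bool} {T : Finset Pt} {a : Pt} (ha : a ∉ T) :
    colExc χ c (insert a T) = (if χ a = c then 1 else -1) + colExc χ c T := by
  rw [colExc, Finset.sum_insert ha, colExc]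

theorem colExc_erase {χ : Pt → Bool} {c : Bool} {T : Finset Pt} {a : Pt} (ha : a ∈ T) :
    colExc χ c (T.erase a) = colExc χ c T - if χ a = c then 1 else -1 := by
  rw [colExc, colExc, ← Finset.sum_erase_add _ _ ha]
  ring

theorem colExc_of_ne {χ : Pt → Bool} {c c' : Bool} (h : c ≠ c') (T : Finset Pt) :
    colExc χ c T = -colExc χ c' T := by
  rw [colExc, colExc, ← Finset.sum_neg_distrib]
  refine Finset.sum_congr rfl fun w _ => ?_
  revert h
  cases c <;> cases c' <;> cases χ w <;> simp

theorem colExc_eq_zero_of_ne {χ : Pt → Bool} {c c' : Bool} (h : c ≠ c') {T : Finset Pt}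
    (hT : colExc χ c T = 0) : colExc χ c' T = 0 := by
  rw [colExc_of_ne h.symm, hT, neg_zero]

theorem colExc_filter_add_not {χ : Pt → Bool} {c : Bool} (T : Finset Pt) (P : Pt → Prop) :
    colExc χ c (T.filter P) + colExc χ c (T.filter fun w => ¬ P w) = colExc χ c T :=
  Finset.sum_filter_add_sum_filter_not _ _ _

theorem colExc_pair {χ : Pt → Bool} {c : Bool} {a b : Pt} (h : χ a ≠ χ b) :
    colExc χ c {a, b} = 0 := by
  have hab : a ∉ ({b} : Finset Pt) := fun hh => h (by rw [Finset.mem_singleton.1 hh])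
  rw [colExc_insert hab, colExc, Finset.sum_singleton]
  revert h
  cases χ a <;> cases χ b <;> cases c <;> simp

/-- If the weights `±1` of a finite set sum to at most `-1`, some upper segment of it with
respect to an injective key starts with weight `-1` and sums to `-1`. -/
theorem exists_upper_segment (key : Pt → ℝ) (sg : Pt → ℤ) (A : Finset Pt)
    (hinj : Set.InjOn key A) (hsg : ∀ w ∈ A, sg w = 1 ∨ sg w = -1)
    (hsum : 1 + ∑ w ∈ A, sg w ≤ 0) :
    ∃ q ∈ A, sg q = -1 ∧ ∑ w ∈ A.filter (fun w => key q ≤ key w), sg w = -1 := by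
  induction A using Finset.strongInduction with
  | H A ih =>
    have hne : A.Nonempty := by
      rw [Finset.nonempty_iff_ne_empty]
      rintro rfl
      simp at hsum
    obtain ⟨m, hm, hmin⟩ := A.exists_min_image key hne
    have hs := Finset.sum_erase_add A sg hm
    by_cases hcase : 1 + ∑ w ∈ A.erase m, sg w ≤ 0
    · obtain ⟨q, hq, hq1, hq2⟩ := ih (A.erase m) (Finset.erase_ssubset hm)
        (hinj.mono (by simp)) (fun w hw => hsg w (Finset.mem_of_mem_erase hw)) hcase
      have hqA := Finset.mem_of_mem_erase hq
      refine ⟨q, hqA, hq1, ?_⟩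
      rw [← hq2]
      refine Finset.sum_congr ?_ fun _ _ => rfl
      ext w
      simp only [Finset.mem_filter, Finset.mem_erase]
      constructor
      · rintro ⟨h1, h2⟩
        refine ⟨⟨?_, h1⟩, h2⟩
        rintro rfl
        exact Finset.ne_of_mem_erase hq (hinj hqA h1 (le_antisymm h2 (hmin q hqA)))
      · rintro ⟨⟨-, h1⟩, h2⟩
        exact ⟨h1, h2⟩
    · refine ⟨m, hm, ?_, ?_⟩
      · rcases hsg m hm with h | h
        · omega
        · exact h
      · rw [Finset.filter_true_of_mem hmin]
        rcases hsg m hm with h | h <;> omega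

theorem exists_split_of_excess {S : Finset Pt} (hS : GenPos S) {χ : Pt → Bool} {p o : Pt}
    (hp : p ∈ S) (hext : Extr S p) {Λ : Pt → ℝ} (hΛ : IsAff Λ) (Λp : Λ p = 0) (ho : o ∈ S)
    (hop : o ≠ p) (Λo : Λ o ≤ 0) (hex : 1 + colExc χ (χ p) (S.filter fun w => 0 < Λ w) ≤ 0) :
    ∃ q ∈ S, χ q ≠ χ p ∧ 0 < Λ q ∧ ∃ L, IsAff L ∧ L p = 0 ∧ L q = 0 ∧
      colExc χ (χ p) (S.filter fun w => 0 ≤ L w) = 0 ∧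
      (∀ w ∈ S, w ≠ p → Λ w ≤ 0 → L w < 0) ∧ ∀ w ∈ S, L w = 0 → w = p ∨ w = q := by
  obtain ⟨F, hF, Fp, hpos⟩ := hext
  have hne : ∀ {w}, 0 < Λ w → w ≠ p := fun h hh => by rw [hh, Λp] at h; exact lt_irrefl _ h
  let G : Pt → Pt → ℝ := fun q w => F q * Λ w + -Λ q * F w + 0
  have hG : ∀ q, IsAff (G q) := fun q => hΛ.lin hF _ _ _
  have Gneg : ∀ q ∈ S, 0 < Λ q → ∀ w ∈ S, w ≠ p → Λ w ≤ 0 → G q w < 0 := by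
    intro q hq hΛq w hw hwp hΛw
    have h1 := mul_pos hΛq (hpos w hw hwp)
    have h2 := hpos q hq (hne hΛq)
    simp only [G]
    nlinarith
  have Gzero : ∀ q ∈ S, 0 < Λ q → ∀ w ∈ S, G q w = 0 → w = p ∨ w = q := by
    intro q hq hΛq w hw h0
    by_contra hcon
    push Not at hcon
    refine hS.aff_ne_zero (hG q) hp hq hw (hne hΛq).symm hcon.1 hcon.2 ?_ ?_
      (Gneg q hq hΛq o ho hop Λo).ne h0
    · simp only [G, Λp, Fp]; ring
    · simp only [G]; ring
  have hkey : ∀ q ∈ S, 0 < Λ q → ∀ w ∈ S, 0 < Λ w → (Λ q / F q ≤ Λ w / F w ↔ 0 ≤ G q w) := by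
    intro q hq hΛq w hw hΛw
    rw [div_le_div_iff₀ (hpos q hq (hne hΛq)) (hpos w hw (hne hΛw))]
    simp only [G]
    constructor <;> intro h <;> linarith
  obtain ⟨q, hq, hq1, hq2⟩ := exists_upper_segment (fun w => Λ w / F w)
    (fun w => if χ w = χ p then 1 else -1) (S.filter fun w => 0 < Λ w) (by
      intro q hq w hw h
      obtain ⟨hq, hΛq⟩ := Finset.mem_filter.1 hq
      obtain ⟨hw, hΛw⟩ := Finset.mem_filter.1 hw
      have h1 := (hkey q hq hΛq w hw hΛw).1 h.le
      have h2 := (hkey w hw hΛw q hq hΛq).1 h.ge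
      simp only [G] at h1 h2
      exact ((Gzero q hq hΛq w hw (by simp only [G]; linarith)).resolve_left (hne hΛw)).symm)
    (fun w _ => by split_ifs <;> simp) hex
  obtain ⟨hq, hΛq⟩ := Finset.mem_filter.1 hq
  refine ⟨q, hq, fun h => by simp [h] at hq1, hΛq, G q, hG q, ?_, ?_, ?_, Gneg q hq hΛq,
    Gzero q hq hΛq⟩
  · simp only [G, Λp, Fp]; ring
  · simp only [G]; ring
  · have hset : (S.filter fun w => 0 ≤ G q w) = insert p ((S.filter fun w => 0 < Λ w).filter
        fun w => Λ q / F q ≤ Λ w / F w) := by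
      ext w
      simp only [Finset.mem_filter, Finset.mem_insert]
      constructor
      · rintro ⟨hw, h0⟩
        by_cases hwp : w = p
        · exact Or.inl hwp
        · have hΛw : 0 < Λ w := by
            by_contra hcon
            exact absurd (Gneg q hq hΛq w hw hwp (not_lt.1 hcon)) (not_lt.2 h0)
          exact Or.inr ⟨⟨hw, hΛw⟩, (hkey q hq hΛq w hw hΛw).2 h0⟩
      · rintro (rfl | ⟨⟨hw, hΛw⟩, h⟩)
        · exact ⟨hp, by simp [G, Λp, Fp]⟩
        · exact ⟨hw, (hkey q hq hΛq w hw hΛw).1 h⟩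
    rw [hset, colExc_insert (by simp [Λp])]
    rw [colExc, hq2]
    simp

/-- A line through `p` and the differently coloured point `q` with a balanced closed side
not containing `o`. -/
def Split (χ : Pt → Bool) (S : Finset Pt) (p q o : Pt) : Prop :=
  q ∈ S ∧ χ q ≠ χ p ∧ ∃ L, IsAff L ∧ L p = 0 ∧ L q = 0 ∧ L o < 0 ∧
    (∀ w ∈ S, L w = 0 → w = p ∨ w = q) ∧ colExc χ (χ p) (S.filter fun w => 0 ≤ L w) = 0

/-- The pair `a`, `b` spans a hull edge or admits a balanced split at one of its points. -/
def Good (χ : Pt → Bool) (S : Finset Pt) (a b : Pt) : Prop :=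
  HullEdge S a b ∨ (∃ q, Split χ S a q b) ∨ ∃ q, Split χ S b q a

theorem Good.symm {χ : Pt → Bool} {S : Finset Pt} {a b : Pt} (h : Good χ S a b) :
    Good χ S b a :=
  h.elim (fun h => Or.inl h.symm) fun h => Or.inr h.symm

theorem HullEdge.split {χ : Pt → Bool} {S : Finset Pt} {a x b : Pt} (h : HullEdge S a x)
    (hχ : χ x ≠ χ a) (hb : b ∈ S) (hba : b ≠ a) (hbx : b ≠ x) : Split χ S a x b := by
  obtain ⟨ha, hx, hax, f, hf, fa, fx, hpos⟩ := h
  refine ⟨hx, hχ, fun w => -f w, hf.neg, by simp [fa], by simp [fx],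
    by simpa using hpos b hb hba hbx, fun w hw h0 => ?_, ?_⟩
  · by_contra hcon
    push Not at hcon
    have := hpos w hw hcon.1 hcon.2
    linarith
  · have : (S.filter fun w => 0 ≤ -f w) = {a, x} := by
      ext w
      simp only [Finset.mem_filter, Finset.mem_insert, Finset.mem_singleton]
      constructor
      · rintro ⟨hw, h0⟩
        by_contra hcon
        push Not at hcon
        have := hpos w hw hcon.1 hcon.2
        linarith
      · rintro (rfl | rfl)
        · exact ⟨ha, by simp [fa]⟩
        · exact ⟨hx, by simp [fx]⟩
    rw [this]
    exact colExc_pair hχ.symm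

theorem exists_split_toward {S : Finset Pt} (hS : GenPos S) {χ : Pt → Bool} {p o : Pt}
    (hp : p ∈ S) (hext : Extr S p) {Λ : Pt → ℝ} (hΛ : IsAff Λ) (Λp : Λ p = 0) (ho : o ∈ S)
    (hop : o ≠ p) (Λo : Λ o ≤ 0) (hex : 1 + colExc χ (χ p) (S.filter fun w => 0 < Λ w) ≤ 0) :
    ∃ q, Split χ S p q o := by
  obtain ⟨q, hq, hχ, -, L, hL, Lp, Lq, hL0, hneg, hz⟩ :=
    exists_split_of_excess hS hp hext hΛ Λp ho hop Λo hex
  exact ⟨q, hq, hχ, L, hL, Lp, Lq, hneg o ho hop Λo, hz, hL0⟩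

/-- The colour excess of `S` splits along a line through exactly two points of `S`. -/
theorem colExc_eq_sides {S : Finset Pt} {χ : Pt → Bool} (c : Bool) {a b : Pt} {Λ : Pt → ℝ}
    (ha : a ∈ S) (hb : b ∈ S) (hab : a ≠ b) (Λa : Λ a = 0) (Λb : Λ b = 0)
    (hz : ∀ w ∈ S, Λ w = 0 → w = a ∨ w = b) :
    colExc χ c S = colExc χ c (S.filter fun w => 0 < Λ w) +
      colExc χ c (S.filter fun w => Λ w < 0) + colExc χ c {a, b} ∧
    colExc χ c (S.filter fun w => 0 ≤ Λ w) =
      colExc χ c (S.filter fun w => 0 < Λ w) + colExc χ c {a, b} := by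
  have h1 := colExc_filter_add_not (χ := χ) (c := c) S fun w => 0 ≤ Λ w
  have h2 := colExc_filter_add_not (χ := χ) (c := c) (S.filter fun w => 0 ≤ Λ w) fun w => 0 < Λ w
  have e1 : (S.filter fun w => ¬ 0 ≤ Λ w) = S.filter fun w => Λ w < 0 :=
    Finset.filter_congr fun w _ => not_le
  have e2 : ((S.filter fun w => 0 ≤ Λ w).filter fun w => 0 < Λ w) =
      S.filter fun w => 0 < Λ w := by
    rw [Finset.filter_filter]
    exact Finset.filter_congr fun w _ => ⟨fun h => h.2, fun h => ⟨h.le, h⟩⟩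
  have e3 : ((S.filter fun w => 0 ≤ Λ w).filter fun w => ¬ 0 < Λ w) = {a, b} := by
    ext w
    simp only [Finset.mem_filter, Finset.mem_insert, Finset.mem_singleton]
    constructor
    · rintro ⟨⟨hw, h0⟩, h1⟩
      exact hz w hw (le_antisymm (not_lt.1 h1) h0)
    · rintro (rfl | rfl)
      · exact ⟨⟨ha, Λa.ge⟩, by simp [Λa]⟩
      · exact ⟨⟨hb, Λb.ge⟩, by simp [Λb]⟩
  rw [e1] at h1
  rw [e2, e3] at h2
  constructor <;> omega

/-- If neither a hull edge nor a split is available at `a`, the line through `a` and `b`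
has balanced sides. -/
theorem colExc_side_eq_zero {S : Finset Pt} (hS : GenPos S) {χ : Pt → Bool} {a b : Pt}
    (ha : a ∈ S) (hb : b ∈ S) (hext : Extr S a) (hχ : χ a ≠ χ b) (hbal : colExc χ (χ a) S = 0)
    (hno : ∀ q, ¬ Split χ S a q b) {Λ : Pt → ℝ} (hΛ : IsAff Λ) (Λa : Λ a = 0) (Λb : Λ b = 0)
    (hz : ∀ w ∈ S, Λ w = 0 → w = a ∨ w = b) :
    colExc χ (χ a) (S.filter fun w => 0 < Λ w) = 0 := by
  have hab : a ≠ b := fun h => hχ (h ▸ rfl)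
  have h1 : ¬ (1 + colExc χ (χ a) (S.filter fun w => 0 < Λ w) ≤ 0) := fun h =>
    let ⟨q, hq⟩ := exists_split_toward hS ha hext hΛ Λa hb hab.symm Λb.le h
    hno q hq
  have h2 : ¬ (1 + colExc χ (χ a) (S.filter fun w => 0 < -Λ w) ≤ 0) := fun h =>
    let ⟨q, hq⟩ := exists_split_toward hS ha hext hΛ.neg (by simp [Λa]) hb hab.symm
      (by simp [Λb]) h
    hno q hq
  simp only [neg_pos] at h2
  have h3 := (colExc_eq_sides (χ := χ) (χ a) ha hb hab Λa Λb hz).1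
  rw [hbal, colExc_pair hχ] at h3
  omega

/-- At most one point of each colour class is bad with respect to `b`. -/
theorem Good.of_not_good {S : Finset Pt} (hS : GenPos S) {χ : Pt → Bool} {a b a' : Pt}
    (ha : a ∈ S) (hb : b ∈ S) (hext : Extr S a) (hχ : χ a ≠ χ b) (hbal : colExc χ (χ a) S = 0)
    (hno : ¬ Good χ S a b) (ha' : a' ∈ S) (hne : a' ≠ a) (hχ' : χ a' = χ a) :
    Good χ S a' b := by
  have hab : a ≠ b := fun h => hχ (h ▸ rfl)
  have ha'b : a' ≠ b := fun h => hχ (h ▸ hχ').symm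
  have hno' : ∀ q, ¬ Split χ S a q b := fun q hq => hno (Or.inr (Or.inl ⟨q, hq⟩))
  have hdet := hS a ha b hb a' ha' hab hne.symm ha'b.symm
  have main : ∀ Λ : Pt → ℝ, IsAff Λ → Λ a = 0 → Λ b = 0 → Λ a' < 0 → Good χ S a' b := by
    intro Λ hΛ Λa Λb Λa'
    have hz : ∀ w ∈ S, Λ w = 0 → w = a ∨ w = b := fun w hw h0 => by
      by_contra hcon
      push Not at hcon
      exact hS.aff_ne_zero hΛ ha hb hw hab hcon.1 hcon.2 Λa Λb Λa'.ne h0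
    have h1 := colExc_side_eq_zero hS ha hb hext hχ hbal hno' hΛ Λa Λb hz
    have h2 := (colExc_eq_sides (χ := χ) (χ a) ha hb hab Λa Λb hz).2
    rw [h1, colExc_pair hχ, add_zero] at h2
    exact Or.inr (Or.inr ⟨a, ha, hχ, Λ, hΛ, Λb, Λa, Λa', fun w hw h0 => (hz w hw h0).symm,
      colExc_eq_zero_of_ne hχ h2⟩)
  rcases hdet.lt_or_gt with h | h
  · exact main _ (isAff_det2 a b) (det2_left a b) (det2_right a b) h
  · exact main _ (isAff_det2 a b).neg (by simp [det2_left]) (by simp [det2_right])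
      (by simpa using h)

/-! ### Alternating paths and their crossings -/

/-- Number of ordered pairs of crossing members of `es`, each member crossing itself. -/
def crossSum (es : List (Pt × Pt)) : ℕ :=
  (es.map fun e => es.countP fun f => SegCross e f).sum

theorem SegCross.refl (e : Pt × Pt) : SegCross e e :=
  ⟨midpoint ℝ e.1 e.2, midpoint_mem_openSegment _ _, midpoint_mem_openSegment _ _⟩

theorem SegCross.symm {e f : Pt × Pt} (h : SegCross e f) : SegCross f e := by
  obtain ⟨x, h1, h2⟩ := h
  exact ⟨x, h2, h1⟩

theorem segCross_swap_iff {e f : Pt × Pt} : SegCross e.swap f.swap ↔ SegCross e f := by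
  simp only [SegCross, Prod.fst_swap, Prod.snd_swap]
  rw [openSegment_symm ℝ e.2 e.1, openSegment_symm ℝ f.2 f.1]

theorem card_filter_range_getD (es : List (Pt × Pt)) (d : Pt × Pt) (P : Pt × Pt → Prop) :
    ((Finset.range es.length).filter fun j => P (es.getD j d)).card =
      es.countP fun f => P f := by
  induction es using List.reverseRecOn with
  | nil => simp
  | append_singleton l e ih =>
    rw [List.countP_append, ← ih, List.length_append, List.length_singleton,
      Finset.range_add_one, Finset.filter_insert]
    have h1 : (Finset.range l.length).filter (fun j => P ((l ++ [e]).getD j d)) =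
        (Finset.range l.length).filter fun j => P (l.getD j d) := by
      refine Finset.filter_congr fun j hj => ?_
      rw [List.getD_append _ _ _ _ (Finset.mem_range.1 hj)]
    have h2 : (l ++ [e]).getD l.length d = e := by simp
    rw [h1, h2]
    by_cases hP : P e
    · rw [if_pos hP, Finset.card_insert_of_notMem (by simp)]
      simp [hP]
    · rw [if_neg hP]
      simp [hP]

theorem edgeCrossCount_add_one (es : List (Pt × Pt)) {i : ℕ} (hi : i < es.length) :
    edgeCrossCount es i + 1 =
      es.countP fun f => SegCross (es.getD i ((0, 0), (0, 0))) f := by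
  rw [← card_filter_range_getD es ((0, 0), (0, 0)), edgeCrossCount]
  have hmem : i ∈ (Finset.range es.length).filter fun j =>
      SegCross (es.getD i ((0, 0), (0, 0))) (es.getD j ((0, 0), (0, 0))) :=
    Finset.mem_filter.2 ⟨Finset.mem_range.2 hi, SegCross.refl _⟩
  rw [← Finset.card_erase_add_one hmem]
  congr 2
  ext j
  simp only [Finset.mem_filter, Finset.mem_erase]
  tauto

theorem onePlane_of_countP {es : List (Pt × Pt)}
    (h : ∀ e ∈ es, (es.countP fun f => SegCross e f) ≤ 2) : OnePlane es := by
  intro i hi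
  have hi := Finset.mem_range.1 hi
  have h1 := edgeCrossCount_add_one es hi
  rw [List.getD_eq_getElem _ _ hi] at h1
  have := h _ (List.getElem_mem hi)
  omega

theorem sum_range_getD (es : List (Pt × Pt)) (d : Pt × Pt) (g : Pt × Pt → ℕ) :
    ∑ i ∈ Finset.range es.length, g (es.getD i d) = (es.map g).sum := by
  induction es using List.reverseRecOn with
  | nil => simp
  | append_singleton l e ih =>
    rw [List.length_append, List.length_singleton, Finset.sum_range_succ, List.map_append,
      List.sum_append, ← ih]
    congr 1
    · refine Finset.sum_congr rfl fun j hj => ?_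
      rw [List.getD_append _ _ _ _ (Finset.mem_range.1 hj)]
    · simp

theorem crossSum_eq (es : List (Pt × Pt)) : crossSum es = 2 * crossNum es + es.length := by
  set d : Pt × Pt := ((0, 0), (0, 0)) with hd
  have h1 : crossSum es = ∑ i ∈ Finset.range es.length, (edgeCrossCount es i + 1) := by
    rw [crossSum, ← sum_range_getD es d]
    exact Finset.sum_congr rfl fun i hi =>
      (edgeCrossCount_add_one es (Finset.mem_range.1 hi)).symm
  set C : ℕ × ℕ → Prop := fun ij => SegCross (es.getD ij.1 d) (es.getD ij.2 d) with hC
  set Q := Finset.range es.length ×ˢ Finset.range es.length with hQ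
  have h2 : ∑ i ∈ Finset.range es.length, edgeCrossCount es i =
      (Q.filter fun ij => ij.2 ≠ ij.1 ∧ C ij).card := by
    rw [Finset.card_filter, hQ, Finset.sum_product]
    refine Finset.sum_congr rfl fun i _ => ?_
    rw [edgeCrossCount, Finset.card_filter]
  have h3 : (Q.filter fun ij => ij.2 ≠ ij.1 ∧ C ij) =
      (Q.filter fun ij => ij.1 < ij.2 ∧ C ij) ∪ Q.filter fun ij => ij.2 < ij.1 ∧ C ij := by
    rw [← Finset.filter_or]
    refine Finset.filter_congr fun ij _ => ?_
    constructor
    · rintro ⟨h, hc⟩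
      exact h.lt_or_gt.elim (fun h => Or.inr ⟨h, hc⟩) fun h => Or.inl ⟨h, hc⟩
    · rintro (⟨h, hc⟩ | ⟨h, hc⟩)
      · exact ⟨h.ne', hc⟩
      · exact ⟨h.ne, hc⟩
  have h4 : (Q.filter fun ij => ij.2 < ij.1 ∧ C ij).card =
      (Q.filter fun ij => ij.1 < ij.2 ∧ C ij).card := by
    refine Finset.card_bij' (fun ij _ => ij.swap) (fun ij _ => ij.swap) ?_ ?_
      (fun _ _ => Prod.swap_swap _) (fun _ _ => Prod.swap_swap _)
    · rintro ⟨i, j⟩ h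
      obtain ⟨h0, h1, h2⟩ := Finset.mem_filter.1 h
      obtain ⟨hi, hj⟩ := Finset.mem_product.1 h0
      exact Finset.mem_filter.2 ⟨Finset.mem_product.2 ⟨hj, hi⟩, h1, SegCross.symm h2⟩
    · rintro ⟨i, j⟩ h
      obtain ⟨h0, h1, h2⟩ := Finset.mem_filter.1 h
      obtain ⟨hi, hj⟩ := Finset.mem_product.1 h0
      exact Finset.mem_filter.2 ⟨Finset.mem_product.2 ⟨hj, hi⟩, h1, SegCross.symm h2⟩
  have h5 : (Q.filter fun ij => ij.1 < ij.2 ∧ C ij).card = crossNum es := rfl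
  rw [h1, Finset.sum_add_distrib, h2, h3, Finset.card_union_of_disjoint, h4, h5]
  · simp; ring
  · refine Finset.disjoint_left.2 fun ij ha hb => ?_
    exact lt_asymm (Finset.mem_filter.1 ha).2.1 (Finset.mem_filter.1 hb).2.1

theorem pathEdges_cons_cons (a b : Pt) (l : List Pt) :
    pathEdges (a :: b :: l) = (a, b) :: pathEdges (b :: l) := rfl

theorem pathEdges_append (l l' : List Pt) (y : Pt) :
    pathEdges (l ++ y :: l') = pathEdges (l ++ [y]) ++ pathEdges (y :: l') := by
  induction l with
  | nil => simp [pathEdges]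
  | cons a l ih =>
    cases l with
    | nil => simp [pathEdges]
    | cons b l =>
      simp only [List.cons_append, pathEdges_cons_cons] at ih ⊢
      rw [ih]

theorem pathEdges_reverse (l : List Pt) :
    pathEdges l.reverse = ((pathEdges l).map Prod.swap).reverse := by
  induction l with
  | nil => rfl
  | cons a l ih =>
    cases l with
    | nil => rfl
    | cons b l =>
      rw [pathEdges_cons_cons, List.map_cons, List.reverse_cons (as := List.map _ _), ← ih,
        List.reverse_cons, List.reverse_cons, List.append_assoc, List.singleton_append,
        pathEdges_append]
      rfl

theorem mem_pathEdges {l : List Pt} {e : Pt × Pt} (h : e ∈ pathEdges l) :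
    e.1 ∈ l ∧ e.2 ∈ l :=
  ⟨(List.of_mem_zip h).1, List.mem_of_mem_tail (List.of_mem_zip h).2⟩

theorem length_pathEdges (l : List Pt) : (pathEdges l).length = l.length - 1 := by
  simp [pathEdges]

/-- `l` is a 1-plane alternating path on the vertex set `U` from `a` to `b`. -/
structure IsAltPath (χ : Pt → Bool) (U : Finset Pt) (a b : Pt) (l : List Pt) : Prop where
  nodup : l.Nodup
  cover : l.toFinset = U
  head : l.head? = some a
  last : l.getLast? = some b
  alt : ∀ e ∈ pathEdges l, χ e.1 ≠ χ e.2
  onePlane : ∀ e ∈ pathEdges l, ((pathEdges l).countP fun f => SegCross e f) ≤ 2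

theorem IsAltPath.mem_of_edge {χ : Pt → Bool} {U : Finset Pt} {a b : Pt} {l : List Pt}
    (h : IsAltPath χ U a b l) {e : Pt × Pt} (he : e ∈ pathEdges l) : e.1 ∈ U ∧ e.2 ∈ U := by
  rw [← h.cover, List.mem_toFinset, List.mem_toFinset]
  exact mem_pathEdges he

theorem crossSum_reverse_swap (es : List (Pt × Pt)) :
    crossSum (es.map Prod.swap).reverse = crossSum es := by
  rw [crossSum, crossSum, List.map_reverse, List.sum_reverse, List.map_map]
  congr 1
  refine List.map_congr_left fun e _ => ?_
  rw [Function.comp_apply, List.countP_reverse, List.countP_map]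
  refine List.countP_congr fun f _ => ?_
  simpa using segCross_swap_iff

theorem IsAltPath.reverse {χ : Pt → Bool} {U : Finset Pt} {a b : Pt} {l : List Pt}
    (h : IsAltPath χ U a b l) :
    IsAltPath χ U b a l.reverse ∧
      crossSum (pathEdges l.reverse) = crossSum (pathEdges l) := by
  rw [pathEdges_reverse]
  refine ⟨⟨List.nodup_reverse.2 h.nodup, by rw [List.toFinset_reverse, h.cover],
    by rw [List.head?_reverse, h.last], by rw [List.getLast?_reverse, h.head], ?_, ?_⟩,
    crossSum_reverse_swap _⟩
  · intro e he
    rw [pathEdges_reverse, List.mem_reverse, List.mem_map] at he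
    obtain ⟨f, hf, rfl⟩ := he
    exact (h.alt f hf).symm
  · intro e he
    rw [pathEdges_reverse] at he ⊢
    rw [List.mem_reverse, List.mem_map] at he
    obtain ⟨f, hf, rfl⟩ := he
    refine le_of_eq_of_le ?_ (h.onePlane f hf)
    rw [List.countP_reverse, List.countP_map]
    refine List.countP_congr fun g _ => ?_
    simpa using segCross_swap_iff

theorem countP_eq_zero_of_not {es : List (Pt × Pt)} {P : Pt × Pt → Prop}
    (h : ∀ f ∈ es, ¬ P f) : (es.countP fun f => P f) = 0 := by
  rw [List.countP_eq_zero]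
  simpa using h

theorem crossSum_append {es fs : List (Pt × Pt)}
    (h : ∀ e ∈ es, ∀ f ∈ fs, ¬ SegCross e f) :
    crossSum (es ++ fs) = crossSum es + crossSum fs := by
  rw [crossSum, List.map_append, List.sum_append, crossSum, crossSum]
  congr 2
  · refine List.map_congr_left fun e he => ?_
    rw [List.countP_append, countP_eq_zero_of_not (h e he), add_zero]
  · refine List.map_congr_left fun f hf => ?_
    rw [List.countP_append, countP_eq_zero_of_not (P := SegCross f)
      (fun e he hc => h e he f hf hc.symm), zero_add]

theorem Separates.not_segCross {U₁ U₂ : Finset Pt} {y : Pt} {L : Pt → ℝ}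
    (h : Separates U₁ U₂ y L) {e f : Pt × Pt} (e1 : e.1 ∈ U₁) (e2 : e.2 ∈ U₁) (he : e.1 ≠ e.2)
    (f1 : f.1 ∈ U₂) (f2 : f.2 ∈ U₂) : ¬ SegCross e f := by
  rintro ⟨x, ⟨α, β, hα, hβ, hαβ, rfl⟩, ⟨α', β', hα', hβ', hαβ', hx⟩⟩
  have h1 := h.aff.combo e.1 e.2 hαβ
  have h2 := h.aff.combo f.1 f.2 hαβ'
  rw [hx, h1] at h2
  have neg : ∀ w ∈ U₁, L w ≤ 0 := fun w hw => by
    by_cases hy : w = y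
    · rw [hy, h.zero]
    · exact (h.neg w hw hy).le
  have pos : ∀ w ∈ U₂, 0 ≤ L w := fun w hw => by
    by_cases hy : w = y
    · rw [hy, h.zero]
    · exact (h.pos w hw hy).le
  have p1 := mul_nonneg hα'.le (pos _ f1)
  have p2 := mul_nonneg hβ'.le (pos _ f2)
  by_cases hy : e.1 = y
  · have := mul_neg_of_pos_of_neg hβ (h.neg _ e2 fun hh => he (hy.trans hh.symm))
    have := mul_nonpos_of_nonneg_of_nonpos hα.le (neg _ e1)
    linarith
  · have := mul_neg_of_pos_of_neg hα (h.neg _ e1 hy)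
    have := mul_nonpos_of_nonneg_of_nonpos hβ.le (neg _ e2)
    linarith

/-- Concatenating two paths at a separated common endpoint creates no crossings. -/
theorem Separates.glue {χ : Pt → Bool} {U₁ U₂ : Finset Pt} {a b y : Pt} {L : Pt → ℝ}
    {l₁ l₂ : List Pt} (h : Separates U₁ U₂ y L) (h1 : IsAltPath χ U₁ a y l₁)
    (h2 : IsAltPath χ U₂ y b l₂) :
    ∃ l, IsAltPath χ (U₁ ∪ U₂) a b l ∧
      crossSum (pathEdges l) = crossSum (pathEdges l₁) + crossSum (pathEdges l₂) := by
  obtain ⟨m₁, rfl⟩ := List.getLast?_eq_some_iff.1 h1.last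
  obtain ⟨m₂, rfl⟩ := List.head?_eq_some_iff.1 h2.head
  have hno : ∀ e ∈ pathEdges (m₁ ++ [y]), ∀ f ∈ pathEdges (y :: m₂), ¬ SegCross e f := by
    intro e he f hf
    obtain ⟨e1, e2⟩ := h1.mem_of_edge he
    obtain ⟨f1, f2⟩ := h2.mem_of_edge hf
    exact h.not_segCross e1 e2 (fun hh => h1.alt e he (congrArg χ hh)) f1 f2
  have hset : (m₁ ++ y :: m₂).toFinset = U₁ ∪ U₂ := by
    rw [← h1.cover, ← h2.cover]
    ext w
    simp only [List.mem_toFinset, List.mem_append, List.mem_cons, Finset.mem_union,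
      List.not_mem_nil]
    tauto
  refine ⟨m₁ ++ y :: m₂, ⟨?_, hset, ?_, ?_, ?_, ?_⟩, ?_⟩
  · rw [List.nodup_append]
    refine ⟨(List.nodup_append.1 h1.nodup).1, h2.nodup, ?_⟩
    rintro x hx z hz rfl
    have m1 : x ∈ U₁ := by rw [← h1.cover]; simp [hx]
    have m2 : x ∈ U₂ := by rw [← h2.cover]; simpa using hz
    have := h.eq_of_mem m1 m2
    subst this
    exact (List.nodup_append.1 h1.nodup).2.2 x hx x (by simp) rfl
  · rw [← h1.head]
    cases m₁ <;> simp
  · rw [List.getLast?_append, h2.last]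
    rfl
  · rw [pathEdges_append]
    intro e he
    rcases List.mem_append.1 he with he | he
    · exact h1.alt e he
    · exact h2.alt e he
  · rw [pathEdges_append]
    intro e he
    rw [List.countP_append]
    rcases List.mem_append.1 he with he | he
    · rw [countP_eq_zero_of_not (hno e he), add_zero]
      exact h1.onePlane e he
    · rw [countP_eq_zero_of_not (P := SegCross e) (fun f hf hc => hno f hf e he hc.symm), zero_add]
      exact h2.onePlane e he
  · rw [pathEdges_append, crossSum_append hno]

/-- Extending a path at both ends through a supporting line of its vertex set creates at most
one crossing. -/
theorem IsAltPath.wrap {χ : Pt → Bool} {U : Finset Pt} {a b u v : Pt} {D : Pt → ℝ}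
    {l : List Pt} (h : IsAltPath χ U u v l) (hD : IsAff D) (Da : D a < 0) (Db : D b < 0)
    (hab : a ≠ b) (hau : χ a ≠ χ u) (hvb : χ v ≠ χ b) (Du : D u = 0) (Dv : D v = 0)
    (hpos : ∀ w ∈ U, 0 ≤ D w) :
    ∃ l', IsAltPath χ (insert a (insert b U)) a b l' ∧
      crossSum (pathEdges l') ≤ crossSum (pathEdges l) + 4 := by
  have ha : a ∉ l := fun hh => by
    have := hpos a (by rw [← h.cover]; simpa using hh)
    linarith
  have hb : b ∉ l := fun hh => by
    have := hpos b (by rw [← h.cover]; simpa using hh)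
    linarith
  have hedges : pathEdges (a :: (l ++ [b])) = (a, u) :: (pathEdges l ++ [(v, b)]) := by
    obtain ⟨m, rfl⟩ := List.head?_eq_some_iff.1 h.head
    obtain ⟨m', hm'⟩ := List.getLast?_eq_some_iff.1 h.last
    rw [List.cons_append, pathEdges_cons_cons, ← List.cons_append, hm', List.append_assoc,
      List.singleton_append, pathEdges_append]
    rfl
  have hno : ∀ x w : Pt, D x < 0 → D w = 0 → ∀ f ∈ pathEdges l, ¬ SegCross (x, w) f := by
    rintro x w hx hw f hf ⟨z, ⟨α, β, hα, hβ, hαβ, rfl⟩, ⟨α', β', hα', hβ', hαβ', hz⟩⟩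
    have h1 := hD.combo x w hαβ
    have h2 := hD.combo f.1 f.2 hαβ'
    rw [hz, h1, hw] at h2
    have p1 := mul_nonneg hα'.le (hpos _ (h.mem_of_edge hf).1)
    have p2 := mul_nonneg hβ'.le (hpos _ (h.mem_of_edge hf).2)
    have := mul_neg_of_pos_of_neg hα hx
    linarith
  have hno1 := hno a u Da Du
  have hno2 : ∀ f ∈ pathEdges l, ¬ SegCross (v, b) f := fun f hf hc =>
    hno b v Db Dv f hf (by
      obtain ⟨z, hz1, hz2⟩ := hc
      exact ⟨z, by rw [openSegment_symm]; exact hz1, hz2⟩)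
  have c1 : ((a, u) :: (pathEdges l ++ [(v, b)])).countP (fun f => SegCross (a, u) f) ≤ 2 := by
    rw [List.countP_cons, List.countP_append, countP_eq_zero_of_not hno1]
    simp only [List.countP_singleton]
    split_ifs <;> omega
  have c2 : ((a, u) :: (pathEdges l ++ [(v, b)])).countP (fun f => SegCross (v, b) f) ≤ 2 := by
    rw [List.countP_cons, List.countP_append, countP_eq_zero_of_not hno2]
    simp only [List.countP_singleton]
    split_ifs <;> omega
  have c3 : ∀ e ∈ pathEdges l, ((a, u) :: (pathEdges l ++ [(v, b)])).countP
      (fun f => SegCross e f) = (pathEdges l).countP fun f => SegCross e f := by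
    intro e he
    rw [List.countP_cons_of_neg, List.countP_append, List.countP_singleton, if_neg, add_zero]
    · simpa using fun hc => hno2 e he (SegCross.symm hc)
    · simpa using fun hc => hno1 e he (SegCross.symm hc)
  refine ⟨a :: (l ++ [b]), ⟨?_, ?_, rfl, by simp [List.getLast?_cons], ?_, ?_⟩, ?_⟩
  · rw [List.nodup_cons, List.nodup_append]
    refine ⟨by simp [ha, hab], h.nodup, by simp, ?_⟩
    rintro x hx z hz rfl
    rw [List.mem_singleton] at hz
    exact hb (hz ▸ hx)
  · rw [← h.cover]
    ext w
    simp
  · rw [hedges]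
    intro e he
    simp only [List.mem_cons, List.mem_append, List.not_mem_nil, or_false] at he
    rcases he with rfl | he | rfl
    · exact hau
    · exact h.alt e he
    · exact hvb
  · rw [hedges]
    intro e he
    have he' := he
    simp only [List.mem_cons, List.mem_append, List.not_mem_nil, or_false] at he'
    rcases he' with rfl | he' | rfl
    · exact c1
    · rw [c3 e he']
      exact h.onePlane e he'
    · exact c2
  · rw [hedges, crossSum, List.map_cons, List.map_append, List.sum_cons, List.sum_append,
      List.map_congr_left c3, ← crossSum]
    simp only [List.map_cons, List.map_nil, List.sum_singleton]
    omega

theorem isAltPath_pair {χ : Pt → Bool} {a b : Pt} (h : χ a ≠ χ b) :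
    IsAltPath χ {a, b} a b [a, b] ∧ crossSum (pathEdges [a, b]) = 1 := by
  have hab : a ≠ b := fun hh => h (hh ▸ rfl)
  refine ⟨⟨by simp [hab], by simp, rfl, rfl, by simpa [pathEdges] using h, ?_⟩, ?_⟩
  · intro e _
    exact (List.countP_le_length).trans (by simp [pathEdges])
  · simp [pathEdges, crossSum, SegCross.refl]

/-! ### Paths between differently coloured endpoints -/

/-- The path bound for a balanced set and differently coloured endpoints. -/
def BalancedPaths (χ : Pt → Bool) (S : Finset Pt) : Prop :=
  ∀ a ∈ S, ∀ b ∈ S, χ a ≠ χ b → Extr S a → Extr S b → colExc χ (χ a) S = 0 → Good χ S a b →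
    ∃ l, IsAltPath χ S a b l ∧ crossSum (pathEdges l) + (biEdges χ S).card + 1 ≤ 2 * S.card

/-- The path bound for a set with one surplus point and endpoints of the surplus colour; it is
stronger when the first endpoint has a hull neighbour of its own colour. -/
def SurplusPaths (χ : Pt → Bool) (S : Finset Pt) : Prop :=
  ∀ a ∈ S, ∀ b ∈ S, a ≠ b → χ a = χ b → Extr S a → Extr S b → colExc χ (χ a) S = 1 →
    ∃ l, IsAltPath χ S a b l ∧ crossSum (pathEdges l) + (biEdges χ S).card ≤ 2 * S.card ∧
      ((∃ x, χ x = χ a ∧ HullEdge S a x) →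
        crossSum (pathEdges l) + (biEdges χ S).card + 2 ≤ 2 * S.card)

/-- Both path bounds hold for all sets with fewer than `n` points. -/
def PathsBelow (χ : Pt → Bool) (n : ℕ) : Prop :=
  ∀ T : Finset Pt, T.card < n → GenPos T → BalancedPaths χ T ∧ SurplusPaths χ T

theorem bool_eq_of_ne {a b c : Bool} (h1 : a ≠ b) (h2 : c ≠ b) : a = c := by
  revert h1 h2
  cases a <;> cases b <;> cases c <;> simp

/-- Separation by a line through `y`, perturbed so as to separate the points on the line too. -/
theorem exists_separates {U₁ U₂ : Finset Pt} {y : Pt} {L M : Pt → ℝ} (hL : IsAff L)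
    (hM : IsAff M) (Ly : L y = 0) (My : M y = 0) (h1 : y ∈ U₁) (h2 : y ∈ U₂)
    (hneg : ∀ w ∈ U₁, w ≠ y → L w < 0 ∨ L w = 0 ∧ M w < 0)
    (hpos : ∀ w ∈ U₂, w ≠ y → 0 < L w ∨ L w = 0 ∧ 0 < M w) :
    ∃ L', Separates U₁ U₂ y L' := by
  obtain ⟨K, hK⟩ := exists_tilt (U₁ ∪ U₂) L M
  refine ⟨fun w => K * L w + 1 * M w + 0, hL.lin hM _ _ _, by simp [Ly, My], h1, h2, ?_, ?_⟩
  · intro w hw hy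
    rcases hneg w hw hy with h | ⟨h, h'⟩
    · have := (hK w (Finset.mem_union_left _ hw)).2 h
      linarith
    · simp only [h]
      linarith
  · intro w hw hy
    rcases hpos w hw hy with h | ⟨h, h'⟩
    · have := (hK w (Finset.mem_union_right _ hw)).1 h
      linarith
    · simp only [h]
      linarith

theorem exists_path_of_split {χ : Pt → Bool} {S : Finset Pt} (hS : GenPos S)
    (ih : PathsBelow χ S.card) {a b q : Pt} (ha : a ∈ S) (hb : b ∈ S) (hχ : χ a ≠ χ b)
    (hext : Extr S b) (hbal : colExc χ (χ a) S = 0) (h : Split χ S a q b) :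
    ∃ l, IsAltPath χ S a b l ∧
      crossSum (pathEdges l) + (biEdges χ S).card + 1 ≤ 2 * S.card := by
  obtain ⟨hq, hqa, L, hL, La, Lq, Lb, hz, hL0⟩ := h
  have hqb : χ q = χ b := bool_eq_of_ne hqa hχ.symm
  have hqa' : q ≠ a := fun hh => hqa (hh ▸ rfl)
  have hqb' : q ≠ b := by rintro rfl; linarith
  set S₁ := S.filter fun w => 0 ≤ L w with hS₁
  set U := insert q (S.filter fun w => L w < 0) with hU
  have mS₁ : ∀ {w}, w ∈ S₁ ↔ w ∈ S ∧ 0 ≤ L w := Finset.mem_filter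
  have mU : ∀ {w}, w ∈ U ↔ w = q ∨ w ∈ S ∧ L w < 0 := by simp [hU]
  have hunion : S₁ ∪ U = S := by
    ext w
    rw [Finset.mem_union, mS₁, mU]
    constructor
    · rintro (h | rfl | h)
      · exact h.1
      · exact hq
      · exact h.1
    · intro hw
      rcases le_or_gt 0 (L w) with h | h
      · exact Or.inl ⟨hw, h⟩
      · exact Or.inr (Or.inr ⟨hw, h⟩)
  have aS₁ : a ∈ S₁ := mS₁.2 ⟨ha, La.ge⟩
  have qS₁ : q ∈ S₁ := mS₁.2 ⟨hq, Lq.ge⟩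
  have qU : q ∈ U := mU.2 (Or.inl rfl)
  have bU : b ∈ U := mU.2 (Or.inr ⟨hb, Lb⟩)
  have S₁S : S₁ ⊆ S := hunion ▸ Finset.subset_union_left
  have US : U ⊆ S := hunion ▸ Finset.subset_union_right
  have hpos : ∀ w ∈ S₁, w ≠ a → w ≠ q → 0 < L w := fun w hw h1 h2 =>
    lt_of_le_of_ne (mS₁.1 hw).2 fun h0 => (hz w (S₁S hw) h0.symm).elim h1 h2
  have hedge : HullEdge S₁ a q := ⟨aS₁, qS₁, hqa'.symm, L, hL, La, Lq, hpos⟩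
  have cS₁ : S₁.card < S.card := Finset.card_lt_card
    (Finset.ssubset_iff_subset_ne.2 ⟨S₁S, fun hh => by
      have : b ∈ S₁ := hh ▸ hb
      exact absurd (mS₁.1 this).2 (not_le.2 Lb)⟩)
  have aU : a ∉ U := fun hh => (mU.1 hh).elim hqa'.symm fun h => by
    rw [La] at h; exact lt_irrefl _ h.2
  have cU : U.card < S.card := Finset.card_lt_card
    (Finset.ssubset_iff_subset_ne.2 ⟨US, fun hh => aU (hh ▸ ha)⟩)
  have eU : colExc χ (χ q) U = 1 := by
    have h1 := colExc_filter_add_not (χ := χ) (c := χ a) S fun w => 0 ≤ L w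
    rw [← hS₁, hL0, hbal, zero_add, Finset.filter_congr fun w _ => not_le] at h1
    rw [hU, colExc_insert (by simp [Lq]), colExc_eq_zero_of_ne hqa.symm h1]
    simp
  obtain ⟨l₁, hl₁, b₁⟩ := (ih S₁ cS₁ (hS.mono S₁S)).1 a aS₁ q qS₁ hqa.symm hedge.ext_left
    hedge.ext_right hL0 (Or.inl hedge)
  obtain ⟨l₂, hl₂, b₂, b₂'⟩ := (ih U cU (hS.mono US)).2 q qU b bU hqb' hqb
    ⟨fun w => -L w, hL.neg, by simp [Lq], fun w hw hne => by
      simpa using ((mU.1 hw).resolve_left hne).2⟩ (hext.mono US) eU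
  obtain ⟨L', hsep⟩ : ∃ L', Separates S₁ U q L' := by
    refine exists_separates hL.neg (isAff_dotAt q a).neg (by simp [Lq]) (by simp [dotAt_self])
      qS₁ qU (fun w hw hne => ?_) (fun w hw hne => Or.inl ?_)
    · by_cases hwa : w = a
      · subst hwa
        exact Or.inr ⟨by simp [La], by simpa using dotAt_pos hqa'⟩
      · exact Or.inl (by simpa using hpos w hw hwa hne)
    · simpa using ((mU.1 hw).resolve_left hne).2
  have hS' : GenPos (S₁ ∪ U) := by rwa [hunion]
  obtain ⟨l, hl, hb⟩ := hsep.glue hl₁ hl₂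
  have hcard := hsep.card
  have main : (biEdges χ S).card + 2 ≤ (biEdges χ S₁).card + (biEdges χ U).card ∨
      (biEdges χ S).card ≤ (biEdges χ S₁).card + (biEdges χ U).card ∧
        crossSum (pathEdges l₂) + (biEdges χ U).card + 2 ≤ 2 * U.card := by
    by_cases hown : ∃ x, χ x = χ q ∧ HullEdge U q x
    · have := hsep.card_le hS' χ
      rw [hunion] at this
      exact Or.inr ⟨this, b₂' hown⟩
    · have := hsep.card_add_two_le_of_junction_edge hS'
        (fun x hx hc => hown ⟨x, hc, hx⟩) bU aS₁ hqa.symm hL La Lq hpos Lb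
      rw [hunion] at this
      exact Or.inl this
  rw [hunion] at hl hcard
  refine ⟨l, hl, ?_⟩
  rcases main with main | main <;> omega

/-- When `a` admits no split towards its hull neighbour `b`, the extreme tangent from `a` to the
remaining points touches them at a point of the colour of `b`. -/
theorem exists_tangent_of_no_split {χ : Pt → Bool} {S : Finset Pt} (hS : GenPos S) {a b : Pt}
    (hedge : HullEdge S a b) (hχ : χ a ≠ χ b) (hbal : colExc χ (χ a) S = 0)
    (hno : ∀ q, ¬ Split χ S a q b) (hne : ((S.erase a).erase b).Nonempty) :
    ∃ s ∈ (S.erase a).erase b, χ s = χ b ∧ ∃ L, IsAff L ∧ L a = 0 ∧ L s = 0 ∧ L b < 0 ∧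
      ∀ w ∈ (S.erase a).erase b, w ≠ s → 0 < L w := by
  have hext := hedge.ext_left
  obtain ⟨ha, hb, hab, H, hH, Ha, Hb, hpos⟩ := hedge
  set T := (S.erase a).erase b with hT
  have mT : ∀ {w}, w ∈ T ↔ w ≠ b ∧ w ≠ a ∧ w ∈ S := by simp [hT]
  have hposT : ∀ w ∈ T, 0 < H w := fun w hw =>
    hpos w (mT.1 hw).2.2 (mT.1 hw).2.1 (mT.1 hw).1
  obtain ⟨s, hs, hmin⟩ := exists_min_ratio hne (fun w => -dotAt a b w) H hposT
  obtain ⟨hsb, hsa, hsS⟩ := mT.1 hs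
  let L : Pt → ℝ := fun w => dotAt a b s * H w + -H s * dotAt a b w + 0
  have hL : IsAff L := hH.lin (isAff_dotAt a b) _ _ _
  have La : L a = 0 := by simp [L, Ha, dotAt_self]
  have Ls : L s = 0 := by simp only [L]; ring
  have Lb : L b < 0 := by
    have := mul_pos (hposT s hs) (dotAt_pos hab)
    simp only [L, Hb]
    linarith
  have Lpos : ∀ w ∈ T, w ≠ s → 0 < L w := by
    intro w hw hne
    obtain ⟨-, hwa, hwS⟩ := mT.1 hw
    have h1 := hS.aff_ne_zero hL ha hsS hwS hsa.symm hwa hne La Ls Lb.ne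
    refine lt_of_le_of_ne ?_ h1.symm
    have := hmin w hw
    simp only [L]
    linarith
  refine ⟨s, hs, ?_, L, hL, La, Ls, Lb, Lpos⟩
  by_contra hc
  have hsχ : χ s = χ a := bool_eq_of_ne hc hχ
  have hset : (S.filter fun w => 0 < L w) = T.erase s := by
    ext w
    rw [Finset.mem_filter, Finset.mem_erase]
    constructor
    · rintro ⟨hw, h0⟩
      refine ⟨fun hh => ?_, mT.2 ⟨fun hh => ?_, fun hh => ?_, hw⟩⟩
      · rw [hh, Ls] at h0; exact lt_irrefl _ h0
      · rw [hh] at h0; exact lt_asymm h0 Lb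
      · rw [hh, La] at h0; exact lt_irrefl _ h0
    · rintro ⟨h1, h2⟩
      exact ⟨(mT.1 h2).2.2, Lpos w h2 h1⟩
  obtain ⟨q, hq⟩ := exists_split_toward (χ := χ) hS ha hext hL La hb hab.symm Lb.le (by
    rw [hset, colExc_erase hs, hT, colExc_erase (Finset.mem_erase.2 ⟨hab.symm, hb⟩),
      colExc_erase ha, hbal]
    simp [hsχ, hχ.symm])
  exact hno q hq

theorem exists_path_of_hullEdge {χ : Pt → Bool} {S : Finset Pt} (hS : GenPos S)
    (ih : PathsBelow χ S.card) {a b : Pt} (hedge : HullEdge S a b) (hχ : χ a ≠ χ b)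
    (hbal : colExc χ (χ a) S = 0) (hno : ∀ q, ¬ Split χ S a q b)
    (hno' : ∀ q, ¬ Split χ S b q a) :
    ∃ l, IsAltPath χ S a b l ∧
      crossSum (pathEdges l) + (biEdges χ S).card + 1 ≤ 2 * S.card := by
  have ha := hedge.1
  have hb := hedge.2.1
  have hab := hedge.2.2.1
  set T := (S.erase a).erase b with hT
  have mT : ∀ {w}, w ∈ T ↔ w ≠ b ∧ w ≠ a ∧ w ∈ S := by simp [hT]
  have hb' : b ∈ S.erase a := Finset.mem_erase.2 ⟨hab.symm, hb⟩
  have hST : insert a (insert b T) = S := by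
    rw [hT, Finset.insert_erase hb', Finset.insert_erase ha]
  have hcard : S.card = T.card + 2 := by
    rw [← hST, Finset.card_insert_of_notMem, Finset.card_insert_of_notMem]
    · simp [hT]
    · simp [hT, hab]
  have hout : ∀ e ∈ biEdges χ S, e ∉ biEdges χ T → e = (a, b) ∨ e = (b, a) := by
    intro e he heT
    obtain ⟨hd, hc⟩ := mem_biEdges.1 he
    have h1 : ∀ x, HullEdge S a x → χ a ≠ χ x → x = b := fun x hx hc => by
      by_contra hxb
      exact hno x (hx.split hc.symm hb hab.symm (Ne.symm hxb))
    have h2 : ∀ x, HullEdge S b x → χ b ≠ χ x → x = a := fun x hx hc => by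
      by_contra hxa
      exact hno' x (hx.split hc.symm ha hab (Ne.symm hxa))
    by_cases ea : e.1 = a
    · exact Or.inl (Prod.ext ea (h1 e.2 (ea ▸ hd.hullEdge) (ea ▸ hc)))
    by_cases eb : e.1 = b
    · exact Or.inr (Prod.ext eb (h2 e.2 (eb ▸ hd.hullEdge) (eb ▸ hc)))
    by_cases ea' : e.2 = a
    · exact Or.inr (Prod.ext (h1 e.1 (ea' ▸ hd.hullEdge.symm) (ea' ▸ hc.symm)) ea')
    by_cases eb' : e.2 = b
    · exact Or.inl (Prod.ext (h2 e.1 (eb' ▸ hd.hullEdge.symm) (eb' ▸ hc.symm)) eb')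
    exact absurd (mem_biEdges.2 ⟨hd.mono (fun w hw => (mT.1 hw).2.2) (mT.2 ⟨eb, ea, hd.1⟩)
      (mT.2 ⟨eb', ea', hd.2.1⟩), hc⟩) heT
  rcases T.eq_empty_or_nonempty with hT0 | hne
  · have hSab : S = {a, b} := by rw [← hST, hT0]; simp
    obtain ⟨h1, h2⟩ := isAltPath_pair hχ
    refine ⟨[a, b], hSab ▸ h1, ?_⟩
    have h3 : biEdges χ S ⊆ {(a, b), (b, a)} := fun e he => by
      simpa using hout e he (by rw [hT0]; simp [biEdges])
    have h4 := (Finset.card_le_card h3).trans Finset.card_le_two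
    rw [hT0, Finset.card_empty] at hcard
    omega
  · obtain ⟨s, hs, hsχ, L, hL, La, Ls, Lb, Lpos⟩ :=
      exists_tangent_of_no_split hS hedge hχ hbal hno hne
    obtain ⟨p, hp, hpχ, M, hM, Mb, Mp, Ma, Mpos⟩ :=
      exists_tangent_of_no_split hS hedge.symm hχ.symm (colExc_eq_zero_of_ne hχ hbal) hno'
        (by rwa [Finset.erase_right_comm])
    rw [Finset.erase_right_comm, ← hT] at hp Mpos
    have hTS : T ⊆ S := fun w hw => (mT.1 hw).2.2
    obtain ⟨s', hs', t', ht', sχ, tχ, D, hD, Ds, Dt, hpos, α, β, γ, hα, hβ, hγ, hDeq⟩ :=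
      exists_visible_edge (hS.mono hTS) χ (o := a) hs hp (by rw [hsχ, hpχ]; exact hχ.symm)
        hL hM Ls Lpos Mp Mpos La.le Ma.le
    have hne' : χ s' ≠ χ t' := by rw [sχ, tχ, hsχ, hpχ]; exact hχ.symm
    have hedge' : HullEdge T s' t' := ⟨hs', ht', fun hh => hne' (hh ▸ rfl), D, hD, Ds, Dt, hpos⟩
    have hbal' : colExc χ (χ a) T = 0 := by
      rw [hT, colExc_erase hb', colExc_erase ha, hbal]
      simp [hχ.symm]
    obtain ⟨l, hl, hbd⟩ := (ih T (by omega) (hS.mono hTS)).1 s' hs' t' ht' hne' hedge'.ext_left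
      hedge'.ext_right (colExc_eq_zero_of_ne (by rw [sχ, hsχ]; exact hχ) hbal') (Or.inl hedge')
    obtain ⟨l', hl', hbd'⟩ := hl.wrap hD (a := a) (b := b)
      (by rw [hDeq, La]; nlinarith) (by rw [hDeq, Mb]; nlinarith) hab
      (by rw [sχ, hsχ]; exact hχ) (by rw [tχ, hpχ]; exact hχ) Ds Dt (fun w hw => by
        by_cases h1 : w = s'
        · rw [h1, Ds]
        by_cases h2 : w = t'
        · rw [h2, Dt]
        exact (hpos w hw h1 h2).le)
    rw [hST] at hl'
    refine ⟨l', hl', ?_⟩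
    obtain ⟨x, hx⟩ := hne
    obtain ⟨hxb, hxa, hxS⟩ := mT.1 hx
    have h1 : (biEdges χ S \ biEdges χ T).card ≤ 1 := by
      refine Finset.card_le_one.2 fun e he f hf => ?_
      obtain ⟨he, he'⟩ := Finset.mem_sdiff.1 he
      obtain ⟨hf, hf'⟩ := Finset.mem_sdiff.1 hf
      have key : ¬ (DirEdge S a b ∧ DirEdge S b a) := by
        rintro ⟨d1, d2⟩
        have p1 := d1.2.2.2 x hxS hxa hxb
        have p2 := d2.2.2.2 x hxS hxb hxa
        rw [det2_swap] at p2
        linarith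
      have de := (mem_biEdges.1 he).1
      have df := (mem_biEdges.1 hf).1
      rcases hout e he he' with rfl | rfl <;> rcases hout f hf hf' with rfl | rfl
      · rfl
      · exact absurd ⟨de, df⟩ key
      · exact absurd ⟨df, de⟩ key
      · rfl
    have h2 := Finset.le_card_sdiff (biEdges χ T) (biEdges χ S)
    obtain ⟨k, hk⟩ := even_card_biEdges hS χ
    obtain ⟨k', hk'⟩ := even_card_biEdges (hS.mono hTS) χ
    omega

theorem balancedPaths_of_below {χ : Pt → Bool} {S : Finset Pt} (hS : GenPos S)
    (ih : PathsBelow χ S.card) : BalancedPaths χ S := by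
  intro a ha b hb hχ hexta hextb hbal hgood
  by_cases h1 : ∃ q, Split χ S a q b
  · obtain ⟨q, hq⟩ := h1
    exact exists_path_of_split hS ih ha hb hχ hextb hbal hq
  by_cases h2 : ∃ q, Split χ S b q a
  · obtain ⟨q, hq⟩ := h2
    obtain ⟨l, hl, hbd⟩ := exists_path_of_split hS ih hb ha hχ.symm hexta
      (colExc_eq_zero_of_ne hχ hbal) hq
    exact ⟨_, hl.reverse.1, by rw [hl.reverse.2]; exact hbd⟩
  push Not at h1 h2
  rcases hgood with h | ⟨q, hq⟩ | ⟨q, hq⟩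
  · exact exists_path_of_hullEdge hS ih h hχ hbal h1 h2
  · exact absurd hq (h1 q)
  · exact absurd hq (h2 q)

/-! ### Paths between endpoints of the surplus colour -/

theorem card_biEdges_le_erase (χ : Pt → Bool) (U : Finset Pt) (q : Pt) :
    (biEdges χ U).card ≤ (biEdges χ (U.erase q)).card + 2 ∧
      ((∃ x, χ x = χ q ∧ HullEdge U q x) →
        (biEdges χ U).card ≤ (biEdges χ (U.erase q)).card + 1) := by
  set A := (biEdges χ U).filter fun e => e.1 = q with hA
  set B := (biEdges χ U).filter fun e => e.2 = q with hB
  have mA : ∀ {e}, e ∈ A ↔ e ∈ biEdges χ U ∧ e.1 = q := Finset.mem_filter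
  have mB : ∀ {e}, e ∈ B ↔ e ∈ biEdges χ U ∧ e.2 = q := Finset.mem_filter
  have hsub : biEdges χ U ⊆ biEdges χ (U.erase q) ∪ (A ∪ B) := by
    intro e he
    by_cases h1 : e.1 = q
    · exact Finset.mem_union_right _ (Finset.mem_union_left _ (mA.2 ⟨he, h1⟩))
    by_cases h2 : e.2 = q
    · exact Finset.mem_union_right _ (Finset.mem_union_right _ (mB.2 ⟨he, h2⟩))
    obtain ⟨hd, hc⟩ := mem_biEdges.1 he
    exact Finset.mem_union_left _ (mem_biEdges.2 ⟨hd.mono (Finset.erase_subset _ _)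
      (Finset.mem_erase.2 ⟨h1, hd.1⟩) (Finset.mem_erase.2 ⟨h2, hd.2.1⟩), hc⟩)
  have cA : A.card ≤ 1 := Finset.card_le_one.2 fun e he f hf => by
    obtain ⟨he, he'⟩ := mA.1 he
    obtain ⟨hf, hf'⟩ := mA.1 hf
    have h1 := (mem_biEdges.1 he).1
    have h2 := (mem_biEdges.1 hf).1
    rw [he'] at h1
    rw [hf'] at h2
    exact Prod.ext (he'.trans hf'.symm) (h1.right_unique h2)
  have cB : B.card ≤ 1 := Finset.card_le_one.2 fun e he f hf => by
    obtain ⟨he, he'⟩ := mB.1 he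
    obtain ⟨hf, hf'⟩ := mB.1 hf
    have h1 := (mem_biEdges.1 he).1
    have h2 := (mem_biEdges.1 hf).1
    rw [he'] at h1
    rw [hf'] at h2
    exact Prod.ext (h1.left_unique h2) (he'.trans hf'.symm)
  have h1 := Finset.card_le_card hsub
  have h2 := Finset.card_union_le (biEdges χ (U.erase q)) (A ∪ B)
  have h3 := Finset.card_union_le A B
  refine ⟨by omega, ?_⟩
  rintro ⟨x, hx, hedge⟩
  rcases hedge.dirEdge with hd | hd
  · have : A.card = 0 := Finset.card_eq_zero.2 <| Finset.eq_empty_of_forall_notMem fun e he => by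
      obtain ⟨he, he'⟩ := mA.1 he
      obtain ⟨h1, h2⟩ := mem_biEdges.1 he
      rw [he'] at h1 h2
      rw [h1.right_unique hd, hx] at h2
      exact h2 rfl
    omega
  · have : B.card = 0 := Finset.card_eq_zero.2 <| Finset.eq_empty_of_forall_notMem fun e he => by
      obtain ⟨he, he'⟩ := mB.1 he
      obtain ⟨h1, h2⟩ := mem_biEdges.1 he
      rw [he'] at h1 h2
      rw [h1.left_unique hd, hx] at h2
      exact h2 rfl
    omega

/-- A path starting at `q` obtained by prepending `q` to a path of the other points. -/
theorem exists_path_cons {χ : Pt → Bool} {U : Finset Pt} (hU : GenPos U)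
    (ih : PathsBelow χ U.card) {q b z z' : Pt} (hq : q ∈ U) (hb : b ∈ U) (hqb : q ≠ b)
    (hχ : χ q = χ b) (hextb : Extr U b) (hex : colExc χ (χ q) U = 1) {D : Pt → ℝ}
    (hD : IsAff D) (hz : z ∈ U.erase q) (hz' : z' ∈ U.erase q) (hzz : z ≠ z')
    (Dz : D z = 0) (Dz' : D z' = 0) (Dq : D q < 0)
    (hpos : ∀ w ∈ U.erase q, w ≠ z → w ≠ z' → 0 < D w) (hzq : χ z ≠ χ q)
    (hgood : Good χ (U.erase q) z b) :
    ∃ l, IsAltPath χ U q b l ∧ crossSum (pathEdges l) + (biEdges χ U).card ≤ 2 * U.card ∧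
      ((∃ x, χ x = χ q ∧ HullEdge U q x) →
        crossSum (pathEdges l) + (biEdges χ U).card + 2 ≤ 2 * U.card) := by
  have hcard := Finset.card_erase_add_one hq
  have hedge : HullEdge (U.erase q) z z' := ⟨hz, hz', hzz, D, hD, Dz, Dz', hpos⟩
  have hb' : b ∈ U.erase q := Finset.mem_erase.2 ⟨hqb.symm, hb⟩
  have hbal : colExc χ (χ q) (U.erase q) = 0 := by rw [colExc_erase hq, hex]; simp
  have hG := hU.mono (Finset.erase_subset q U)
  obtain ⟨l₂, hl₂, b₂⟩ := (ih _ (by omega) hG).1 z hz b hb' (hχ ▸ hzq) hedge.ext_left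
    (hextb.mono (Finset.erase_subset _ _)) (colExc_eq_zero_of_ne hzq.symm hbal) hgood
  obtain ⟨h1, h1'⟩ := isAltPath_pair hzq.symm
  have hzU := (Finset.mem_erase.1 hz)
  obtain ⟨L', hsep⟩ : ∃ L', Separates {q, z} (U.erase q) z L' := by
    refine exists_separates hD (isAff_dotAt z z') Dz (dotAt_self _ _) (by simp) hz
      (fun w hw hne => Or.inl ?_) (fun w hw hne => ?_)
    · have : w = q := by simpa [hne] using hw
      rwa [this]
    · by_cases hwz : w = z'
      · subst hwz
        exact Or.inr ⟨Dz', dotAt_pos hzz⟩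
      · exact Or.inl (hpos w hw hne hwz)
  have hunion : ({q, z} : Finset Pt) ∪ U.erase q = U := by
    ext w
    simp only [Finset.mem_union, Finset.mem_insert, Finset.mem_singleton, Finset.mem_erase]
    constructor
    · rintro ((rfl | rfl) | h)
      exacts [hq, hzU.2, h.2]
    · intro hw
      by_cases hwq : w = q
      exacts [Or.inl (Or.inl hwq), Or.inr ⟨hwq, hw⟩]
  obtain ⟨l, hl, hs⟩ := hsep.glue h1 hl₂
  rw [hunion] at hl
  obtain ⟨c1, c2⟩ := card_biEdges_le_erase χ U q
  obtain ⟨k, hk⟩ := even_card_biEdges hU χ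
  obtain ⟨k', hk'⟩ := even_card_biEdges hG χ
  refine ⟨l, hl, by omega, fun hx => ?_⟩
  have := c2 hx
  omega

theorem exists_path_of_opposite_neighbor {χ : Pt → Bool} {U : Finset Pt} (hU : GenPos U)
    (ih : PathsBelow χ U.card) {q b x : Pt} (hb : b ∈ U) (hqb : q ≠ b)
    (hχ : χ q = χ b) (hextb : Extr U b) (hex : colExc χ (χ q) U = 1)
    (hedge : HullEdge U q x) (hx : χ x ≠ χ q) :
    ∃ l, IsAltPath χ U q b l ∧ crossSum (pathEdges l) + (biEdges χ U).card ≤ 2 * U.card ∧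
      ((∃ x, χ x = χ q ∧ HullEdge U q x) →
        crossSum (pathEdges l) + (biEdges χ U).card + 2 ≤ 2 * U.card) := by
  obtain ⟨hq, hxU, hqx, F, hF, Fq, Fx, hpos⟩ := hedge
  have hxb : x ≠ b := fun h => hx (h ▸ hχ.symm)
  have mT : ∀ {w}, w ∈ (U.erase q).erase x ↔ w ≠ x ∧ w ≠ q ∧ w ∈ U := by simp
  have hposT : ∀ w ∈ (U.erase q).erase x, 0 < F w := fun w hw =>
    hpos w (mT.1 hw).2.2 (mT.1 hw).2.1 (mT.1 hw).1
  obtain ⟨x', hx', hmin⟩ := exists_min_ratio ⟨b, mT.2 ⟨hxb.symm, hqb.symm, hb⟩⟩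
    (fun w => -dotAt x q w) F hposT
  obtain ⟨hxx, hxq, hxU'⟩ := mT.1 hx'
  let D : Pt → ℝ := fun w => dotAt x q x' * F w + -F x' * dotAt x q w + 0
  have hD : IsAff D := hF.lin (isAff_dotAt x q) _ _ _
  have Dx : D x = 0 := by simp [D, Fx, dotAt_self]
  have Dx' : D x' = 0 := by simp only [D]; ring
  have Dq : D q < 0 := by
    have := mul_pos (hposT x' hx') (dotAt_pos hqx.symm)
    simp only [D, Fq]
    linarith
  have Dpos : ∀ w ∈ U.erase q, w ≠ x → w ≠ x' → 0 < D w := by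
    intro w hw h1 h2
    have hw' := Finset.mem_erase.1 hw
    have h3 := hU.aff_ne_zero hD hxU hxU' hw'.2 hxx.symm h1 h2 Dx Dx' Dq.ne
    refine lt_of_le_of_ne ?_ h3.symm
    have := hmin w (mT.2 ⟨h1, hw'⟩)
    simp only [D]
    linarith
  have mx : x ∈ U.erase q := Finset.mem_erase.2 ⟨hqx.symm, hxU⟩
  have mx' : x' ∈ U.erase q := Finset.mem_erase.2 ⟨hxq, hxU'⟩
  have mb : b ∈ U.erase q := Finset.mem_erase.2 ⟨hqb.symm, hb⟩
  by_cases hgood : Good χ (U.erase q) x b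
  · exact exists_path_cons hU ih hq hb hqb hχ hextb hex hD mx mx' hxx.symm Dx Dx' Dq Dpos hx hgood
  have hedge : HullEdge (U.erase q) x x' := ⟨mx, mx', hxx.symm, D, hD, Dx, Dx', Dpos⟩
  have hb' : b ≠ x' := by
    rintro rfl
    exact hgood (Or.inl hedge)
  have hc : χ x' = χ x := by
    by_contra hc
    exact hgood (Or.inr (Or.inl ⟨x', hedge.split hc mb hxb.symm hb'⟩))
  have hbal : colExc χ (χ q) (U.erase q) = 0 := by rw [colExc_erase hq, hex]; simp
  have hgood' : Good χ (U.erase q) x' b :=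
    Good.of_not_good (hU.mono (Finset.erase_subset _ _)) mx mb hedge.ext_left
      (hχ ▸ hx) (colExc_eq_zero_of_ne hx.symm hbal) hgood mx' hxx hc
  exact exists_path_cons hU ih hq hb hqb hχ hextb hex hD mx' mx hxx Dx' Dx Dq
    (fun w hw h1 h2 => Dpos w hw h2 h1) (hc ▸ hx) hgood'

/-- A common inner tangent of two finite sets separated by the zero line of `L`, chosen among the
two by the condition on the direction in which `D` increases. -/
theorem exists_inner_tangent {T₁ T₂ : Finset Pt} {L D : Pt → ℝ} (hL : IsAff L) (hD : IsAff D)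
    (h1 : T₁.Nonempty) (h2 : T₂.Nonempty) (L1 : ∀ w ∈ T₁, 0 ≤ L w) (L2 : ∀ w ∈ T₂, L w < 0) :
    ∃ y ∈ T₁, ∃ z ∈ T₂, ∃ M, IsAff M ∧ M y = 0 ∧ M z = 0 ∧ (∀ w ∈ T₁, 0 ≤ M w) ∧
      (∀ w ∈ T₂, M w ≤ 0) ∧ ∀ u v, L u = 0 → L v = 0 → M u + D u = M v + D v := by
  obtain ⟨⟨y, z⟩, hyz, hmin⟩ := (T₁ ×ˢ T₂).exists_min_image
    (fun e => (D e.2 - D e.1) / (L e.1 - L e.2)) (h1.product h2)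
  obtain ⟨hy, hz⟩ := Finset.mem_product.1 hyz
  simp only at hy hz hmin
  have pos : ∀ u ∈ T₁, ∀ v ∈ T₂, 0 < L u - L v := fun u hu v hv => by
    have := L1 u hu
    have := L2 v hv
    linarith
  set m := (D z - D y) / (L y - L z) with hm
  have hmz : m * (L y - L z) = D z - D y := div_mul_cancel₀ _ (pos y hy z hz).ne'
  have key : ∀ u ∈ T₁, ∀ v ∈ T₂, m * (L u - L v) ≤ D v - D u := fun u hu v hv =>
    (le_div_iff₀ (pos u hu v hv)).1 (hmin (u, v) (Finset.mem_product.2 ⟨hu, hv⟩))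
  refine ⟨y, hy, z, hz, fun w => -m * L w + -1 * D w + (m * L y + D y), hL.lin hD _ _ _,
    by ring, by linarith, fun w hw => ?_, fun w hw => ?_, fun u v hu hv => ?_⟩
  · have := key w hw z hz
    linarith
  · have := key y hy w hw
    linarith
  · simp only [hu, hv]
    ring

/-- A set cut by a line through the extreme point `q` and a further point `g` into a balanced part
`T₁` and a part `T₂` containing `b`, where both lines of tangency from `q` end in points of the
colour of `q`, together with an inner tangent of the two parts. -/
structure TangentCut (χ : Pt → Bool) (U T₁ T₂ : Finset Pt) (q b g y z : Pt)
    (L M F : Pt → ℝ) : Prop where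
  union : T₁ ∪ T₂ = U
  q_mem : q ∈ T₁
  g_mem : g ∈ T₁
  b_mem : b ∈ T₂
  y_mem : y ∈ T₁
  z_mem : z ∈ T₂
  affL : IsAff L
  affM : IsAff M
  affF : IsAff F
  Lq : L q = 0
  Lg : L g = 0
  Lpos : ∀ w ∈ T₁, w ≠ q → w ≠ g → 0 < L w
  Lneg : ∀ w ∈ T₂, L w < 0
  My : M y = 0
  Mz : M z = 0
  Mpos : ∀ w ∈ T₁, w ≠ y → 0 < M w
  Mneg : ∀ w ∈ T₂, w ≠ z → M w < 0
  Mlt : M g < M q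
  Fq : F q = 0
  Fpos : ∀ w ∈ U, w ≠ q → 0 < F w
  yq : y ≠ q
  gχ : χ g ≠ χ q
  bχ : χ b = χ q
  bal : colExc χ (χ q) T₁ = 0
  surplus : colExc χ (χ q) T₂ = 1
  left : ∃ x ∈ T₁, χ x = χ q ∧ HullEdge U q x
  right : ∃ x ∈ T₂, χ x = χ q ∧ HullEdge U q x

theorem exists_tangentCut {χ : Pt → Bool} {U : Finset Pt} (hU : GenPos U) {q b : Pt}
    (hq : q ∈ U) (hb : b ∈ U) (hqb : q ≠ b) (hχ : χ q = χ b) (hext : Extr U q)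
    (hex : colExc χ (χ q) U = 1) (hown : ∀ x, HullEdge U q x → χ x = χ q) :
    ∃ T₁ T₂ g y z L M F, TangentCut χ U T₁ T₂ q b g y z L M F := by
  have hdet : ∀ w ∈ U, det2 q b w = 0 → w = q ∨ w = b := fun w hw h0 => by
    by_contra! hne
    exact hU q hq b hb w hw hqb hne.1.symm hne.2.symm h0
  obtain ⟨Λ, hΛ, Λq, Λb, hΛ1⟩ : ∃ Λ, IsAff Λ ∧ Λ q = 0 ∧ Λ b = 0 ∧
      1 + colExc χ (χ q) (U.filter fun w => 0 < Λ w) ≤ 0 := by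
    have h1 := (colExc_eq_sides (χ := χ) (χ q) hq hb hqb (det2_left q b) (det2_right q b) hdet).1
    have h2 : colExc χ (χ q) {q, b} = 2 := by
      rw [colExc_insert (by simpa using hqb)]
      simp [colExc, hχ]
    rw [hex, h2] at h1
    rcases le_or_gt (1 + colExc χ (χ q) (U.filter fun w => 0 < det2 q b w)) 0 with h | h
    · exact ⟨_, isAff_det2 q b, det2_left q b, det2_right q b, h⟩
    · refine ⟨_, (isAff_det2 q b).neg, by simp [det2_left], by simp [det2_right], ?_⟩
      simp only [Left.neg_pos_iff]
      omega
  obtain ⟨g, hg, gχ, Λg, L, hL, Lq, Lg, bal, hneg, hz⟩ :=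
    exists_split_of_excess hU hq hext hΛ Λq hb hqb.symm Λb.le hΛ1
  have Lb : L b < 0 := hneg b hb hqb.symm Λb.le
  obtain ⟨F, hF, Fq, Fpos⟩ := hext
  have hgq : g ≠ q := fun h => gχ (h ▸ rfl)
  set T₁ := U.filter fun w => 0 ≤ L w with hT₁
  set T₂ := U.filter fun w => L w < 0 with hT₂
  have m1 : ∀ {w}, w ∈ T₁ ↔ w ∈ U ∧ 0 ≤ L w := Finset.mem_filter
  have m2 : ∀ {w}, w ∈ T₂ ↔ w ∈ U ∧ L w < 0 := Finset.mem_filter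
  have union : T₁ ∪ T₂ = U := by
    ext w
    rw [Finset.mem_union, m1, m2, ← and_or_left]
    exact and_iff_left (le_or_gt 0 (L w))
  have hq1 : q ∈ T₁ := m1.2 ⟨hq, Lq.ge⟩
  have hg1 : g ∈ T₁ := m1.2 ⟨hg, Lg.ge⟩
  have hb2 : b ∈ T₂ := m2.2 ⟨hb, Lb⟩
  have surplus : colExc χ (χ q) T₂ = 1 := by
    have h1 := colExc_filter_add_not (χ := χ) (c := χ q) U fun w => 0 ≤ L w
    rwa [← hT₁, bal, hex, zero_add, Finset.filter_congr fun w _ => not_le] at h1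
  have n2 : ∀ w ∈ T₂, w ≠ q := fun w hw h => by
    have := (m2.1 hw).2
    rw [h, Lq] at this
    exact lt_irrefl _ this
  have left : ∃ x ∈ T₁, χ x = χ q ∧ HullEdge U q x := by
    obtain ⟨x, hx, hmin⟩ := exists_min_ratio (T := T₁.erase q) ⟨g, Finset.mem_erase.2 ⟨hgq, hg1⟩⟩
      (fun w => -L w) F fun w hw => Fpos w (m1.1 (Finset.mem_of_mem_erase hw)).1
        (Finset.ne_of_mem_erase hw)
    obtain ⟨hxq, hx1⟩ := Finset.mem_erase.1 hx
    have Fx := Fpos x (m1.1 hx1).1 hxq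
    have Lx := (m1.1 hx1).2
    have hlt : ∀ w ∈ T₂, -L x * F w < -L w * F x := fun w hw => by
      have h1 := mul_pos (neg_pos.2 (m2.1 hw).2) Fx
      have h2 := mul_nonneg Lx (Fpos w (m2.1 hw).1 (n2 w hw)).le
      linarith
    have hedge : HullEdge U q x := hullEdge_of_min_ratio hU hF hL.neg Fq (by simp [Lq]) hq
      (m1.1 hx1).1 hxq (fun w hw hne => by
        rw [← union, Finset.mem_union] at hw
        rcases hw with hw | hw
        · exact hmin w (Finset.mem_erase.2 ⟨hne, hw⟩)
        · exact (hlt w hw).le) (hlt b hb2).ne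
    exact ⟨x, hx1, hown x hedge, hedge⟩
  have right : ∃ x ∈ T₂, χ x = χ q ∧ HullEdge U q x := by
    obtain ⟨x, hx, hmin⟩ := exists_min_ratio (T := T₂) ⟨b, hb2⟩
      L F fun w hw => Fpos w (m2.1 hw).1 (n2 w hw)
    have Fx := Fpos x (m2.1 hx).1 (n2 x hx)
    have Lx := (m2.1 hx).2
    have hlt : ∀ w ∈ T₁, w ≠ q → L x * F w < L w * F x := fun w hw hne => by
      have h1 := mul_pos (neg_pos.2 Lx) (Fpos w (m1.1 hw).1 hne)
      have h2 := mul_nonneg (m1.1 hw).2 Fx.le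
      linarith
    have hedge : HullEdge U q x := hullEdge_of_min_ratio hU hF hL Fq Lq hq
      (m2.1 hx).1 (n2 x hx) (fun w hw hne => by
        rw [← union, Finset.mem_union] at hw
        rcases hw with hw | hw
        · exact (hlt w hw hne).le
        · exact hmin w hw) (hlt g hg1 hgq).ne
    exact ⟨x, hx, hown x hedge, hedge⟩
  obtain ⟨y, hy, z, hz', M, hM, My, Mz, M1, M2, hMF⟩ := exists_inner_tangent hL hF ⟨q, hq1⟩ ⟨b, hb2⟩
    (fun w hw => (m1.1 hw).2) fun w hw => (m2.1 hw).2
  have Mlt : M g < M q := by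
    have := hMF q g Lq Lg
    have := Fpos g hg hgq
    linarith
  have Mq : 0 < M q := (M1 g hg1).trans_lt Mlt
  have hyz : y ≠ z := fun h => by
    have h1 := (m1.1 hy).2
    rw [h] at h1
    exact absurd h1 (not_le.2 (m2.1 hz').2)
  have hM0 : ∀ w ∈ U, w ≠ y → w ≠ z → M w ≠ 0 := fun w hw h1 h2 =>
    hU.aff_ne_zero hM (m1.1 hy).1 (m2.1 hz').1 hw hyz h1 h2 My Mz Mq.ne'
  refine ⟨T₁, T₂, g, y, z, L, M, F, union, hq1, hg1, hb2, hy, hz', hL, hM, hF, Lq, Lg, ?_,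
    fun w hw => (m2.1 hw).2, My, Mz, ?_, ?_, Mlt, Fq, Fpos, ?_, gχ, hχ.symm, bal, surplus,
    left, right⟩
  · exact fun w hw h1 h2 => lt_of_le_of_ne (m1.1 hw).2 fun h0 =>
      (hz w (m1.1 hw).1 h0.symm).elim h1 h2
  · refine fun w hw h1 => lt_of_le_of_ne (M1 w hw) (hM0 w (m1.1 hw).1 h1 ?_).symm
    rintro rfl
    exact absurd (m1.1 hw).2 (not_le.2 (m2.1 hz').2)
  · refine fun w hw h1 => lt_of_le_of_ne (M2 w hw) (hM0 w (m2.1 hw).1 ?_ h1)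
    rintro rfl
    exact absurd (m1.1 hy).2 (not_le.2 (m2.1 hw).2)
  · rintro rfl
    exact Mq.ne' My

namespace TangentCut

variable {χ : Pt → Bool} {U T₁ T₂ : Finset Pt} {q b g y z : Pt} {L M F : Pt → ℝ}

theorem left_sub (h : TangentCut χ U T₁ T₂ q b g y z L M F) {w : Pt} (hw : w ∈ T₁) : w ∈ U :=
  h.union ▸ Finset.mem_union_left _ hw

theorem right_sub (h : TangentCut χ U T₁ T₂ q b g y z L M F) {w : Pt} (hw : w ∈ T₂) : w ∈ U :=
  h.union ▸ Finset.mem_union_right _ hw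

theorem nonneg (h : TangentCut χ U T₁ T₂ q b g y z L M F) {w : Pt} (hw : w ∈ T₁) : 0 ≤ L w := by
  by_cases h1 : w = q
  · rw [h1, h.Lq]
  by_cases h2 : w = g
  · rw [h2, h.Lg]
  exact (h.Lpos w hw h1 h2).le

theorem not_mem_both (h : TangentCut χ U T₁ T₂ q b g y z L M F) {w : Pt} (h1 : w ∈ T₁)
    (h2 : w ∈ T₂) : False :=
  absurd (h.nonneg h1) (not_le.2 (h.Lneg w h2))

theorem ne_of_mem (h : TangentCut χ U T₁ T₂ q b g y z L M F) {v w : Pt} (h1 : v ∈ T₁)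
    (h2 : w ∈ T₂) : v ≠ w := fun hh => h.not_mem_both h1 (hh ▸ h2)

/-- Gluing along the inner tangent when its end on the side of `q` has the other colour. -/
theorem exists_path_of_ne (h : TangentCut χ U T₁ T₂ q b g y z L M F) (hU : GenPos U)
    (ih : PathsBelow χ U.card) (hextq : Extr U q) (hextb : Extr U b) (hy : χ y ≠ χ q) :
    ∃ l, IsAltPath χ U q b l ∧
      crossSum (pathEdges l) + (biEdges χ U).card + 2 ≤ 2 * U.card := by
  have hyT₂ : y ∉ T₂ := fun hh => h.not_mem_both h.y_mem hh
  have hyz : y ≠ z := h.ne_of_mem h.y_mem h.z_mem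
  set U₂ := insert y T₂ with hU₂
  have m2 : ∀ {w}, w ∈ U₂ ↔ w = y ∨ w ∈ T₂ := Finset.mem_insert
  have U₂U : U₂ ⊆ U := fun w hw => (m2.1 hw).elim (fun hh => hh ▸ h.left_sub h.y_mem) h.right_sub
  have T₁U : T₁ ⊆ U := fun w hw => h.left_sub hw
  have hqU₂ : q ∉ U₂ := fun hh => (m2.1 hh).elim h.yq.symm (h.not_mem_both h.q_mem)
  have cU₂ : U₂.card < U.card := Finset.card_lt_card (Finset.ssubset_iff_subset_ne.2
    ⟨U₂U, fun hh => hqU₂ (hh ▸ h.left_sub h.q_mem)⟩)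
  have bU₂ : b ∈ U₂ := m2.2 (Or.inr h.b_mem)
  have yU₂ : y ∈ U₂ := m2.2 (Or.inl rfl)
  have zU₂ : z ∈ U₂ := m2.2 (Or.inr h.z_mem)
  have hyb : χ y ≠ χ b := by rwa [h.bχ]
  have eU₂ : colExc χ (χ y) U₂ = 0 := by
    refine colExc_eq_zero_of_ne hy.symm ?_
    rw [hU₂, colExc_insert hyT₂, h.surplus]
    simp [hy]
  obtain ⟨x, hx, hxχ, hqx⟩ := h.right
  have hedge : HullEdge U₂ y z := ⟨yU₂, zU₂, hyz, _, h.affM.neg, by simp [h.My], by simp [h.Mz],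
    fun w hw h1 h2 => by simpa using h.Mneg w ((m2.1 hw).resolve_left h1) h2⟩
  by_cases hgood : Good χ U₂ y b
  · have cT₁ : T₁.card < U.card := Finset.card_lt_card (Finset.ssubset_iff_subset_ne.2
      ⟨T₁U, fun hh => h.not_mem_both (hh ▸ h.right_sub h.b_mem) h.b_mem⟩)
    have hgood₁ : Good χ T₁ q y := by
      by_cases hyg : y = g
      · subst hyg
        exact Or.inl ⟨h.q_mem, h.y_mem, h.yq.symm, L, h.affL, h.Lq, h.Lg, h.Lpos⟩
      · refine Or.inr (Or.inl ⟨g, h.g_mem, h.gχ, _, h.affL.neg, by simp [h.Lq], by simp [h.Lg],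
          by simpa using h.Lpos y h.y_mem h.yq hyg, fun w hw h0 => ?_, ?_⟩)
        · by_contra! hne
          have := h.Lpos w hw hne.1 hne.2
          linarith
        · have : (T₁.filter fun w => 0 ≤ -L w) = {q, g} := by
            ext w
            simp only [Finset.mem_filter, Finset.mem_insert, Finset.mem_singleton]
            constructor
            · rintro ⟨hw, h0⟩
              by_contra! hne
              have := h.Lpos w hw hne.1 hne.2
              linarith
            · rintro (rfl | rfl)
              · exact ⟨h.q_mem, by simp [h.Lq]⟩
              · exact ⟨h.g_mem, by simp [h.Lg]⟩
          rw [this, colExc_pair h.gχ.symm]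
    obtain ⟨l₁, hl₁, b₁⟩ := (ih T₁ cT₁ (hU.mono T₁U)).1 q h.q_mem y h.y_mem hy.symm
      (hextq.mono T₁U) ⟨M, h.affM, h.My, h.Mpos⟩ h.bal hgood₁
    obtain ⟨l₂, hl₂, b₂⟩ := (ih U₂ cU₂ (hU.mono U₂U)).1 y yU₂ b bU₂ hyb hedge.ext_left
      (hextb.mono U₂U) eU₂ hgood
    have hunion : T₁ ∪ U₂ = U := by
      rw [hU₂, Finset.union_insert, h.union, Finset.insert_eq_of_mem (h.left_sub h.y_mem)]
    obtain ⟨L', hsep⟩ : ∃ L', Separates T₁ U₂ y L' := by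
      refine exists_separates h.affM.neg (isAff_dotAt y z) (by simp [h.My]) (dotAt_self _ _)
        h.y_mem yU₂ (fun w hw hne => Or.inl (by simpa using h.Mpos w hw hne)) fun w hw hne => ?_
      by_cases hwz : w = z
      · subst hwz
        exact Or.inr ⟨by simp [h.Mz], dotAt_pos hyz⟩
      · exact Or.inl (by simpa using h.Mneg w ((m2.1 hw).resolve_left hne) hwz)
    obtain ⟨l, hl, hs⟩ := hsep.glue hl₁ hl₂
    have hcard := hsep.card
    have hc := hsep.card_add_two_le_of_mono (χ := χ) (e := (q, x)) (by rwa [hunion])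
      (mem_crossPairs.2 ⟨⟨h.yq.symm, h.q_mem⟩, ⟨(h.ne_of_mem h.y_mem hx).symm, m2.2 (Or.inr hx)⟩,
        by rwa [hunion]⟩) hy.symm (by simpa [hxχ] using hy.symm)
    rw [hunion] at hl hcard hc
    exact ⟨l, hl, by omega⟩
  · have hzb : b ≠ z := by
      rintro rfl
      exact hgood (Or.inl hedge)
    have hzχ : χ z = χ y := by
      by_contra hc
      exact hgood (Or.inr (Or.inl ⟨z, hedge.split hc bU₂ (h.ne_of_mem h.y_mem h.b_mem).symm hzb⟩))
    have hzq : χ z ≠ χ q := hzχ ▸ hy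
    have hgood₂ : Good χ U₂ z b := Good.of_not_good (hU.mono U₂U) yU₂ bU₂ hedge.ext_left hyb eU₂
      hgood zU₂ hyz.symm hzχ
    set U₁ := insert z (T₁.erase y) with hU₁
    have m1 : ∀ {w}, w ∈ U₁ ↔ w = z ∨ w ≠ y ∧ w ∈ T₁ := by simp [hU₁]
    have U₁U : U₁ ⊆ U := fun w hw =>
      (m1.1 hw).elim (fun hh => hh ▸ h.right_sub h.z_mem) fun hh => h.left_sub hh.2
    have cU₁ : U₁.card < U.card := Finset.card_lt_card (Finset.ssubset_iff_subset_ne.2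
      ⟨U₁U, fun hh => by
        have := m1.1 (hh ▸ h.left_sub h.y_mem : y ∈ U₁)
        exact this.elim hyz fun hh => hh.1 rfl⟩)
    have zU₁ : z ∈ U₁ := m1.2 (Or.inl rfl)
    have qU₁ : q ∈ U₁ := m1.2 (Or.inr ⟨h.yq.symm, h.q_mem⟩)
    have hzT : z ∉ T₁ := fun hh => h.not_mem_both hh h.z_mem
    have eU₁ : colExc χ (χ q) U₁ = 0 := by
      rw [hU₁, colExc_insert (fun hh => hzT (Finset.mem_of_mem_erase hh)), colExc_erase h.y_mem,
        h.bal]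
      simp [hy, hzq]
    have hedge₁ : HullEdge U₁ q z := by
      refine ⟨qU₁, zU₁, h.ne_of_mem h.q_mem h.z_mem, fun w => F z * L w + -L z * F w + 0,
        h.affL.lin h.affF _ _ _, by simp [h.Lq, h.Fq], by ring, fun w hw hwq hwz => ?_⟩
      have hw₁ := ((m1.1 hw).resolve_left hwz).2
      have h1 := h.Fpos z (h.right_sub h.z_mem) (h.ne_of_mem h.q_mem h.z_mem).symm
      have h2 := mul_nonneg h1.le (h.nonneg hw₁)
      have h3 := mul_pos (neg_pos.2 (h.Lneg z h.z_mem)) (h.Fpos w (h.left_sub hw₁) hwq)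
      linarith
    obtain ⟨l₁, hl₁, b₁⟩ := (ih U₁ cU₁ (hU.mono U₁U)).1 q qU₁ z zU₁ hzq.symm
      hedge₁.ext_left hedge₁.ext_right eU₁ (Or.inl hedge₁)
    obtain ⟨l₂, hl₂, b₂⟩ := (ih U₂ cU₂ (hU.mono U₂U)).1 z zU₂ b bU₂ (hzχ ▸ hyb) hedge.ext_right
      (hextb.mono U₂U) (hzχ ▸ eU₂) hgood₂
    have hunion : U₁ ∪ U₂ = U := by
      refine subset_antisymm (Finset.union_subset U₁U U₂U) fun w hw => ?_
      rw [← h.union, Finset.mem_union] at hw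
      rw [Finset.mem_union, m1, m2]
      by_cases hwy : w = y
      · exact Or.inr (Or.inl hwy)
      · exact hw.elim (fun hh => Or.inl (Or.inr ⟨hwy, hh⟩)) fun hh => Or.inr (Or.inr hh)
    obtain ⟨L', hsep⟩ : ∃ L', Separates U₁ U₂ z L' := by
      refine exists_separates h.affM.neg (isAff_dotAt z y) (by simp [h.Mz]) (dotAt_self _ _)
        zU₁ zU₂ (fun w hw hne => Or.inl ?_) fun w hw hne => ?_
      · have := (m1.1 hw).resolve_left hne
        simpa using h.Mpos w this.2 this.1
      · by_cases hwy : w = y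
        · subst hwy
          exact Or.inr ⟨by simp [h.My], dotAt_pos hyz.symm⟩
        · exact Or.inl (by simpa using h.Mneg w ((m2.1 hw).resolve_left hwy) hne)
    obtain ⟨l, hl, hs⟩ := hsep.glue hl₁ hl₂
    have hcard := hsep.card
    have hxz : x ≠ z := by
      rintro rfl
      exact hzq hxχ
    have hc := hsep.card_add_two_le_of_mono (χ := χ) (e := (q, x)) (by rwa [hunion])
      (mem_crossPairs.2 ⟨⟨h.ne_of_mem h.q_mem h.z_mem, qU₁⟩, ⟨hxz, m2.2 (Or.inr hx)⟩,
        by rwa [hunion]⟩) hzq.symm (by simpa [hxχ] using hzq.symm)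
    rw [hunion] at hl hcard hc
    exact ⟨l, hl, by omega⟩

/-- Gluing along a tangent edge of the side of `q` when the end of the inner tangent has the
colour of `q`. -/
theorem exists_path_of_eq (h : TangentCut χ U T₁ T₂ q b g y z L M F) (hU : GenPos U)
    (ih : PathsBelow χ U.card) (hextq : Extr U q) (hextb : Extr U b) (hy : χ y = χ q) :
    ∃ l, IsAltPath χ U q b l ∧
      crossSum (pathEdges l) + (biEdges χ U).card + 2 ≤ 2 * U.card := by
  have mT : ∀ {w}, w ∈ T₁.erase q ↔ w ≠ q ∧ w ∈ T₁ := Finset.mem_erase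
  have hgq : g ≠ q := fun hh => h.gχ (hh ▸ rfl)
  have hMb : M b ≤ 0 := by
    by_cases hbz : b = z
    · rw [hbz, h.Mz]
    · exact (h.Mneg b h.b_mem hbz).le
  have hTU : T₁.erase q ⊆ U := fun w hw => h.left_sub (mT.1 hw).2
  have hgT : g ∈ T₁.erase q := mT.2 ⟨hgq, h.g_mem⟩
  obtain ⟨s, hs, t, ht, hsχ, htχ, D, hD, Ds, Dt, Dpos, α, β, γ, hα, hβ, hγ, hDeq⟩ :=
    exists_visible_edge (hU.mono hTU) χ (o := b) hgT
      (mT.2 ⟨h.yq, h.y_mem⟩) (by rw [hy]; exact h.gχ) h.affL h.affM h.Lg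
      (fun w hw hne => h.Lpos w (mT.1 hw).2 (mT.1 hw).1 hne) h.My
      (fun w hw hne => h.Mpos w (mT.1 hw).2 hne) (h.Lneg b h.b_mem).le hMb
  obtain ⟨hsq, hs₁⟩ := mT.1 hs
  obtain ⟨htq, ht₁⟩ := mT.1 ht
  have hsχ' : χ s ≠ χ q := hsχ ▸ h.gχ
  have htχ' : χ t = χ q := htχ.trans hy
  have hst : s ≠ t := fun hh => hsχ' (hh ▸ htχ')
  have Dg : 0 ≤ D g := by
    by_cases h1 : g = s
    · rw [h1, Ds]
    by_cases h2 : g = t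
    · rw [h2, Dt]
    exact (Dpos g hgT h1 h2).le
  have Dq : 0 < D q := by
    have h1 := mul_lt_mul_of_pos_left h.Mlt hβ
    rw [hDeq, h.Lg] at Dg
    rw [hDeq, h.Lq]
    linarith
  have D₁ : ∀ w ∈ T₁, w ≠ s → w ≠ t → 0 < D w := fun w hw h1 h2 => by
    by_cases hwq : w = q
    · rwa [hwq]
    · exact Dpos w (mT.2 ⟨hwq, hw⟩) h1 h2
  have D₂ : ∀ w ∈ T₂, D w < 0 := fun w hw => by
    have h1 := mul_pos hα (neg_pos.2 (h.Lneg w hw))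
    have h2 : M w ≤ 0 := by
      by_cases hwz : w = z
      · rw [hwz, h.Mz]
      · exact (h.Mneg w hw hwz).le
    have h3 := mul_nonneg hβ.le (neg_nonneg.2 h2)
    rw [hDeq]
    linarith
  have hsT₂ : s ∉ T₂ := h.not_mem_both hs₁
  have htT₂ : t ∉ T₂ := h.not_mem_both ht₁
  set U₁ := T₁.erase s with hU₁
  set U₂ := insert s (insert t T₂) with hU₂
  have m1 : ∀ {w}, w ∈ U₁ ↔ w ≠ s ∧ w ∈ T₁ := Finset.mem_erase
  have m2 : ∀ {w}, w ∈ U₂ ↔ w = s ∨ w = t ∨ w ∈ T₂ := by simp [hU₂]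
  have U₁U : U₁ ⊆ U := fun w hw => h.left_sub (m1.1 hw).2
  have U₂U : U₂ ⊆ U := by
    intro w hw
    rcases m2.1 hw with rfl | rfl | hw
    exacts [h.left_sub hs₁, h.left_sub ht₁, h.right_sub hw]
  have cU₁ : U₁.card < U.card := Finset.card_lt_card (Finset.ssubset_iff_subset_ne.2
    ⟨U₁U, fun hh => (m1.1 (hh ▸ h.left_sub hs₁ : s ∈ U₁)).1 rfl⟩)
  have cU₂ : U₂.card < U.card := Finset.card_lt_card (Finset.ssubset_iff_subset_ne.2
    ⟨U₂U, fun hh => by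
      rcases m2.1 (hh ▸ h.left_sub h.q_mem : q ∈ U₂) with h1 | h1 | h1
      exacts [hsq h1.symm, htq h1.symm, h.not_mem_both h.q_mem h1]⟩)
  have hunion : U₁ ∪ U₂ = U := by
    refine subset_antisymm (Finset.union_subset U₁U U₂U) fun w hw => ?_
    rw [← h.union, Finset.mem_union] at hw
    rw [Finset.mem_union, m1, m2]
    by_cases hws : w = s
    · exact Or.inr (Or.inl hws)
    · exact hw.elim (fun hh => Or.inl ⟨hws, hh⟩) fun hh => Or.inr (Or.inr (Or.inr hh))
  have qU₁ : q ∈ U₁ := m1.2 ⟨hsq.symm, h.q_mem⟩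
  have tU₁ : t ∈ U₁ := m1.2 ⟨hst.symm, ht₁⟩
  have sU₂ : s ∈ U₂ := m2.2 (Or.inl rfl)
  have tU₂ : t ∈ U₂ := m2.2 (Or.inr (Or.inl rfl))
  have bU₂ : b ∈ U₂ := m2.2 (Or.inr (Or.inr h.b_mem))
  have eU₁ : colExc χ (χ q) U₁ = 1 := by
    rw [hU₁, colExc_erase hs₁, h.bal]
    simp [hsχ']
  have eU₂ : colExc χ (χ t) U₂ = 1 := by
    rw [htχ', hU₂, colExc_insert (by simp [hst, hsT₂]), colExc_insert htT₂, h.surplus]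
    simp [hsχ', htχ']
  have hedge : HullEdge U₂ s t := ⟨sU₂, tU₂, hst, _, hD.neg, by simp [Ds], by simp [Dt],
    fun w hw h1 h2 => by simpa using D₂ w (((m2.1 hw).resolve_left h1).resolve_left h2)⟩
  obtain ⟨x, hx, hxχ, hqx⟩ := h.left
  obtain ⟨x', hx', hxχ', hqx'⟩ := h.right
  have xU₁ : x ∈ U₁ := m1.2 ⟨fun hh => hsχ' (hh ▸ hxχ), hx⟩
  obtain ⟨l₁, hl₁, -, b₁⟩ := (ih U₁ cU₁ (hU.mono U₁U)).2 q qU₁ t tU₁ htq.symm htχ'.symm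
    (hextq.mono U₁U) ⟨D, hD, Dt, fun w hw hne => D₁ w (m1.1 hw).2 (m1.1 hw).1 hne⟩ eU₁
  have b₁ := b₁ ⟨x, hxχ, hqx.mono U₁U qU₁ xU₁⟩
  obtain ⟨l₂, hl₂, b₂, b₂'⟩ := (ih U₂ cU₂ (hU.mono U₂U)).2 t tU₂ b bU₂
    (h.ne_of_mem ht₁ h.b_mem) (htχ'.trans h.bχ.symm) hedge.ext_right (hextb.mono U₂U) eU₂
  obtain ⟨L', hsep⟩ : ∃ L', Separates U₁ U₂ t L' := by
    refine exists_separates hD.neg (isAff_dotAt t s) (by simp [Dt]) (dotAt_self _ _)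
      tU₁ tU₂ (fun w hw hne => Or.inl ?_) fun w hw hne => ?_
    · simpa using D₁ w (m1.1 hw).2 (m1.1 hw).1 hne
    · by_cases hws : w = s
      · subst hws
        exact Or.inr ⟨by simp [Ds], dotAt_pos hst.symm⟩
      · exact Or.inl (by simpa using D₂ w (((m2.1 hw).resolve_left hws).resolve_left hne))
  obtain ⟨l, hl, hsum⟩ := hsep.glue hl₁ hl₂
  have hcard := hsep.card
  have hU' : GenPos (U₁ ∪ U₂) := by rwa [hunion]
  have main : (biEdges χ U).card + 2 ≤ (biEdges χ U₁).card + (biEdges χ U₂).card ∨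
      (biEdges χ U).card ≤ (biEdges χ U₁).card + (biEdges χ U₂).card ∧
        crossSum (pathEdges l₂) + (biEdges χ U₂).card + 2 ≤ 2 * U₂.card := by
    by_cases hown : ∃ x, χ x = χ t ∧ HullEdge U₂ t x
    · have := hsep.card_le hU' χ
      rw [hunion] at this
      exact Or.inr ⟨this, b₂' hown⟩
    · have := hsep.card_add_two_le_of_junction_mono (e := (q, x')) hU'
        (fun x hx hc => hown ⟨x, hc, hx⟩)
        (mem_crossPairs.2 ⟨⟨htq.symm, qU₁⟩, ⟨(h.ne_of_mem ht₁ hx').symm,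
          m2.2 (Or.inr (Or.inr hx'))⟩, by rwa [hunion]⟩) hxχ'.symm
      rw [hunion] at this
      exact Or.inl this
  rw [hunion] at hl hcard
  refine ⟨l, hl, ?_⟩
  rcases main with main | main <;> omega

end TangentCut

theorem surplusPaths_of_below {χ : Pt → Bool} {U : Finset Pt} (hU : GenPos U)
    (ih : PathsBelow χ U.card) : SurplusPaths χ U := by
  intro q hq b hb hqb hχ hextq hextb hex
  by_cases hopp : ∃ x, χ x ≠ χ q ∧ HullEdge U q x
  · obtain ⟨x, hx, hedge⟩ := hopp
    exact exists_path_of_opposite_neighbor hU ih hb hqb hχ hextb hex hedge hx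
  · obtain ⟨T₁, T₂, g, y, z, L, M, F, h⟩ := exists_tangentCut hU hq hb hqb hχ hextq hex
      fun x hx => by
        by_contra hc
        exact hopp ⟨x, hc, hx⟩
    obtain ⟨l, hl, hbd⟩ : ∃ l, IsAltPath χ U q b l ∧
        crossSum (pathEdges l) + (biEdges χ U).card + 2 ≤ 2 * U.card := by
      by_cases hy : χ y = χ q
      · exact h.exists_path_of_eq hU ih hextq hextb hy
      · exact h.exists_path_of_ne hU ih hextq hextb hy
    exact ⟨l, hl, by omega, fun _ => hbd⟩

theorem pathsBelow (χ : Pt → Bool) (n : ℕ) : PathsBelow χ n := by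
  induction n with
  | zero => exact fun T hT => absurd hT (Nat.not_lt_zero _)
  | succ n ih =>
    intro T hT hG
    have ih' : PathsBelow χ T.card := fun T' hT' => ih T' (by omega)
    exact ⟨balancedPaths_of_below hG ih', surplusPaths_of_below hG ih'⟩

theorem exists_path_of_good {χ : Pt → Bool} {S : Finset Pt} (hS : GenPos S) {a b : Pt}
    (ha : a ∈ S) (hb : b ∈ S) (hχ : χ a ≠ χ b) (hexta : Extr S a) (hextb : Extr S b)
    (hbal : colExc χ (χ a) S = 0) (hgood : Good χ S a b) :
    ∃ l, IsAltPath χ S a b l ∧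
      crossSum (pathEdges l) + (biEdges χ S).card + 1 ≤ 2 * S.card :=
  (pathsBelow χ _ S (Nat.lt_succ_self _) hS).1 a ha b hb hχ hexta hextb hbal hgood

/-! ### Hull points and hull lists -/

theorem GeneralPosition.genPos {S : Finset Pt} (h : GeneralPosition S) : GenPos S := by
  intro p hp q hq r hr hpq hpr hqr h0
  refine h p hp q hq r hr hpq hpr hqr ?_
  rw [collinear_iff_of_mem (p₀ := p) (by simp)]
  refine ⟨q - p, fun x hx => ?_⟩
  have hd := dotAt_pos hpq
  have hd' := hd.ne'
  rcases hx with rfl | rfl | rfl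
  · exact ⟨0, by simp⟩
  · exact ⟨1, by simp⟩
  · refine ⟨dotAt p q x / dotAt p q q, ?_⟩
    simp only [det2] at h0
    have h1 : x.1 - p.1 = dotAt p q x / dotAt p q q * (q.1 - p.1) := by
      rw [div_mul_eq_mul_div, eq_div_iff hd']
      simp only [dotAt]
      linear_combination (-(q.2 - p.2)) * h0
    have h2 : x.2 - p.2 = dotAt p q x / dotAt p q q * (q.2 - p.2) := by
      rw [div_mul_eq_mul_div, eq_div_iff hd']
      simp only [dotAt]
      linear_combination (q.1 - p.1) * h0
    ext <;> simp only [vadd_eq_add, Prod.fst_add, Prod.snd_add, Prod.smul_fst, Prod.smul_snd,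
      Prod.fst_sub, Prod.snd_sub, smul_eq_mul]
    · linarith
    · linarith

theorem mem_hullPts_iff {S : Finset Pt} {p : Pt} : p ∈ hullPts S ↔ p ∈ S ∧ Extr S p := by
  rw [hullPts, Finset.mem_filter, and_congr_right_iff]
  intro hp
  constructor
  · intro h
    obtain ⟨f, u, h1, h2⟩ := geometric_hahn_banach_closed_point (convex_convexHull ℝ _)
      ((S.erase p).finite_toSet.isClosed_convexHull ℝ) h
    have key : ∀ w : Pt, f w = f (1, 0) * w.1 + f (0, 1) * w.2 := fun w => by
      have : w = w.1 • ((1, 0) : Pt) + w.2 • ((0, 1) : Pt) := by ext <;> simp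
      conv_lhs => rw [this, map_add, map_smul, map_smul]
      simp only [smul_eq_mul]
      ring
    refine ⟨fun w => f p - f w, ⟨-f (1, 0), -f (0, 1), f p, fun w => ?_⟩, sub_self _,
      fun w hw hne => ?_⟩
    · simp only [key w]
      ring
    · have := h1 w (subset_convexHull ℝ _ (Finset.mem_coe.2 (Finset.mem_erase.2 ⟨hne, hw⟩)))
      linarith
  · rintro ⟨f, hf, fp, hpos⟩ h
    have hconv : Convex ℝ {w | 0 < f w} := by
      intro x hx y hy α β hα hβ hαβ
      simp only [Set.mem_ofPred_eq] at hx hy ⊢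
      rw [hf.combo x y hαβ]
      rcases hα.eq_or_lt with rfl | hα
      · rw [zero_add] at hαβ
        simpa [hαβ] using hy
      · have := mul_pos hα hx
        have := mul_nonneg hβ hy.le
        linarith
    have : p ∈ {w | 0 < f w} := convexHull_min (fun w hw => by
      obtain ⟨h1, h2⟩ := Finset.mem_erase.1 (Finset.mem_coe.1 hw)
      exact hpos w h2 h1) hconv h
    simp [fp] at this

theorem nonneg_of_nonneg_hullPts {S : Finset Pt} {f : Pt → ℝ} (hf : IsAff f)
    (h : ∀ w ∈ hullPts S, 0 ≤ f w) {w : Pt} (hw : w ∈ S) : 0 ≤ f w := by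
  have hconv : Convex ℝ {w | 0 ≤ f w} := by
    intro x hx y hy α β hα hβ hαβ
    simp only [Set.mem_ofPred_eq] at hx hy ⊢
    rw [hf.combo x y hαβ]
    positivity
  have hsub : (convexHull ℝ (S : Set Pt)).extremePoints ℝ ⊆ (hullPts S : Set Pt) := by
    intro x hx
    have hxS : x ∈ S := extremePoints_convexHull_subset hx
    rw [(convex_convexHull ℝ _).mem_extremePoints_iff_mem_sdiff_convexHull_sdiff] at hx
    refine Finset.mem_coe.2 (Finset.mem_filter.2 ⟨hxS, fun hh => hx.2 (convexHull_mono ?_ hh)⟩)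
    intro y hy
    obtain ⟨h1, h2⟩ := Finset.mem_erase.1 (Finset.mem_coe.1 hy)
    exact ⟨subset_convexHull ℝ _ h2, h1⟩
  have h1 := closure_convexHull_extremePoints (S.finite_toSet.isCompact_convexHull ℝ)
    (convex_convexHull ℝ _)
  have h2 : w ∈ closure (convexHull ℝ ((convexHull ℝ (S : Set Pt)).extremePoints ℝ)) := by
    rw [h1]
    exact subset_convexHull ℝ _ hw
  have h3 : closure (convexHull ℝ ((convexHull ℝ (S : Set Pt)).extremePoints ℝ)) ⊆
      convexHull ℝ (hullPts S : Set Pt) :=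
    closure_minimal (convexHull_mono hsub) ((hullPts S).finite_toSet.isClosed_convexHull ℝ)
  exact convexHull_min (fun x hx => h x hx) hconv (h3 h2)

theorem cycPred_injective {m : ℕ} (hm : 0 < m) : Function.Injective (cycPred hm) := by
  intro i j h
  have h1 : (i.val + (m - 1)) ≡ (j.val + (m - 1)) [MOD m] := Fin.mk.inj_iff.1 h
  have h2 := Nat.ModEq.add_right_cancel' _ h1
  exact Fin.ext (Nat.ModEq.eq_of_lt_of_lt h2 i.2 j.2)

theorem cycPred_cycSucc {m : ℕ} (hm : 0 < m) (i : Fin m) : cycPred hm (cycSucc hm i) = i := by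
  refine Fin.ext ?_
  simp only [cycPred, cycSucc, Nat.mod_add_mod]
  rw [show i.val + 1 + (m - 1) = i.val + m by omega, Nat.add_mod_right, Nat.mod_eq_of_lt i.2]

theorem IsHullList.dirEdge {S : Finset Pt} (hS : GenPos S) {m : ℕ} (hm : 0 < m) {pt : Fin m → Pt}
    (h : IsHullList S pt) {i : Fin m} (hne : pt i ≠ pt (cycPred hm i)) :
    DirEdge S (pt i) (pt (cycPred hm i)) := by
  obtain ⟨⟨hinj, hcw⟩, himg⟩ := h
  have mem : ∀ k, pt k ∈ S := fun k =>
    (mem_hullPts_iff.1 (himg ▸ Finset.mem_image_of_mem _ (Finset.mem_univ k))).1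
  have hlist : ∀ k, k ≠ i → k ≠ cycPred hm i → 0 < det2 (pt i) (pt (cycPred hm i)) (pt k) := by
    intro k hki hkp
    have hki' : k.val ≠ i.val := fun hh => hki (Fin.ext hh)
    have hkp' : k.val ≠ (cycPred hm i).val := fun hh => hkp (Fin.ext hh)
    have hk := k.2
    rcases Nat.eq_zero_or_pos i.val with h0 | h0
    · have hp : (cycPred hm i).val = m - 1 := by
        simp only [cycPred, h0, zero_add]
        exact Nat.mod_eq_of_lt (by omega)
      have := hcw i k (cycPred hm i) (Fin.lt_def.2 (by omega)) (Fin.lt_def.2 (by omega))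
      simp only [det2] at this ⊢
      linarith
    · have hp : (cycPred hm i).val = i.val - 1 := by
        simp only [cycPred]
        rw [show i.val + (m - 1) = (i.val - 1) + m by omega, Nat.add_mod_right]
        exact Nat.mod_eq_of_lt (by omega)
      rcases lt_or_gt_of_ne hki' with hlt | hlt
      · have := hcw k (cycPred hm i) i (Fin.lt_def.2 (by omega)) (Fin.lt_def.2 (by omega))
        rw [← det2_rot, det2_swap] at this
        linarith
      · have := hcw (cycPred hm i) i k (Fin.lt_def.2 (by omega)) (Fin.lt_def.2 (by omega))
        rw [det2_swap] at this
        linarith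
  refine ⟨mem _, mem _, hne, fun w hw h1 h2 => ?_⟩
  refine lt_of_le_of_ne (nonneg_of_nonneg_hullPts (isAff_det2 _ _) (fun x hx => ?_) hw)
    (hS _ (mem _) _ (mem _) w hw hne h1.symm h2.symm).symm
  rw [← himg, Finset.mem_image] at hx
  obtain ⟨k, -, rfl⟩ := hx
  by_cases hki : k = i
  · rw [hki, det2_left]
  by_cases hkp : k = cycPred hm i
  · rw [hkp, det2_right]
  exact (hlist k hki hkp).le

theorem runCount_of_exists {m : ℕ} (hm : 0 < m) {A C : Finset Pt} {pt : Fin m → Pt} {i : Fin m}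
    (hi : pt i ∉ A) : runCount hm A C pt =
      (Finset.univ.filter fun i : Fin m => pt i ∈ A ∧ pt (cycPred hm i) ∈ C).card :=
  if_neg fun h => hi (h i)

theorem card_filter_cycPred_comm {m : ℕ} (hm : 0 < m) {A C : Finset Pt} {pt : Fin m → Pt}
    (hAC : ∀ i, pt i ∈ C ↔ pt i ∉ A) :
    (Finset.univ.filter fun i : Fin m => pt i ∈ A ∧ pt (cycPred hm i) ∈ C).card =
      (Finset.univ.filter fun i : Fin m => pt i ∈ C ∧ pt (cycPred hm i) ∈ A).card := by
  have h1 := Finset.card_filter_add_card_filter_not (s := Finset.univ.filter fun i => pt i ∈ A)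
    fun i => pt (cycPred hm i) ∈ A
  have h2 := Finset.card_filter_add_card_filter_not
    (s := Finset.univ.filter fun i => pt (cycPred hm i) ∈ A) fun i => pt i ∈ A
  have h3 : (Finset.univ.filter fun i => pt (cycPred hm i) ∈ A).card =
      (Finset.univ.filter fun i => pt i ∈ A).card := by
    refine Finset.card_bij (fun i _ => cycPred hm i) (fun i hi => by simpa using hi)
      (fun i _ j _ hij => cycPred_injective hm hij) fun j hj => ?_
    obtain ⟨i, rfl⟩ := Finite.surjective_of_injective (cycPred_injective hm) j
    exact ⟨i, by simpa using hj, rfl⟩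
  simp only [Finset.filter_filter, ← hAC] at h1 h2
  have h4 : (Finset.univ.filter fun i : Fin m => pt (cycPred hm i) ∈ A ∧ pt i ∈ A) =
      Finset.univ.filter fun i : Fin m => pt i ∈ A ∧ pt (cycPred hm i) ∈ A := by
    simp only [and_comm]
  have h5 : (Finset.univ.filter fun i : Fin m => pt (cycPred hm i) ∈ A ∧ pt i ∈ C) =
      Finset.univ.filter fun i : Fin m => pt i ∈ C ∧ pt (cycPred hm i) ∈ A := by
    simp only [and_comm]
  rw [h4, h5] at h2
  omega

theorem IsHullList.two_mul_card_le {χ : Pt → Bool} {S : Finset Pt} (hS : GenPos S) {m : ℕ}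
    (hm : 0 < m) {pt : Fin m → Pt} (h : IsHullList S pt) {c : Bool} {A C : Finset Pt}
    (hA : ∀ w ∈ A, χ w = c) (hC : ∀ w ∈ C, χ w ≠ c) :
    2 * (Finset.univ.filter fun i : Fin m => pt i ∈ A ∧ pt (cycPred hm i) ∈ C).card ≤
      (biEdges χ S).card := by
  rw [card_biEdges_eq_two_mul hS χ c]
  refine Nat.mul_le_mul_left 2 (Finset.card_le_card_of_injOn
    (fun i => (pt i, pt (cycPred hm i))) (fun i hi => ?_) fun i _ j _ hij =>
      h.1.1 (Prod.ext_iff.1 hij).1)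
  obtain ⟨h1, h2⟩ := (Finset.mem_filter.1 (Finset.mem_coe.1 hi)).2
  have hne : χ (pt i) ≠ χ (pt (cycPred hm i)) := fun hh => hC _ h2 (hh ▸ hA _ h1)
  exact Finset.mem_coe.2 (Finset.mem_filter.2 ⟨mem_biEdges.2
    ⟨h.dirEdge hS hm fun hh => hne (congrArg χ hh), hne⟩, hA _ h1⟩)

/-! ### Special configurations -/

theorem balancedAt_iff {χ : Pt → Bool} {c : Bool} {A C : Finset Pt} {k : ℕ} {q : Fin k → Pt}
    (hinj : Function.Injective q) (hA : ∀ i, q i ∈ A ↔ χ (q i) = c)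
    (hC : ∀ i, q i ∈ C ↔ χ (q i) ≠ c) (j : Fin k) :
    BalancedAt A C q j ↔ colExc χ c ((Finset.univ.filter fun i => i ≤ j).image q) = -1 := by
  have h1 : colExc χ c ((Finset.univ.filter fun i => i ≤ j).image q) =
      ((Finset.univ.filter fun i : Fin k => i ≤ j ∧ q i ∈ A).card : ℤ) -
        (Finset.univ.filter fun i : Fin k => i ≤ j ∧ q i ∈ C).card := by
    rw [colExc, Finset.sum_image hinj.injOn, ← Finset.filter_filter, ← Finset.filter_filter,
      Finset.card_filter, Finset.card_filter, Nat.cast_sum, Nat.cast_sum,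
      ← Finset.sum_sub_distrib]
    refine Finset.sum_congr rfl fun i _ => ?_
    by_cases hc : χ (q i) = c <;> simp [hA, hC, hc]
  rw [BalancedAt, h1]
  omega

theorem eq_of_firstBalanced {χ : Pt → Bool} {S A C : Finset Pt} (hS : GenPos S) {a b : Pt}
    (ha : a ∈ S) (hb : b ∈ S) (hχ : χ a ≠ χ b) (hext : Extr S a)
    (hbal : colExc χ (χ a) S = 0) (hgood : ¬ Good χ S a b) (hA : ∀ w ∈ S, w ∈ A ↔ χ w = χ a)
    (hC : ∀ w ∈ S, w ∈ C ↔ χ w ≠ χ a) {k : ℕ} {q : Fin k → Pt} (hinj : Function.Injective q)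
    (himg : Finset.univ.image q = S.erase a) {σ : ℝ}
    (hord : ∀ i j : Fin k, i < j → 0 < σ * det2 a (q i) (q j)) {j : Fin k}
    (hj : FirstBalanced A C q j) : q j = b := by
  have hab : a ≠ b := fun hh => hχ (hh ▸ rfl)
  have mem : ∀ i, q i ≠ a ∧ q i ∈ S := fun i =>
    Finset.mem_erase.1 (himg ▸ Finset.mem_image_of_mem _ (Finset.mem_univ i))
  have surj : ∀ w ∈ S, w ≠ a → ∃ i, q i = w := fun w hw hne => by
    have : w ∈ Finset.univ.image q := himg ▸ Finset.mem_erase.2 ⟨hne, hw⟩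
    simpa using this
  have hiff := balancedAt_iff hinj (fun i => hA _ (mem i).2) fun i => hC _ (mem i).2
  have sgn : ∀ i i' : Fin k, i ≠ i' → (0 < σ * det2 a (q i) (q i') ↔ i < i') := by
    intro i i' hne
    refine ⟨fun h => ?_, hord i i'⟩
    by_contra hlt
    have := hord i' i (lt_of_le_of_ne (not_lt.1 hlt) hne.symm)
    rw [← det2_rot, det2_swap, det2_rot] at this
    linarith
  obtain ⟨t, rfl⟩ := surj b hb hab.symm
  by_contra hne
  have hjt : j ≠ t := fun hh => hne (hh ▸ rfl)
  have hno : ∀ p, ¬ Split χ S a p (q t) := fun p hp => hgood (Or.inr (Or.inl ⟨p, hp⟩))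
  rcases lt_or_gt_of_ne hjt with hlt | hlt
  · let u : Fin k := ⟨j.val + 1, lt_of_le_of_lt (Fin.lt_def.1 hlt) t.2⟩
    have hΛ : IsAff fun w => -(σ * det2 a (q u) w + 0 * det2 a (q u) w + 0) :=
      ((isAff_det2 a (q u)).lin (isAff_det2 a (q u)) σ 0 0).neg
    have hval : ∀ i, i ≠ u → -(σ * det2 a (q u) (q i) + 0 * det2 a (q u) (q i) + 0) =
        σ * det2 a (q i) (q u) := fun i _ => by
      rw [← det2_rot a (q i) (q u), det2_swap, det2_rot]
      ring
    have hu : ∀ i : Fin k, i < u ↔ i ≤ j := fun i => by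
      rw [Fin.lt_def, Fin.le_def]
      exact Nat.lt_succ_iff
    have hset : (S.filter fun w => 0 < -(σ * det2 a (q u) w + 0 * det2 a (q u) w + 0)) =
        (Finset.univ.filter fun i => i ≤ j).image q := by
      ext w
      simp only [Finset.mem_filter, Finset.mem_image, Finset.mem_univ, true_and]
      constructor
      · rintro ⟨hw, h0⟩
        by_cases hwa : w = a
        · simp [hwa, det2_left] at h0
        obtain ⟨i, rfl⟩ := surj w hw hwa
        have hiu : i ≠ u := by
          rintro rfl
          simp [det2_right] at h0
        rw [hval i hiu, sgn i u hiu] at h0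
        exact ⟨i, (hu i).1 h0, rfl⟩
      · rintro ⟨i, hi, rfl⟩
        have hiu := (hu i).2 hi
        exact ⟨(mem i).2, by rw [hval i hiu.ne]; exact hord i u hiu⟩
    have htu : -(σ * det2 a (q u) (q t) + 0 * det2 a (q u) (q t) + 0) ≤ 0 := by
      by_cases htu : t = u
      · simp [htu, det2_right]
      · rw [hval t htu]
        refine not_lt.1 fun h0 => ?_
        rw [sgn t u htu, hu] at h0
        exact absurd hlt (not_lt.2 h0)
    obtain ⟨p, hp⟩ := exists_split_toward (χ := χ) hS ha hext hΛ (by simp [det2_left]) hb hab.symm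
      htu (by rw [hset, (hiff j).1 hj.1]; norm_num)
    exact hno p hp
  · refine hj.2 t hlt ((hiff t).2 ?_)
    have hσ : σ ≠ 0 := by
      rintro rfl
      have := hord t j hlt
      simp at this
    have hside := colExc_side_eq_zero hS ha hb hext hχ hbal hno
      (Λ := fun w => -(σ * det2 a (q t) w + 0 * det2 a (q t) w + 0))
      ((isAff_det2 a (q t)).lin (isAff_det2 a (q t)) σ 0 0).neg (by simp [det2_left])
      (by simp [det2_right]) fun w hw h0 => by
        by_contra! hne
        refine hS a ha (q t) hb w hw hab hne.1.symm hne.2.symm ?_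
        simpa [hσ] using h0
    have hval : ∀ i, -(σ * det2 a (q t) (q i) + 0 * det2 a (q t) (q i) + 0) =
        σ * det2 a (q i) (q t) := fun i => by
      rw [← det2_rot a (q i) (q t), det2_swap, det2_rot]
      ring
    have hset : (S.filter fun w => 0 < -(σ * det2 a (q t) w + 0 * det2 a (q t) w + 0)) =
        ((Finset.univ.filter fun i => i ≤ t).image q).erase (q t) := by
      ext w
      simp only [Finset.mem_filter, Finset.mem_erase, Finset.mem_image, Finset.mem_univ, true_and]
      constructor
      · rintro ⟨hw, h0⟩
        by_cases hwa : w = a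
        · simp [hwa, det2_left] at h0
        obtain ⟨i, rfl⟩ := surj w hw hwa
        have hit : i ≠ t := by
          rintro rfl
          simp [det2_right] at h0
        rw [hval i, sgn i t hit] at h0
        exact ⟨fun hh => hit (hinj hh), i, h0.le, rfl⟩
      · rintro ⟨hwt, i, hi, rfl⟩
        have hit : i ≠ t := fun hh => hwt (hh ▸ rfl)
        exact ⟨(mem i).2, by rw [hval i]; exact hord i t (lt_of_le_of_ne hi hit)⟩
    rw [hset, colExc_erase (Finset.mem_image.2 ⟨t, by simp, rfl⟩), if_neg hχ.symm] at hside
    linarith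

theorem IsHullList.mem_of_not_good {χ : Pt → Bool} {S A : Finset Pt} (hS : GenPos S) {a b : Pt}
    (hb : b ∈ S) (hχ : χ a ≠ χ b) (hgood : ¬ Good χ S a b) (hA : ∀ w ∈ S, w ∈ A ↔ χ w = χ a)
    {m : ℕ} (hm : 0 < m) {pt : Fin m → Pt} (h : IsHullList S pt) {i : Fin m} (hi : pt i = a) :
    pt (cycPred hm i) ∈ A ∧ pt (cycSucc hm i) ∈ A := by
  have hab : b ≠ a := fun hh => hχ (hh ▸ rfl)
  have mem : ∀ k, pt k ∈ S := fun k =>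
    (mem_hullPts_iff.1 (h.2 ▸ Finset.mem_image_of_mem _ (Finset.mem_univ k))).1
  have key : ∀ x, HullEdge S a x → χ x = χ a := fun x hx => by
    by_contra hc
    by_cases hbx : b = x
    · exact hgood (Or.inl (hbx ▸ hx))
    · exact hgood (Or.inr (Or.inl ⟨x, hx.split hc hb hab hbx⟩))
  refine ⟨(hA _ (mem _)).2 ?_, (hA _ (mem _)).2 ?_⟩
  · by_cases hne : pt i = pt (cycPred hm i)
    · rw [← hne, hi]
    · exact key _ (hi ▸ (h.dirEdge hS hm hne).hullEdge)
  · have hs := cycPred_cycSucc hm i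
    by_cases hne : pt (cycSucc hm i) = pt i
    · rw [hne, hi]
    · have := h.dirEdge hS hm (i := cycSucc hm i) (by rwa [hs])
      rw [hs, hi] at this
      exact key _ this.hullEdge.symm

theorem good_of_not_specialConfig {χ : Pt → Bool} {R B : Finset Pt} (hS : GenPos (R ∪ B))
    {r b : Pt} (hr : r ∈ hullPts (R ∪ B)) (hb : b ∈ hullPts (R ∪ B))
    (hRχ : ∀ w ∈ R ∪ B, w ∈ R ↔ χ w = χ r) (hBχ : ∀ w ∈ R ∪ B, w ∈ B ↔ χ w = χ b)
    (hχ : χ r ≠ χ b) (hbal : colExc χ (χ r) (R ∪ B) = 0) (hns : ¬ SpecialConfig R B r b) :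
    Good χ (R ∪ B) r b := by
  by_contra hgood
  obtain ⟨hrS, hrx⟩ := mem_hullPts_iff.1 hr
  obtain ⟨hbS, hbx⟩ := mem_hullPts_iff.1 hb
  have hgood' : ¬ Good χ (R ∪ B) b r := fun h => hgood h.symm
  have hbal' : colExc χ (χ b) (R ∪ B) = 0 := colExc_eq_zero_of_ne hχ hbal
  have flip : ∀ x : Bool, (x = χ b ↔ x ≠ χ r) ∧ (x = χ r ↔ x ≠ χ b) := by
    revert hχ
    cases χ b <;> cases χ r <;> decide
  have hRχ' : ∀ w ∈ R ∪ B, w ∈ R ↔ χ w ≠ χ b := fun w hw => (hRχ w hw).trans (flip _).2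
  have hBχ' : ∀ w ∈ R ∪ B, w ∈ B ↔ χ w ≠ χ r := fun w hw => (hBχ w hw).trans (flip _).1
  refine hns ⟨hr, hb, fun m hm pt hpt i => ⟨fun hi => ?_, fun hi => ?_⟩, fun k q hq j hj => ?_,
    fun k q hq j hj => ?_⟩
  · exact hpt.mem_of_not_good hS hbS hχ hgood hRχ hm hi
  · exact hpt.mem_of_not_good hS hrS hχ.symm hgood' hBχ hm hi
  · rcases hq with ⟨h1, h2, h3⟩ | ⟨h1, h2, h3⟩
    · exact eq_of_firstBalanced hS hrS hbS hχ hrx hbal hgood hRχ hBχ' h1 h2 (σ := 1)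
        (fun i j hij => by simpa using h3 i j hij) hj
    · exact eq_of_firstBalanced hS hrS hbS hχ hrx hbal hgood hRχ hBχ' h1 h2 (σ := -1)
        (fun i j hij => by simpa using h3 i j hij) hj
  · rcases hq with ⟨h1, h2, h3⟩ | ⟨h1, h2, h3⟩
    · exact eq_of_firstBalanced hS hbS hrS hχ.symm hbx hbal' hgood' hBχ hRχ' h1 h2 (σ := 1)
        (fun i j hij => by simpa using h3 i j hij) hj
    · exact eq_of_firstBalanced hS hbS hrS hχ.symm hbx hbal' hgood' hBχ hRχ' h1 h2 (σ := -1)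
        (fun i j hij => by simpa using h3 i j hij) hj

/-- Lemma 2.4(i): for `S = R ∪ B` in general position with `|R| = |B| = n ≥ 1`, a red
point `r` on the hull boundary, and a blue point `b` on the hull boundary such that
`(S, r, b)` is non-special, there exists a 1-plane Hamiltonian alternating path on `S`
with endpoints `r` and `b` and at most `n − r(S) = n − b(S)` crossings. -/
theorem stmt3 (n : ℕ) (hn : 1 ≤ n) (R B : Finset Pt)
    (hdisj : Disjoint R B)
    (hgp : GeneralPosition (R ∪ B))
    (hR : R.card = n) (hB : B.card = n)
    (r b : Pt) (hr : r ∈ R) (hrh : r ∈ hullPts (R ∪ B))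
    (hb : b ∈ B) (hbh : b ∈ hullPts (R ∪ B))
    (hns : ¬ SpecialConfig R B r b) :
    ∃ P : HamAltPath R B r b,
      OnePlane (pathEdges P.verts) ∧
      ∀ (m : ℕ) (hm : 0 < m) (pt : Fin m → Pt), IsHullList (R ∪ B) pt →
        runCount hm R B pt = runCount hm B R pt ∧
        crossNum (pathEdges P.verts) ≤ n - runCount hm R B pt := by
  have hS := hgp.genPos
  have hRB : ∀ w ∈ R ∪ B, w ∈ B ↔ w ∉ R := fun w hw =>
    ⟨fun h1 h2 => Finset.disjoint_left.1 hdisj h2 h1, fun h =>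
      (Finset.mem_union.1 hw).resolve_left h⟩
  obtain ⟨hrS, hrx⟩ := mem_hullPts_iff.1 hrh
  obtain ⟨hbS, hbx⟩ := mem_hullPts_iff.1 hbh
  have hbR : b ∉ R := (hRB b hbS).1 hb
  have hrB : r ∉ B := fun h => (hRB r hrS).1 h hr
  set χ : Pt → Bool := fun p => decide (p ∈ R) with hχdef
  have hχr : χ r = true := decide_eq_true hr
  have hχb : χ b = false := decide_eq_false hbR
  have hRχ : ∀ w, w ∈ R ↔ χ w = true := fun w => by simp [hχdef]
  have hBχ : ∀ w ∈ R ∪ B, w ∈ B ↔ χ w = false := fun w hw => by simp [hχdef, hRB w hw]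
  have hχ : χ r ≠ χ b := by simp [hχr, hχb]
  have hbal : colExc χ (χ r) (R ∪ B) = 0 := by
    rw [hχr, colExc, Finset.sum_union hdisj,
      Finset.sum_congr rfl fun w hw => if_pos ((hRχ w).1 hw),
      Finset.sum_congr (s₁ := B) rfl fun w hw => if_neg (by
        simp [(hBχ w (Finset.mem_union_right _ hw)).1 hw])]
    simp [hR, hB]
  have hcard : (R ∪ B).card = 2 * n := by
    rw [Finset.card_union_of_disjoint hdisj, hR, hB, two_mul]
  obtain ⟨l, hl, hcross⟩ := exists_path_of_good hS hrS hbS hχ hrx hbx hbal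
    (good_of_not_specialConfig hS hrh hbh (fun w _ => by rw [hRχ, hχr])
      (fun w hw => by rw [hBχ w hw, hχb]) hχ hbal hns)
  refine ⟨⟨l, hl.nodup, hl.cover, hl.head, hl.last, fun e he => ?_⟩,
    onePlane_of_countP hl.onePlane, fun m hm pt hpt => ?_⟩
  · obtain ⟨h1, h2⟩ := hl.mem_of_edge he
    have h3 := hl.alt e he
    rw [Bichromatic, hRχ, hRχ, hBχ _ h1, hBχ _ h2]
    revert h3
    cases χ e.1 <;> cases χ e.2 <;> simp
  · have hmem : ∀ k, pt k ∈ R ∪ B := fun k =>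
      (mem_hullPts_iff.1 (hpt.2 ▸ Finset.mem_image_of_mem _ (Finset.mem_univ k))).1
    obtain ⟨i, -, hi⟩ := Finset.mem_image.1 (hpt.2.symm ▸ hrh)
    obtain ⟨j, -, hj⟩ := Finset.mem_image.1 (hpt.2.symm ▸ hbh)
    have hle := hpt.two_mul_card_le hS hm (χ := χ) (c := true) (A := R) (C := B)
      (fun w hw => (hRχ w).1 hw) fun w hw => by
        simp [(hBχ w (Finset.mem_union_right _ hw)).1 hw]
    rw [runCount_of_exists hm (hj ▸ hbR), runCount_of_exists hm (hi ▸ hrB)]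
    refine ⟨card_filter_cycPred_comm hm fun k => hRB _ (hmem k), ?_⟩
    have hlen : l.length = 2 * n := by
      rw [← hcard, ← hl.cover, List.toFinset_card_of_nodup hl.nodup]
    rw [crossSum_eq, length_pathEdges, hlen, hcard] at hcross
    show crossNum (pathEdges l) ≤ _
    omega
end
end
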